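/- arXiv:2601.11470 — 4 statements merged into one kernel-verified Lean document; each statement's English description precedes it below -/
import Mathlib

section
/- Let X be the middle-thirds Cantor set, s = log 2 / log 3, μ the normalized s-Hausdorff measure on X, and r = (c n^{−1/s})_{n≥1} with c > 0. (1) If c < 1.06126, then ℙ_μ({ω : X ⊆ E_r(ω)}) = 0. (2) If c > 1.37546, then ℙ_μ({ω : X ⊆ E_r(ω)}) = 1. -/
open MeasureTheory Metric Filter Set
open scoped ENNReal Topology

noncomputable section

/-- The random covering set `E_r(ω) = limsup_n B(ω_n, r_n)`. -/
def coverSet (r : ℕ → ℝ) (ω : ℕ → ℝ) : Set ℝ :=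
  ⋂ k, ⋃ n, ⋃ (_ : k ≤ n), ball (ω n) (r n)

/-- The two similarities `x ↦ x / 3` and `x ↦ 1 - x / 3` generating the Cantor set. -/
def cantorMap (e : Bool) (x : ℝ) : ℝ := if e then 1 - x / 3 else x / 3

@[simp] lemma cantorMap_false (x : ℝ) : cantorMap false x = x / 3 := rfl

@[simp] lemma cantorMap_true (x : ℝ) : cantorMap true x = 1 - x / 3 := rfl

lemma continuous_cantorMap (e : Bool) : Continuous (cantorMap e) := by
  cases e
  · exact continuous_id.div_const 3
  · exact continuous_const.sub (continuous_id.div_const 3)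

lemma measurable_cantorMap (e : Bool) : Measurable (cantorMap e) :=
  (continuous_cantorMap e).measurable

lemma one_sub_mem_preCantorSet (n : ℕ) : ∀ x ∈ preCantorSet n, 1 - x ∈ preCantorSet n := by
  induction n with
  | zero =>
    intro x hx
    rw [preCantorSet_zero, mem_Icc] at *
    constructor <;> linarith [hx.1, hx.2]
  | succ n ih =>
    rintro x (⟨y, hy, rfl⟩ | ⟨y, hy, rfl⟩)
    · exact Or.inr ⟨1 - y, ih y hy, by ring⟩
    · exact Or.inl ⟨1 - y, ih y hy, by ring⟩

lemma one_sub_mem_cantorSet {x : ℝ} (hx : x ∈ cantorSet) : 1 - x ∈ cantorSet :=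
  mem_iInter.2 fun n ↦ one_sub_mem_preCantorSet n x (mem_iInter.1 hx n)

lemma cantorMap_mem {x : ℝ} (e : Bool) (hx : x ∈ cantorSet) : cantorMap e x ∈ cantorSet := by
  rw [cantorSet_eq_union_halves]
  cases e
  · exact Or.inl ⟨x, hx, rfl⟩
  · exact Or.inr ⟨1 - x, one_sub_mem_cantorSet hx, by simp; ring⟩

lemma exists_cantorMap_eq {x : ℝ} (hx : x ∈ cantorSet) :
    ∃ e, ∃ y ∈ cantorSet, cantorMap e y = x := by
  rw [cantorSet_eq_union_halves] at hx
  rcases hx with ⟨y, hy, rfl⟩ | ⟨y, hy, rfl⟩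
  · exact ⟨false, y, hy, rfl⟩
  · exact ⟨true, 1 - y, one_sub_mem_cantorSet hy, by simp; ring⟩

lemma cantorMap_image_union :
    cantorMap false '' cantorSet ∪ cantorMap true '' cantorSet = cantorSet := by
  ext x
  constructor
  · rintro (⟨y, hy, rfl⟩ | ⟨y, hy, rfl⟩) <;> exact cantorMap_mem _ hy
  · intro hx
    obtain ⟨e, y, hy, rfl⟩ := exists_cantorMap_eq hx
    cases e
    · exact Or.inl ⟨y, hy, rfl⟩
    · exact Or.inr ⟨y, hy, rfl⟩

lemma cantorMap_injective (e : Bool) : Function.Injective (cantorMap e) := by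
  intro x y h
  cases e <;> simp only [cantorMap_false, cantorMap_true] at h <;> linarith

lemma abs_cantorMap_sub_same (e : Bool) (x y : ℝ) :
    |cantorMap e x - cantorMap e y| = |x - y| / 3 := by
  cases e
  · simp only [cantorMap_false]
    rw [← sub_div, abs_div, abs_of_pos (by norm_num : (0 : ℝ) < 3)]
  · simp only [cantorMap_true]
    rw [show 1 - x / 3 - (1 - y / 3) = (y - x) / 3 by ring, abs_div,
      abs_of_pos (by norm_num : (0 : ℝ) < 3), abs_sub_comm]

lemma abs_cantorMap_sub_not (e : Bool) {x y : ℝ} (hx : x ∈ Icc (0 : ℝ) 1)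
    (hy : y ∈ Icc (0 : ℝ) 1) :
    |cantorMap e x - cantorMap (!e) y| = (3 - x - y) / 3 := by
  obtain ⟨h1, h2⟩ := hx
  obtain ⟨h3, h4⟩ := hy
  cases e
  · simp only [cantorMap_false, cantorMap_true, Bool.not_false]
    rw [abs_of_nonpos (by linarith)]; ring
  · simp only [cantorMap_false, cantorMap_true, Bool.not_true]
    rw [abs_of_nonneg (by linarith)]; ring

/-- The expanding tent map inverting both `cantorMap false` and `cantorMap true`. -/
def tentMap (x : ℝ) : ℝ := if x ≤ 1 / 2 then 3 * x else 3 - 3 * x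

lemma tentMap_cantorMap (e : Bool) {x : ℝ} (hx : x ∈ Icc (0 : ℝ) 1) :
    tentMap (cantorMap e x) = x := by
  obtain ⟨h1, h2⟩ := hx
  cases e
  · rw [tentMap, cantorMap_false, if_pos (by linarith)]; ring
  · rw [tentMap, cantorMap_true, if_neg (by linarith)]; ring

lemma measurable_tentMap : Measurable tentMap :=
  Measurable.ite measurableSet_Iic (by fun_prop) (by fun_prop)

/-- A probability measure on the Cantor set which is self-similar with weights `w`. -/
structure IsSelfSimilar (w : Bool → ℝ) (ν : Measure ℝ) : Prop where
  nonneg : ∀ e, 0 ≤ w e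
  add_eq_one : w false + w true = 1
  univ_eq : ν univ = 1
  compl_eq : ν cantorSetᶜ = 0
  eq_add : ν = ENNReal.ofReal (w false) • ν.map (cantorMap false) +
    ENNReal.ofReal (w true) • ν.map (cantorMap true)

namespace IsSelfSimilar

variable {w : Bool → ℝ} {ν : Measure ℝ}

lemma isProbabilityMeasure (h : IsSelfSimilar w ν) : IsProbabilityMeasure ν := ⟨h.univ_eq⟩

lemma ae_mem (h : IsSelfSimilar w ν) : ∀ᵐ x ∂ν, x ∈ cantorSet := by
  rw [ae_iff]; exact h.compl_eq

lemma ae_mem_Icc (h : IsSelfSimilar w ν) : ∀ᵐ x ∂ν, x ∈ Icc (0 : ℝ) 1 :=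
  h.ae_mem.mono fun _ hx ↦ cantorSet_subset_unitInterval hx

lemma apply_eq (h : IsSelfSimilar w ν) {A : Set ℝ} (hA : MeasurableSet A) :
    ν A = ENNReal.ofReal (w false) * ν (cantorMap false ⁻¹' A) +
      ENNReal.ofReal (w true) * ν (cantorMap true ⁻¹' A) := by
  conv_lhs => rw [h.eq_add]
  simp [Measure.map_apply (measurable_cantorMap _) hA]

lemma integral_eq (h : IsSelfSimilar w ν) {f : ℝ → ℝ} (hf : Measurable f)
    (hi : ∀ e, Integrable (fun x ↦ f (cantorMap e x)) ν) :
    ∫ x, f x ∂ν = w false * ∫ x, f (cantorMap false x) ∂ν +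
      w true * ∫ x, f (cantorMap true x) ∂ν := by
  have hm : ∀ e, Integrable f (ENNReal.ofReal (w e) • ν.map (cantorMap e)) := fun e ↦
    ((integrable_map_measure hf.aestronglyMeasurable
      (measurable_cantorMap e).aemeasurable).2 (hi e)).smul_measure ENNReal.ofReal_ne_top
  conv_lhs => rw [h.eq_add]
  rw [integral_add_measure (hm _) (hm _), integral_smul_measure, integral_smul_measure,
    integral_map (measurable_cantorMap _).aemeasurable hf.aestronglyMeasurable,
    integral_map (measurable_cantorMap _).aemeasurable hf.aestronglyMeasurable,
    ENNReal.toReal_ofReal (h.nonneg _), ENNReal.toReal_ofReal (h.nonneg _)]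
  simp

lemma integrable_of_continuous (h : IsSelfSimilar w ν) {f : ℝ → ℝ} (hf : Continuous f) :
    Integrable f ν := by
  have := h.isProbabilityMeasure
  have h1 := hf.continuousOn.integrableOn_compact (μ := ν) isCompact_cantorSet
  rwa [IntegrableOn, Measure.restrict_eq_self_of_ae_mem h.ae_mem] at h1

lemma measurePreserving_tentMap (h : IsSelfSimilar w ν) : MeasurePreserving tentMap ν ν := by
  have := h.isProbabilityMeasure
  refine ⟨measurable_tentMap, ?_⟩
  ext A hA
  rw [Measure.map_apply measurable_tentMap hA, h.apply_eq (measurable_tentMap hA)]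
  have key : ∀ e, ν (cantorMap e ⁻¹' (tentMap ⁻¹' A)) = ν A := fun e ↦ by
    refine measure_congr (h.ae_mem_Icc.mono fun x hx ↦ ?_)
    change (tentMap (cantorMap e x) ∈ A) = (x ∈ A)
    rw [tentMap_cantorMap e hx]
  rw [key, key, ← add_mul, ← ENNReal.ofReal_add (h.nonneg _) (h.nonneg _), h.add_eq_one]
  simp

lemma measure_ball_cantorMap_le (h : IsSelfSimilar w ν) (e : Bool) {x ρ : ℝ}
    (hx : x ∈ cantorSet) (hρ : ρ ≤ 1) :
    ν (ball (cantorMap e x) (ρ / 3)) ≤ ENNReal.ofReal (w e) * ν (ball x ρ) := by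
  have h0 : ∀ e', ν (cantorMap e' ⁻¹' ball (cantorMap e x) (ρ / 3)) ≤
      if e' = e then ν (ball x ρ) else 0 := by
    intro e'
    split_ifs with he
    · subst he
      refine measure_mono fun y hy ↦ ?_
      rw [mem_preimage, mem_ball, Real.dist_eq, abs_cantorMap_sub_same] at hy
      rw [mem_ball, Real.dist_eq]; linarith
    · refine (measure_mono_null (fun y hy hyI ↦ ?_) (ae_iff.1 h.ae_mem_Icc)).le
      obtain rfl : e' = !e := by cases e <;> cases e' <;> simp_all
      rw [mem_preimage, mem_ball, Real.dist_eq, abs_sub_comm,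
        abs_cantorMap_sub_not e (cantorSet_subset_unitInterval hx) hyI] at hy
      have := (cantorSet_subset_unitInterval hx).2
      linarith [hyI.2]
  rw [h.apply_eq measurableSet_ball]
  have h1 := h0 false
  have h2 := h0 true
  cases e
  · simp only [reduceCtorEq, if_true, if_false, nonpos_iff_eq_zero] at h1 h2
    rw [h2, mul_zero, add_zero]
    gcongr
  · simp only [reduceCtorEq, if_true, if_false, nonpos_iff_eq_zero] at h1 h2
    rw [h1, mul_zero, zero_add]
    gcongr

end IsSelfSimilar

/-- The first symbol in the coding of a point of the Cantor set by `cantorMap`. -/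
def cantorDigit (x : ℝ) : Bool := !decide (x ≤ 1 / 2)

lemma cantorDigit_cantorMap (e : Bool) {x : ℝ} (hx : x ∈ Icc (0 : ℝ) 1) :
    cantorDigit (cantorMap e x) = e := by
  obtain ⟨h1, h2⟩ := hx
  cases e
  · rw [cantorDigit, cantorMap_false, decide_eq_true (by linarith)]; rfl
  · rw [cantorDigit, cantorMap_true, decide_eq_false (by linarith)]; rfl

lemma IsSelfSimilar.measure_ball_le {w : Bool → ℝ} {ν : Measure ℝ} (h : IsSelfSimilar w ν)
    (n : ℕ) : ∀ x ∈ cantorSet, ν (ball x ((1 / 3) ^ n)) ≤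
      ENNReal.ofReal (∏ i ∈ Finset.range n, w (cantorDigit (tentMap^[i] x))) := by
  have := h.isProbabilityMeasure
  induction n with
  | zero => intro x _; simpa using prob_le_one
  | succ n ih =>
    intro x hx
    obtain ⟨e, y, hy, rfl⟩ := exists_cantorMap_eq hx
    have hy' := cantorSet_subset_unitInterval hy
    rw [Finset.prod_range_succ', mul_comm, ENNReal.ofReal_mul (h.nonneg _)]
    simp only [Function.iterate_succ_apply, Function.iterate_zero, id, tentMap_cantorMap e hy',
      cantorDigit_cantorMap e hy']
    rw [show ((1 : ℝ) / 3) ^ (n + 1) = (1 / 3) ^ n / 3 by ring]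
    refine (h.measure_ball_cantorMap_le e hy (pow_le_one₀ (by norm_num) (by norm_num))).trans ?_
    gcongr
    exact ih y hy

/-- The sign of the derivative of the composition of the first `n` maps coded by `e`. -/
def codingSign (e : ℕ → Bool) (n : ℕ) : ℝ := ∏ i ∈ Finset.range n, if e i then -1 else 1

/-- The point of the Cantor set coded by a sequence of symbols. -/
def codingMap (e : ℕ → Bool) : ℝ :=
  ∑' n, codingSign e n * (1 / 3) ^ n * (if e n then 1 else 0)

lemma norm_codingMap_term_le (e : ℕ → Bool) (n : ℕ) :
    ‖codingSign e n * (1 / 3) ^ n * (if e n then 1 else 0)‖ ≤ ((1 : ℝ) / 3) ^ n := by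
  have h1 : |codingSign e n| = 1 := by
    rw [codingSign, Finset.abs_prod]
    exact Finset.prod_eq_one fun i _ ↦ by split_ifs <;> simp
  rw [norm_mul, norm_mul, Real.norm_eq_abs, h1, one_mul, Real.norm_of_nonneg (by positivity)]
  refine mul_le_of_le_one_right (by positivity) ?_
  split_ifs <;> simp

lemma summable_codingMap (e : ℕ → Bool) :
    Summable fun n ↦ codingSign e n * (1 / 3) ^ n * (if e n then (1 : ℝ) else 0) :=
  .of_norm_bounded (summable_geometric_of_lt_one (by norm_num) (by norm_num))
    (norm_codingMap_term_le e)

lemma codingMap_eq (e : ℕ → Bool) :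
    codingMap e = cantorMap (e 0) (codingMap fun n ↦ e (n + 1)) := by
  have h : ∀ n, codingSign e (n + 1) * (1 / 3) ^ (n + 1) * (if e (n + 1) then (1 : ℝ) else 0) =
      (if e 0 then -1 else 1) / 3 * (codingSign (fun n ↦ e (n + 1)) n * (1 / 3) ^ n *
        (if e (n + 1) then (1 : ℝ) else 0)) := fun n ↦ by
    rw [codingSign, codingSign, Finset.prod_range_succ']; ring
  rw [codingMap, (summable_codingMap e).tsum_eq_zero_add]
  simp_rw [h]
  rw [tsum_mul_left, codingMap]
  cases e 0 <;> simp [codingSign] <;> ring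

lemma codingMap_mem_cantorSet (e : ℕ → Bool) : codingMap e ∈ cantorSet := by
  have hb : ∀ e, |codingMap e| ≤ 3 / 2 := fun e ↦ by
    have h1 := tsum_of_norm_bounded
      (hasSum_geometric_of_lt_one (r := (1 : ℝ) / 3) (by norm_num) (by norm_num))
      (norm_codingMap_term_le e)
    rw [← Real.norm_eq_abs]
    exact h1.trans (by norm_num)
  have key : ∀ n e, infDist (codingMap e) cantorSet ≤ 2 * (1 / 3) ^ n := by
    intro n
    induction n with
    | zero =>
      intro e
      refine (infDist_le_dist_of_mem zero_mem_cantorSet).trans ?_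
      rw [Real.dist_eq, sub_zero]
      linarith [hb e]
    | succ n ih =>
      intro e
      rw [codingMap_eq]
      refine le_of_forall_pos_lt_add fun ε hε ↦ ?_
      obtain ⟨y, hy, hy'⟩ := (infDist_lt_iff ⟨0, zero_mem_cantorSet⟩).1
        ((ih fun n ↦ e (n + 1)).trans_lt (lt_add_of_pos_right _ hε))
      refine (infDist_le_dist_of_mem (cantorMap_mem (e 0) hy)).trans_lt ?_
      rw [Real.dist_eq] at hy' ⊢
      rw [abs_cantorMap_sub_same, pow_succ]
      linarith
  rw [isClosed_cantorSet.mem_iff_infDist_zero ⟨0, zero_mem_cantorSet⟩]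
  have ht : Tendsto (fun n : ℕ ↦ 2 * ((1 : ℝ) / 3) ^ n) atTop (𝓝 0) := by
    simpa using (tendsto_pow_atTop_nhds_zero_of_lt_one (r := (1 : ℝ) / 3) (by norm_num)
      (by norm_num)).const_mul 2
  exact le_antisymm (ge_of_tendsto' ht fun n ↦ key n e) infDist_nonneg

lemma measurable_codingMap : Measurable codingMap := by
  have h : Continuous codingMap := by
    refine continuous_tsum (fun n ↦ ?_)
      (summable_geometric_of_lt_one (r := (1 : ℝ) / 3) (by norm_num) (by norm_num))
      (fun n e ↦ norm_codingMap_term_le e n)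
    have h1 : ∀ (a b : ℝ) (i : ℕ), Continuous fun e : ℕ → Bool ↦ if e i then a else b :=
      fun a b i ↦ (continuous_of_discreteTopology (f := fun t : Bool ↦ if t then a else b)).comp
        (continuous_apply i)
    unfold codingSign
    exact ((continuous_finsetProd _ fun i _ ↦ h1 _ _ i).mul continuous_const).mul (h1 _ _ n)
  exact h.measurable

/-- The measure on `Bool` with weights `w`. -/
def boolMeasure (w : Bool → ℝ) : Measure Bool :=
  ENNReal.ofReal (w false) • Measure.dirac false + ENNReal.ofReal (w true) • Measure.dirac true

/-- Prepend a symbol to a sequence. -/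
def consSeq (e : Bool) (q : ℕ → Bool) : ℕ → Bool
  | 0 => e
  | n + 1 => q n

lemma measurable_consSeq : Measurable fun q : Bool × (ℕ → Bool) ↦ consSeq q.1 q.2 := by
  refine measurable_pi_lambda _ fun n ↦ ?_
  cases n
  · exact measurable_fst
  · exact (measurable_pi_apply _).comp measurable_snd

lemma map_consSeq_infinitePi (m : Measure Bool) [IsProbabilityMeasure m] :
    (m.prod (Measure.infinitePi fun _ : ℕ ↦ m)).map (fun q ↦ consSeq q.1 q.2) =
      Measure.infinitePi fun _ : ℕ ↦ m := by
  refine Measure.eq_infinitePi _ fun s t ht ↦ ?_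
  classical
  obtain ⟨n, hn⟩ := s.bddAbove
  have hs : s ⊆ Finset.range (n + 1) := fun i hi ↦ Finset.mem_range.2 (Nat.lt_succ_of_le (hn hi))
  let t' : ℕ → Set Bool := fun i ↦ if i ∈ s then t i else univ
  have e1 : (s : Set ℕ).pi t = (Finset.range (n + 1) : Set ℕ).pi t' := by
    ext q
    simp only [Set.mem_pi, Finset.mem_coe, t']
    constructor
    · intro h i _
      split_ifs with h'
      · exact h i h'
      · trivial
    · intro h i hi
      simpa [hi] using h i (hs hi)
  have e2 : ∏ i ∈ s, m (t i) = ∏ i ∈ Finset.range (n + 1), m (t' i) := by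
    rw [← Finset.prod_subset hs (f := fun i ↦ m (t' i)) fun i _ hi ↦ by
      rw [show t' i = univ from if_neg hi, measure_univ]]
    exact Finset.prod_congr rfl fun i hi ↦ by simp [t', hi]
  have e3 : (fun q : Bool × (ℕ → Bool) ↦ consSeq q.1 q.2) ⁻¹'
      (Finset.range (n + 1) : Set ℕ).pi t' =
        t' 0 ×ˢ (Finset.range n : Set ℕ).pi fun i ↦ t' (i + 1) := by
    ext ⟨a, q⟩
    simp only [mem_preimage, Set.mem_pi, Finset.mem_coe, Finset.mem_range, mem_prod]
    constructor
    · exact fun h ↦ ⟨h 0 (by lia), fun i hi ↦ h (i + 1) (by lia)⟩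
    · rintro ⟨h1, h2⟩ (_ | i) hi
      · exact h1
      · exact h2 i (by lia)
  have hmt : MeasurableSet ((Finset.range (n + 1) : Set ℕ).pi t') :=
    MeasurableSet.pi (Finset.range (n + 1)).countable_toSet fun i _ ↦ .of_discrete
  rw [e1, e2, Measure.map_apply measurable_consSeq hmt, e3, Measure.prod_prod,
    Measure.infinitePi_pi _ fun i _ ↦ .of_discrete, Finset.prod_range_succ', mul_comm]

theorem exists_isSelfSimilar {w : Bool → ℝ} (h0 : ∀ e, 0 ≤ w e)
    (h1 : w false + w true = 1) : ∃ ν, IsSelfSimilar w ν := by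
  have hp : IsProbabilityMeasure (boolMeasure w) := ⟨by
    simp [boolMeasure, ← ENNReal.ofReal_add (h0 _) (h0 _), h1]⟩
  refine ⟨(Measure.infinitePi fun _ : ℕ ↦ boolMeasure w).map codingMap, h0, h1, ?_, ?_, ?_⟩
  · rw [Measure.map_apply measurable_codingMap MeasurableSet.univ]; simp
  · rw [Measure.map_apply measurable_codingMap isClosed_cantorSet.measurableSet.compl,
      show codingMap ⁻¹' cantorSetᶜ = ∅ from
        eq_empty_of_forall_notMem fun e he ↦ he (codingMap_mem_cantorSet e), measure_empty]
  · have hc : ∀ e, codingMap ∘ consSeq e = cantorMap e ∘ codingMap := fun e ↦ by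
      ext q
      exact codingMap_eq _
    have hm : ∀ e, Measurable (consSeq e) := fun e ↦
      measurable_consSeq.comp measurable_prodMk_left
    have key : (Measure.infinitePi fun _ : ℕ ↦ boolMeasure w) =
        ENNReal.ofReal (w false) •
          (Measure.infinitePi fun _ : ℕ ↦ boolMeasure w).map (consSeq false) +
        ENNReal.ofReal (w true) •
          (Measure.infinitePi fun _ : ℕ ↦ boolMeasure w).map (consSeq true) := by
      ext A hA
      conv_lhs => rw [← map_consSeq_infinitePi, Measure.map_apply measurable_consSeq hA,
        Measure.prod_apply (measurable_consSeq hA), boolMeasure]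
      rw [lintegral_add_measure, lintegral_smul_measure, lintegral_smul_measure,
        lintegral_dirac, lintegral_dirac]
      simp only [Measure.coe_add, Measure.coe_smul, Pi.add_apply, Pi.smul_apply,
        Measure.map_apply (hm _) hA]
      rfl
    conv_lhs => rw [key]
    rw [Measure.map_add _ _ measurable_codingMap, Measure.map_smul, Measure.map_smul,
      Measure.map_map measurable_codingMap (hm _), Measure.map_map measurable_codingMap (hm _),
      hc, hc, Measure.map_map (measurable_cantorMap _) measurable_codingMap,
      Measure.map_map (measurable_cantorMap _) measurable_codingMap]

/-- The images of `0` under the compositions of `m` maps `cantorMap e`. -/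
def cantorPoints : ℕ → Finset ℝ
  | 0 => {0}
  | m + 1 => (cantorPoints m).image (cantorMap false) ∪ (cantorPoints m).image (cantorMap true)

lemma mem_cantorPoints_succ {m : ℕ} {x : ℝ} :
    x ∈ cantorPoints (m + 1) ↔ ∃ e, ∃ y ∈ cantorPoints m, cantorMap e y = x := by
  simp only [cantorPoints, Finset.mem_union, Finset.mem_image, Bool.exists_bool]

lemma mem_cantorSet_of_mem_cantorPoints (m : ℕ) : ∀ x ∈ cantorPoints m, x ∈ cantorSet := by
  induction m with
  | zero => intro x hx; rw [Finset.mem_singleton.1 hx]; exact zero_mem_cantorSet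
  | succ m ih =>
    intro x hx
    obtain ⟨e, y, hy, rfl⟩ := mem_cantorPoints_succ.1 hx
    exact cantorMap_mem e (ih y hy)

lemma exists_mem_cantorPoints (m : ℕ) :
    ∀ x ∈ cantorSet, ∃ y ∈ cantorPoints m, |x - y| ≤ (1 / 3) ^ m := by
  induction m with
  | zero =>
    intro x hx
    obtain ⟨h1, h2⟩ := cantorSet_subset_unitInterval hx
    exact ⟨0, Finset.mem_singleton_self 0, by rw [sub_zero, abs_of_nonneg h1]; simpa using h2⟩
  | succ m ih =>
    intro x hx
    obtain ⟨e, x, hx', rfl⟩ := exists_cantorMap_eq hx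
    obtain ⟨y, hy, h⟩ := ih x hx'
    refine ⟨_, mem_cantorPoints_succ.2 ⟨e, y, hy, rfl⟩, ?_⟩
    rw [abs_cantorMap_sub_same, pow_succ]
    linarith

lemma sum_cantorPoints_succ_le (m : ℕ) {f : ℝ → ℝ} (hf : ∀ x, 0 ≤ f x) :
    ∑ x ∈ cantorPoints (m + 1), f x ≤
      ∑ x ∈ cantorPoints m, (f (cantorMap false x) + f (cantorMap true x)) := by
  have h1 := Finset.sum_union_inter (f := f) (s₁ := (cantorPoints m).image (cantorMap false))
    (s₂ := (cantorPoints m).image (cantorMap true))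
  rw [Finset.sum_image (cantorMap_injective _).injOn,
    Finset.sum_image (cantorMap_injective _).injOn, ← Finset.sum_add_distrib] at h1
  rw [← h1, cantorPoints]
  exact le_add_of_nonneg_right (Finset.sum_nonneg fun _ _ ↦ hf _)

lemma card_cantorPoints_le (m : ℕ) : (cantorPoints m).card ≤ 2 ^ m := by
  induction m with
  | zero => rfl
  | succ m ih =>
    have h1 := Finset.card_union_le ((cantorPoints m).image (cantorMap false))
      ((cantorPoints m).image (cantorMap true))
    have h2 := Finset.card_image_le (s := cantorPoints m) (f := cantorMap false)
    have h3 := Finset.card_image_le (s := cantorPoints m) (f := cantorMap true)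
    rw [cantorPoints, pow_succ]
    lia

/-- The dimension of the Cantor set. -/
def cantorDim : ℝ := Real.log 2 / Real.log 3

lemma cantorDim_pos : 0 < cantorDim := div_pos (Real.log_pos (by norm_num)) (Real.log_pos (by norm_num))

lemma three_rpow_cantorDim : (3 : ℝ) ^ cantorDim = 2 := by
  have h3 : Real.log 3 ≠ 0 := (Real.log_pos (by norm_num)).ne'
  rw [Real.rpow_def_of_pos (by norm_num), cantorDim, mul_div_cancel₀ _ h3,
    Real.exp_log (by norm_num)]

lemma third_pow_rpow_cantorDim (n : ℕ) : (((1 : ℝ) / 3) ^ n) ^ cantorDim = (1 / 2) ^ n := by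
  rw [← Real.rpow_natCast, ← Real.rpow_mul (by norm_num), mul_comm, Real.rpow_mul (by norm_num),
    Real.rpow_natCast, Real.div_rpow (by norm_num) (by norm_num), three_rpow_cantorDim,
    Real.one_rpow]

lemma IsSelfSimilar.measure_ball_le_half {ν : Measure ℝ} (h : IsSelfSimilar (fun _ ↦ 1 / 2) ν)
    (n : ℕ) {x : ℝ} (hx : x ∈ cantorSet) :
    ν (ball x ((1 / 3) ^ n)) ≤ ENNReal.ofReal ((1 / 2) ^ n) := by
  simpa using h.measure_ball_le n x hx

lemma hausdorffMeasure_cantorSet_pos : 0 < μH[cantorDim] cantorSet := by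
  obtain ⟨ν, h⟩ := exists_isSelfSimilar (w := fun _ ↦ 1 / 2) (fun _ ↦ by norm_num) (by norm_num)
  have := h.isProbabilityMeasure
  have h1 : (4⁻¹ : ℝ≥0∞) • ν ≤ μH[cantorDim] := by
    refine Measure.le_hausdorffMeasure _ _ (ENNReal.ofReal (1 / 3)) (by simp) fun A hA ↦ ?_
    rw [Measure.smul_apply, smul_eq_mul, ← ENNReal.div_eq_inv_mul]
    refine ENNReal.div_le_of_le_mul' ?_
    obtain h0 | ⟨x, hxA, hxC⟩ := (A ∩ cantorSet).eq_empty_or_nonempty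
    · have : ν A = 0 := measure_mono_null (fun x hx hxC ↦
        (h0 ▸ (⟨hx, hxC⟩ : x ∈ A ∩ cantorSet) : x ∈ (∅ : Set ℝ))) h.compl_eq
      simp [this]
    have hfin : ediam A ≠ ⊤ := ne_top_of_le_ne_top ENNReal.ofReal_ne_top hA
    obtain ⟨d, hd0, hd⟩ : ∃ d : ℝ, 0 ≤ d ∧ ediam A = ENNReal.ofReal d :=
      ⟨(ediam A).toReal, ENNReal.toReal_nonneg, (ENNReal.ofReal_toReal hfin).symm⟩
    rw [hd] at hA ⊢
    rw [ENNReal.ofReal_le_ofReal_iff (by norm_num)] at hA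
    have hball : ∀ n : ℕ, d < (1 / 3) ^ n → ν A ≤ ENNReal.ofReal ((1 / 2) ^ n) := by
      intro n hn
      refine (measure_mono fun y hy ↦ ?_).trans (h.measure_ball_le_half n hxC)
      rw [mem_ball, ← ENNReal.ofReal_lt_ofReal_iff (by positivity), ← edist_dist]
      refine (edist_le_ediam_of_mem hy hxA).trans_lt ?_
      rw [hd, ENNReal.ofReal_lt_ofReal_iff (by positivity)]
      exact hn
    rcases hd0.eq_or_lt with rfl | hd0
    · have : ν A ≤ 0 := by
        have ht : Tendsto (fun n : ℕ ↦ ENNReal.ofReal ((1 / 2) ^ n)) atTop (𝓝 0) := by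
          simpa using ENNReal.tendsto_ofReal (tendsto_pow_atTop_nhds_zero_of_lt_one
            (r := (1 : ℝ) / 2) (by norm_num) (by norm_num))
        exact ge_of_tendsto' ht fun n ↦ hball n (by positivity)
      exact this.trans zero_le
    · obtain ⟨n, hn1, hn2⟩ := exists_nat_pow_near_of_lt_one (x := 3 * d) (y := (1 : ℝ) / 3)
        (by positivity) (by linarith) (by norm_num) (by norm_num)
      refine (hball n (by linarith)).trans ?_
      rw [ENNReal.ofReal_rpow_of_pos hd0, show (4 : ℝ≥0∞) = ENNReal.ofReal 4 by simp,
        ← ENNReal.ofReal_mul (by norm_num)]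
      refine ENNReal.ofReal_le_ofReal ?_
      have : ((1 : ℝ) / 2) ^ (n + 2) ≤ d ^ cantorDim := by
        rw [← third_pow_rpow_cantorDim]
        refine Real.rpow_le_rpow (by positivity) ?_ cantorDim_pos.le
        rw [pow_succ] at hn1 ⊢
        rw [pow_succ]
        linarith
      rw [pow_add] at this
      linarith
  refine lt_of_lt_of_le ?_ (h1 cantorSet)
  rw [Measure.smul_apply, (prob_compl_eq_zero_iff isClosed_cantorSet.measurableSet).1 h.compl_eq]
  simp

lemma hausdorffMeasure_cantorSet_lt_top : μH[cantorDim] cantorSet < ⊤ := by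
  have hr : Tendsto (fun n : ℕ ↦ ENNReal.ofReal (2 * (1 / 3) ^ n)) atTop (𝓝 0) := by
    simpa using ENNReal.tendsto_ofReal ((tendsto_pow_atTop_nhds_zero_of_lt_one
      (r := (1 : ℝ) / 3) (by norm_num) (by norm_num)).const_mul 2)
  have hd : ∀ (n : ℕ) (x : ℝ),
      ediam (closedBall x ((1 / 3) ^ n)) ≤ ENNReal.ofReal (2 * (1 / 3) ^ n) := fun n x ↦ by
    rw [Real.closedBall_eq_Icc, Real.ediam_Icc]
    exact ENNReal.ofReal_le_ofReal (by linarith)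
  have h1 := Measure.hausdorffMeasure_le_liminf_sum (ι := fun n : ℕ ↦ ↥(cantorPoints n)) cantorDim
    cantorSet _ hr
    (fun n x ↦ closedBall (x : ℝ) ((1 / 3) ^ n)) (.of_forall fun n x ↦ hd n x)
    (.of_forall fun n x hx ↦ by
      obtain ⟨y, hy, h⟩ := exists_mem_cantorPoints n x hx
      exact mem_iUnion.2 ⟨⟨y, hy⟩, by rwa [mem_closedBall, Real.dist_eq]⟩)
  refine h1.trans_lt ((liminf_le_of_frequently_le' (x := ENNReal.ofReal (2 ^ cantorDim))
    (Frequently.of_forall fun n ↦ ?_)).trans_lt ENNReal.ofReal_lt_top)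
  calc ∑ x : ↥(cantorPoints n), ediam (closedBall (x : ℝ) ((1 / 3) ^ n)) ^ cantorDim
      ≤ ∑ x : ↥(cantorPoints n), ENNReal.ofReal (2 ^ cantorDim * (1 / 2) ^ n) := by
        refine Finset.sum_le_sum fun x _ ↦ ?_
        rw [← third_pow_rpow_cantorDim, ← Real.mul_rpow (by norm_num) (by positivity),
          ← ENNReal.ofReal_rpow_of_pos (by positivity)]
        exact ENNReal.rpow_le_rpow (hd n x) cantorDim_pos.le
    _ ≤ ENNReal.ofReal (2 ^ cantorDim) := by
        rw [Finset.sum_const, Finset.card_univ, Fintype.card_coe, nsmul_eq_mul,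
          ← ENNReal.ofReal_natCast, ← ENNReal.ofReal_mul (by positivity)]
        refine ENNReal.ofReal_le_ofReal ?_
        have h2 : ((cantorPoints n).card : ℝ) ≤ 2 ^ n := mod_cast card_cantorPoints_le n
        calc ((cantorPoints n).card : ℝ) * (2 ^ cantorDim * (1 / 2) ^ n)
            ≤ 2 ^ n * (2 ^ cantorDim * (1 / 2) ^ n) := by gcongr
          _ = 2 ^ cantorDim := by
            rw [mul_left_comm, ← mul_pow]; norm_num

lemma hausdorffMeasure_cantorMap_image (e : Bool) (A : Set ℝ) :
    μH[cantorDim] (cantorMap e '' A) = ENNReal.ofReal (1 / 2) * μH[cantorDim] A := by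
  have h3 : (3⁻¹ : ℝ) ^ cantorDim = 1 / 2 := by
    rw [Real.inv_rpow (by norm_num), three_rpow_cantorDim]; norm_num
  have key : ∀ (p a : ℝ), a ≠ 0 → |a| = 3⁻¹ →
      μH[cantorDim] (AffineMap.homothety p a '' A) =
        ENNReal.ofReal (1 / 2) * μH[cantorDim] A := fun p a h0 ha ↦ by
    rw [hausdorffMeasure_homothety_image cantorDim_pos.le p h0, ENNReal.smul_def, smul_eq_mul,
      ← h3, ← ha, ← Real.norm_eq_abs, ← coe_nnnorm, ← NNReal.coe_rpow, ENNReal.ofReal_coe_nnreal]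
  cases e
  · rw [← key 0 3⁻¹ (by norm_num) (by norm_num)]
    congr 2; ext x; simp [AffineMap.homothety_apply]; ring
  · rw [← key (3 / 4) (-3⁻¹) (by norm_num) (by norm_num)]
    congr 2; ext x; simp [AffineMap.homothety_apply]; ring

theorem isSelfSimilar_hausdorffMeasure :
    IsSelfSimilar (fun _ ↦ 1 / 2)
      ((μH[cantorDim] cantorSet)⁻¹ • (μH[cantorDim]).restrict cantorSet) where
  nonneg _ := by norm_num
  add_eq_one := by norm_num
  univ_eq := by
    simpa using ENNReal.inv_mul_cancel hausdorffMeasure_cantorSet_pos.ne'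
      hausdorffMeasure_cantorSet_lt_top.ne
  compl_eq := by
    rw [Measure.smul_apply, Measure.restrict_apply isClosed_cantorSet.measurableSet.compl]
    simp
  eq_add := by
    have hm := fun e ↦ measurable_cantorMap e
    have hC := isClosed_cantorSet.measurableSet
    simp only [Measure.map_smul, smul_comm (ENNReal.ofReal (1 / 2)), ← smul_add]
    congr 1
    ext A hA
    simp only [Measure.coe_add, Pi.add_apply, Measure.smul_apply, Measure.map_apply (hm _) hA,
      Measure.restrict_apply hA, Measure.restrict_apply (hm _ hA), smul_eq_mul]
    rw [mul_add, ← hausdorffMeasure_cantorMap_image, ← hausdorffMeasure_cantorMap_image,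
      image_preimage_inter, image_preimage_inter, ← measure_union, ← inter_union_distrib_left, cantorMap_image_union]
    · refine Disjoint.mono inter_subset_right inter_subset_right (disjoint_left.2 ?_)
      rintro _ ⟨x, hx, rfl⟩ ⟨y, hy, h⟩
      have hx' := (cantorSet_subset_unitInterval hx).2
      have hy' := (cantorSet_subset_unitInterval hy).2
      simp only [cantorMap_false, cantorMap_true] at h
      linarith
    · exact hA.inter (isCompact_cantorSet.image (continuous_cantorMap true)).measurableSet

/-- The radii `c * n ^ (-1 / s)`, indexed from `0`. -/
def coverRadius (c : ℝ) (n : ℕ) : ℝ := c * ((n + 1 : ℕ) : ℝ) ^ (-(1 / cantorDim))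

lemma coverRadius_pos {c : ℝ} (hc : 0 < c) (n : ℕ) : 0 < coverRadius c n := by
  unfold coverRadius; positivity

lemma lt_coverRadius_iff {c t : ℝ} (hc : 0 < c) (ht : 0 < t) (n : ℕ) :
    t < coverRadius c n ↔ (n + 1 : ℝ) < c ^ cantorDim * t ^ (-cantorDim) := by
  have hn : (0 : ℝ) < ((n + 1 : ℕ) : ℝ) := by positivity
  rw [← Real.rpow_lt_rpow_iff ht.le (coverRadius_pos hc n).le cantorDim_pos, coverRadius,
    Real.mul_rpow hc.le (by positivity), ← Real.rpow_mul hn.le, neg_mul,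
    one_div_mul_cancel cantorDim_pos.ne', Real.rpow_neg_one, Real.rpow_neg ht.le,
    ← div_eq_mul_inv, ← div_eq_mul_inv, lt_div_iff₀ hn, lt_div_iff₀ (by positivity), mul_comm]
  push_cast
  rfl

/-- The energy kernel `|t| ^ (-s)`, truncated at scale `3 ^ (-J)`. -/
def truncKernel (J : ℕ) (t : ℝ) : ℝ := max |t| ((1 / 3) ^ J) ^ (-cantorDim)

/-- The interaction of points in the two halves of the Cantor set, in rescaled coordinates. -/
def crossKernel (t : ℝ) : ℝ := max 1 (3 - t) ^ (-cantorDim)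

lemma continuous_truncKernel (J : ℕ) : Continuous (truncKernel J) :=
  (continuous_abs.max continuous_const).rpow_const fun _ ↦
    Or.inl (lt_max_of_lt_right (by positivity)).ne'

lemma continuous_crossKernel : Continuous crossKernel :=
  (continuous_const.max (continuous_const.sub continuous_id)).rpow_const fun _ ↦
    Or.inl (lt_max_of_lt_left one_pos).ne'

lemma truncKernel_nonneg (J : ℕ) (t : ℝ) : 0 ≤ truncKernel J t := by
  unfold truncKernel; positivity

lemma crossKernel_nonneg (t : ℝ) : 0 ≤ crossKernel t := by
  unfold crossKernel; positivity

lemma crossKernel_le_one (t : ℝ) : crossKernel t ≤ 1 :=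
  Real.rpow_le_one_of_one_le_of_nonpos (le_max_left _ _) (neg_nonpos.2 cantorDim_pos.le)

lemma third_rpow_neg_cantorDim : ((1 : ℝ) / 3) ^ (-cantorDim) = 2 := by
  rw [one_div, Real.inv_rpow (by norm_num), Real.rpow_neg (by norm_num), inv_inv,
    three_rpow_cantorDim]

lemma third_pow_rpow_neg_cantorDim (J : ℕ) : (((1 : ℝ) / 3) ^ J) ^ (-cantorDim) = 2 ^ J := by
  rw [Real.rpow_neg (by positivity), third_pow_rpow_cantorDim, ← inv_pow]
  norm_num

lemma truncKernel_le (J : ℕ) (t : ℝ) : truncKernel J t ≤ 2 ^ J := by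
  rw [truncKernel, ← third_pow_rpow_neg_cantorDim]
  exact Real.rpow_le_rpow_of_nonpos (by positivity) (le_max_right _ _)
    (neg_nonpos.2 cantorDim_pos.le)

lemma truncKernel_succ_same (J : ℕ) (e : Bool) (x y : ℝ) :
    truncKernel (J + 1) (cantorMap e x - cantorMap e y) = 2 * truncKernel J (x - y) := by
  rw [truncKernel, truncKernel, abs_cantorMap_sub_same, pow_succ, ← mul_one_div |x - y|,
    ← max_mul_of_nonneg _ _ (by norm_num : (0 : ℝ) ≤ 1 / 3),
    Real.mul_rpow (by positivity) (by norm_num), third_rpow_neg_cantorDim, mul_comm]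

lemma truncKernel_succ_not (J : ℕ) (e : Bool) {x y : ℝ} (hx : x ∈ Icc (0 : ℝ) 1)
    (hy : y ∈ Icc (0 : ℝ) 1) :
    truncKernel (J + 1) (cantorMap e x - cantorMap (!e) y) = 2 * crossKernel (x + y) := by
  have h1 : (1 : ℝ) ≤ 3 - (x + y) := by linarith [hx.2, hy.2]
  have h2 : ((1 : ℝ) / 3) ^ J ≤ 1 := pow_le_one₀ (by norm_num) (by norm_num)
  rw [truncKernel, crossKernel, abs_cantorMap_sub_not e hx hy, max_eq_right h1, pow_succ,
    max_eq_left (by linarith), sub_sub, ← mul_one_div, Real.mul_rpow (by linarith) (by norm_num),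
    third_rpow_neg_cantorDim, mul_comm]

/-- The truncated potential of `μ`. -/
def truncPotential (μ : Measure ℝ) (J : ℕ) (x : ℝ) : ℝ := ∫ y, truncKernel J (x - y) ∂μ

/-- The potential created by one half of the Cantor set on the other one. -/
def crossPotential (μ : Measure ℝ) (x : ℝ) : ℝ := ∫ y, crossKernel (x + y) ∂μ

lemma crossPotential_nonneg (μ : Measure ℝ) (x : ℝ) : 0 ≤ crossPotential μ x :=
  integral_nonneg fun _ ↦ crossKernel_nonneg _

lemma crossPotential_le_one (μ : Measure ℝ) [IsProbabilityMeasure μ] (x : ℝ) :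
    crossPotential μ x ≤ 1 := by
  have := norm_integral_le_of_norm_le_const (μ := μ) (f := fun y ↦ crossKernel (x + y)) (C := 1)
    (.of_forall fun y ↦ by
      rw [Real.norm_of_nonneg (crossKernel_nonneg _)]; exact crossKernel_le_one _)
  rw [probReal_univ, mul_one] at this
  exact (le_abs_self _).trans this

lemma continuous_crossPotential (μ : Measure ℝ) [IsProbabilityMeasure μ] :
    Continuous (crossPotential μ) := by
  refine continuous_of_dominated (bound := fun _ ↦ 1)
    (fun x ↦ (continuous_crossKernel.comp (continuous_const_add x)).aestronglyMeasurable)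
    (fun x ↦ .of_forall fun y ↦ ?_) (integrable_const _)
    (.of_forall fun y ↦ continuous_crossKernel.comp (continuous_add_const y))
  rw [Real.norm_of_nonneg (crossKernel_nonneg _)]
  exact crossKernel_le_one _

namespace IsSelfSimilar

variable {μ : Measure ℝ}

lemma truncPotential_zero (h : IsSelfSimilar (fun _ ↦ 1 / 2) μ) {x : ℝ} (hx : x ∈ cantorSet) :
    truncPotential μ 0 x = 1 := by
  have := h.isProbabilityMeasure
  have h1 : ∀ᵐ y ∂μ, truncKernel 0 (x - y) = 1 := by
    filter_upwards [h.ae_mem_Icc] with y hy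
    have hx' := cantorSet_subset_unitInterval hx
    rw [truncKernel, pow_zero, max_eq_right, Real.one_rpow]
    exact abs_le.2 ⟨by linarith [hx'.1, hy.2], by linarith [hx'.2, hy.1]⟩
  rw [truncPotential, integral_congr_ae h1]
  simp

lemma truncPotential_succ (h : IsSelfSimilar (fun _ ↦ 1 / 2) μ) (J : ℕ) (e : Bool) {x : ℝ}
    (hx : x ∈ cantorSet) : truncPotential μ (J + 1) (cantorMap e x) =
      truncPotential μ J x + crossPotential μ x := by
  have hcont : ∀ a, Continuous fun y ↦ truncKernel (J + 1) (a - y) := fun a ↦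
    (continuous_truncKernel _).comp (continuous_sub_left a)
  have hs : ∫ y, truncKernel (J + 1) (cantorMap e x - cantorMap e y) ∂μ =
      2 * truncPotential μ J x := by
    simp only [truncKernel_succ_same, integral_const_mul, truncPotential]
  have hn : ∫ y, truncKernel (J + 1) (cantorMap e x - cantorMap (!e) y) ∂μ =
      2 * crossPotential μ x := by
    rw [crossPotential, ← integral_const_mul]
    exact integral_congr_ae (h.ae_mem_Icc.mono fun y hy ↦
      truncKernel_succ_not J e (cantorSet_subset_unitInterval hx) hy)
  rw [truncPotential, h.integral_eq (hcont _).measurable fun e' ↦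
    h.integrable_of_continuous ((hcont _).comp (continuous_cantorMap e'))]
  cases e
  · rw [hs, show true = !false from rfl, hn]; ring
  · rw [hs, show false = !true from rfl, hn]; ring

lemma truncPotential_eq (h : IsSelfSimilar (fun _ ↦ 1 / 2) μ) (J : ℕ) : ∀ x ∈ cantorSet,
    truncPotential μ J x = 1 + ∑ i ∈ Finset.range J, crossPotential μ (tentMap^[i + 1] x) := by
  induction J with
  | zero => intro x hx; simp [h.truncPotential_zero hx]
  | succ J ih =>
    intro x hx
    obtain ⟨e, y, hy, rfl⟩ := exists_cantorMap_eq hx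
    rw [h.truncPotential_succ J e hy, ih y hy, Finset.sum_range_succ']
    simp only [Function.iterate_succ_apply, Function.iterate_zero, id,
      tentMap_cantorMap e (cantorSet_subset_unitInterval hy)]
    ring

lemma card_filter_eq_sum_indicator (x y : ℝ) (r : ℕ → ℝ) (N : ℕ) :
    (((Finset.range N).filter fun n ↦ |x - y| < r n).card : ℝ) =
      ∑ n ∈ Finset.range N, (ball x (r n)).indicator (fun _ ↦ (1 : ℝ)) y := by
  rw [Finset.card_filter]
  push_cast
  refine Finset.sum_congr rfl fun n _ ↦ ?_
  by_cases hy : |x - y| < r n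
  · rw [if_pos hy, indicator_of_mem (by rwa [mem_ball, Real.dist_eq, abs_sub_comm])]
  · rw [if_neg hy, indicator_of_notMem (by rwa [mem_ball, Real.dist_eq, abs_sub_comm])]

lemma sum_measureReal_ball [IsProbabilityMeasure μ] (x : ℝ) (r : ℕ → ℝ) (N : ℕ) :
    ∑ n ∈ Finset.range N, μ.real (ball x (r n)) =
      ∫ y, (((Finset.range N).filter fun n ↦ |x - y| < r n).card : ℝ) ∂μ := by
  simp_rw [card_filter_eq_sum_indicator]
  rw [integral_finsetSum _ fun n _ ↦ (integrable_const (1 : ℝ)).indicator measurableSet_ball]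
  exact Finset.sum_congr rfl fun n _ ↦ (integral_indicator_one measurableSet_ball).symm

lemma integrable_card_filter [IsProbabilityMeasure μ] (x : ℝ) (r : ℕ → ℝ) (N : ℕ) :
    Integrable (fun y ↦ (((Finset.range N).filter fun n ↦ |x - y| < r n).card : ℝ)) μ := by
  simp_rw [card_filter_eq_sum_indicator]
  exact integrable_finsetSum _ fun n _ ↦ (integrable_const (1 : ℝ)).indicator measurableSet_ball

lemma integrable_truncKernel (h : IsSelfSimilar (fun _ ↦ 1 / 2) μ) (J : ℕ) (x : ℝ) :
    Integrable (fun y ↦ truncKernel J (x - y)) μ :=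
  h.integrable_of_continuous ((continuous_truncKernel _).comp (continuous_sub_left x))

lemma sum_measureReal_ball_le (h : IsSelfSimilar (fun _ ↦ 1 / 2) μ) {c : ℝ} (hc : 0 < c)
    {N J : ℕ} (hN : (N : ℝ) ≤ c ^ cantorDim * 2 ^ J) (x : ℝ) :
    ∑ n ∈ Finset.range N, μ.real (ball x (coverRadius c n)) ≤
      c ^ cantorDim * truncPotential μ J x := by
  have := h.isProbabilityMeasure
  rw [sum_measureReal_ball, truncPotential, ← integral_const_mul]
  refine integral_mono (integrable_card_filter _ _ _)
    ((h.integrable_truncKernel J x).const_mul _) fun y ↦ ?_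
  have hB : 0 ≤ c ^ cantorDim * truncKernel J (x - y) :=
    mul_nonneg (by positivity) (truncKernel_nonneg _ _)
  have hsub : (Finset.range N).filter (fun n ↦ |x - y| < coverRadius c n) ⊆
      Finset.range ⌊c ^ cantorDim * truncKernel J (x - y)⌋₊ := by
    intro n hn
    rw [Finset.mem_filter, Finset.mem_range] at hn
    rw [Finset.mem_range, Nat.lt_iff_add_one_le, Nat.le_floor_iff hB]
    obtain ⟨h1, h2⟩ := hn
    have h1' : ((n + 1 : ℕ) : ℝ) ≤ N := mod_cast h1
    rw [truncKernel]
    rcases le_total |x - y| ((1 / 3) ^ J) with h3 | h3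
    · rw [max_eq_right h3, third_pow_rpow_neg_cantorDim]
      exact h1'.trans hN
    · rw [max_eq_left h3]
      have h4 := (lt_coverRadius_iff hc (lt_of_lt_of_le (by positivity) h3) n).1 h2
      push_cast
      exact h4.le
  have h1 := Finset.card_le_card hsub
  rw [Finset.card_range] at h1
  exact (Nat.cast_le.2 h1).trans (Nat.floor_le hB)

lemma le_sum_measureReal_ball (h : IsSelfSimilar (fun _ ↦ 1 / 2) μ) {c : ℝ} (hc : 0 < c)
    (J : ℕ) (x : ℝ) :
    c ^ cantorDim * truncPotential μ J x - 1 ≤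
      ∑ n ∈ Finset.range ⌊c ^ cantorDim * 2 ^ J⌋₊, μ.real (ball x (coverRadius c n)) := by
  have := h.isProbabilityMeasure
  have h1 : c ^ cantorDim * truncPotential μ J x - 1 =
      ∫ y, (c ^ cantorDim * truncKernel J (x - y) - 1) ∂μ := by
    rw [integral_sub ((h.integrable_truncKernel J x).const_mul _) (integrable_const _),
      integral_const_mul, truncPotential]
    simp
  rw [sum_measureReal_ball, h1]
  refine integral_mono (((h.integrable_truncKernel J x).const_mul _).sub (integrable_const _))
    (integrable_card_filter _ _ _) fun y ↦ ?_
  have hsub : Finset.range (⌈c ^ cantorDim * truncKernel J (x - y)⌉₊ - 1) ⊆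
      (Finset.range ⌊c ^ cantorDim * 2 ^ J⌋₊).filter (fun n ↦ |x - y| < coverRadius c n) := by
    intro n hn
    rw [Finset.mem_range, Nat.lt_sub_iff_add_lt, Nat.lt_ceil] at hn
    push_cast at hn
    rw [Finset.mem_filter, Finset.mem_range, Nat.lt_iff_add_one_le, Nat.le_floor_iff (by positivity)]
    constructor
    · push_cast
      exact hn.le.trans (by gcongr; exact truncKernel_le _ _)
    · exact (le_max_left _ _).trans_lt
        ((lt_coverRadius_iff hc (lt_max_of_lt_right (by positivity)) n).2 hn)
  have h2 := Finset.card_le_card hsub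
  rw [Finset.card_range, tsub_le_iff_right] at h2
  have h3 := (Nat.le_ceil (c ^ cantorDim * truncKernel J (x - y))).trans (Nat.cast_le.2 h2)
  push_cast at h3
  simpa using h3

end IsSelfSimilar

namespace IsSelfSimilar

variable {μ : Measure ℝ}

lemma integral_id_eq_half (h : IsSelfSimilar (fun _ ↦ 1 / 2) μ) : ∫ y, y ∂μ = 1 / 2 := by
  have := h.isProbabilityMeasure
  have hi : Integrable (fun y ↦ y / 3) μ :=
    h.integrable_of_continuous (continuous_id.div_const 3)
  have h1 := h.integral_eq (f := id) measurable_id fun e ↦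
    h.integrable_of_continuous (continuous_cantorMap e)
  simp only [id, cantorMap_false, cantorMap_true] at h1
  rw [integral_sub (integrable_const _) hi, integral_div] at h1
  simp only [integral_const, probReal_univ, smul_eq_mul, mul_one] at h1
  linarith

lemma le_crossPotential (h : IsSelfSimilar (fun _ ↦ 1 / 2) μ) {x : ℝ} (hx : x ∈ Icc (0 : ℝ) 1) :
    (5 / 2 - x) ^ (-cantorDim) ≤ crossPotential μ x := by
  have := h.isProbabilityMeasure
  have ha : 0 < 5 / 2 - x := by linarith [hx.2]
  have hid : Integrable (fun y : ℝ ↦ y) μ := h.integrable_of_continuous continuous_id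
  have hd : Integrable (fun y : ℝ ↦ cantorDim * (1 / 2 - y) / (5 / 2 - x)) μ :=
    (((integrable_const _).sub hid).const_mul _).div_const _
  have h1 : ∫ y, (5 / 2 - x) ^ (-cantorDim) * (1 - cantorDim * (1 / 2 - y) / (5 / 2 - x)) ∂μ =
      (5 / 2 - x) ^ (-cantorDim) := by
    rw [integral_const_mul, integral_sub (integrable_const _) hd, integral_div,
      integral_const_mul, integral_sub (integrable_const _) hid, h.integral_id_eq_half]
    simp
  rw [← h1]
  refine integral_mono_ae (((integrable_const _).sub hd).const_mul _)
    (h.integrable_of_continuous (continuous_crossKernel.comp (continuous_const_add x)))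
    (h.ae_mem_Icc.mono fun y hy ↦ ?_)
  have hu : 0 < (3 - (x + y)) / (5 / 2 - x) := div_pos (by linarith [hx.2, hy.2]) ha
  have h2 : crossKernel (x + y) =
      (5 / 2 - x) ^ (-cantorDim) * ((3 - (x + y)) / (5 / 2 - x)) ^ (-cantorDim) := by
    rw [← Real.mul_rpow ha.le hu.le, mul_div_cancel₀ _ ha.ne', crossKernel,
      max_eq_right (by linarith [hx.2, hy.2])]
  change _ ≤ crossKernel (x + y)
  rw [h2]
  refine mul_le_mul_of_nonneg_left ?_ (Real.rpow_nonneg ha.le _)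
  rw [Real.rpow_def_of_pos hu]
  have h3 := mul_le_mul_of_nonneg_left (Real.log_le_sub_one_of_pos hu) cantorDim_pos.le
  have h4 : cantorDim * (1 / 2 - y) / (5 / 2 - x) =
      cantorDim * ((3 - (x + y)) / (5 / 2 - x) - 1) := by
    rw [div_sub_one ha.ne', mul_div_assoc]; ring
  linarith [Real.add_one_le_exp (Real.log ((3 - (x + y)) / (5 / 2 - x)) * -cantorDim)]

lemma le_crossPotential_cantorMap (h : IsSelfSimilar (fun _ ↦ 1 / 2) μ) (e : Bool) {x : ℝ}
    (hx : x ∈ Icc (0 : ℝ) 1) :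
    (if e then 11 / 6 else 5 / 2 : ℝ) ^ (-cantorDim) ≤ crossPotential μ (cantorMap e x) := by
  obtain ⟨h1, h2⟩ := hx
  have h3 : cantorMap e x ∈ Icc (0 : ℝ) 1 := by
    cases e <;> simp only [cantorMap_false, cantorMap_true] <;> constructor <;> linarith
  refine le_trans ?_ (h.le_crossPotential h3)
  refine Real.rpow_le_rpow_of_nonpos (by linarith [h3.2]) ?_ (neg_nonpos.2 cantorDim_pos.le)
  cases e
  · simp only [cantorMap_false, Bool.false_eq_true, if_false]; linarith
  · simp only [cantorMap_true, if_true]; linarith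

end IsSelfSimilar

lemma cantorDim_le : cantorDim ≤ 2 / 3 := by
  have h3 : 0 < Real.log 3 := Real.log_pos (by norm_num)
  rw [cantorDim, div_le_iff₀ h3]
  have h1 : Real.log (2 ^ 3) ≤ Real.log (3 ^ 2) := Real.log_le_log (by norm_num) (by norm_num)
  rw [Real.log_pow, Real.log_pow] at h1
  push_cast at h1
  linarith

lemma exp_neg_le_of_le {x a b : ℝ} (ha : 0 ≤ a) (hax : a ≤ x)
    (hb : 1 ≤ b * (1 + a + a ^ 2 / 2 + a ^ 3 / 6)) : Real.exp (-x) ≤ b := by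
  have h1 := Real.sum_le_exp_of_nonneg ha 4
  simp only [Finset.sum_range_succ, Finset.sum_range_zero, Nat.factorial] at h1
  norm_num at h1
  have h2 : 0 < 1 + a + a ^ 2 / 2 + a ^ 3 / 6 := by positivity
  have hb0 : 0 ≤ b := by
    by_contra! h
    nlinarith
  rw [Real.exp_neg, inv_le_iff_one_le_mul₀ (Real.exp_pos _)]
  refine hb.trans (mul_le_mul_of_nonneg_left ?_ hb0)
  linarith [Real.exp_le_exp.2 hax]

lemma cantor_covering_rate_lt_one :
    Real.exp (-((1.37546 : ℝ) ^ cantorDim * (5 / 2 : ℝ) ^ (-cantorDim))) +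
      Real.exp (-((1.37546 : ℝ) ^ cantorDim * (11 / 6 : ℝ) ^ (-cantorDim))) < 1 := by
  have hh : (1 / 1.588 : ℝ) ≤ (1 / 2 : ℝ) ^ cantorDim := by
    refine le_trans ?_ (Real.rpow_le_rpow_of_exponent_ge (by norm_num) (by norm_num) cantorDim_le)
    rw [← pow_le_pow_iff_left₀ (by norm_num) (by positivity) (by norm_num : (3 : ℕ) ≠ 0),
      ← Real.rpow_natCast ((1 / 2 : ℝ) ^ (2 / 3 : ℝ)), ← Real.rpow_mul (by norm_num)]
    norm_num
  have key : ∀ a : ℝ, 0 < a → (1.37546 : ℝ) ^ cantorDim * a ^ (-cantorDim) =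
      (1.37546 / a) ^ cantorDim := fun a ha ↦ by
    rw [Real.div_rpow (by norm_num) ha.le, Real.rpow_neg ha.le, div_eq_mul_inv]
  have h1 : (0.6297 : ℝ) ≤ (1.37546 / (5 / 2)) ^ cantorDim := by
    refine le_trans ?_ (hh.trans (Real.rpow_le_rpow (by norm_num) (by norm_num) cantorDim_pos.le))
    norm_num
  have h2 : (0.793 : ℝ) ≤ (1.37546 / (11 / 6)) ^ cantorDim := by
    have h3 : (3 / 4 : ℝ) ^ cantorDim =
        (3 : ℝ) ^ cantorDim * ((1 / 2 : ℝ) ^ cantorDim * (1 / 2 : ℝ) ^ cantorDim) := by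
      rw [← Real.mul_rpow (by norm_num) (by norm_num),
        ← Real.mul_rpow (by norm_num) (by norm_num)]
      norm_num
    refine le_trans ?_ (Real.rpow_le_rpow (by norm_num)
      (by norm_num : (3 / 4 : ℝ) ≤ 1.37546 / (11 / 6)) cantorDim_pos.le)
    rw [h3, three_rpow_cantorDim]
    have h4 := mul_le_mul hh hh (by norm_num) (by positivity)
    norm_num at h4 ⊢
    linarith
  rw [key _ (by norm_num), key _ (by norm_num)]
  have h4 := exp_neg_le_of_le (b := 0.536) (by norm_num) h1 (by norm_num)
  have h5 := exp_neg_le_of_le (b := 0.458) (by norm_num) h2 (by norm_num)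
  linarith

namespace IsSelfSimilar

variable {μ : Measure ℝ}

lemma sum_exp_potential_le (h : IsSelfSimilar (fun _ ↦ 1 / 2) μ) {β : ℝ} (hβ : 0 ≤ β) (m : ℕ) :
    ∑ x ∈ cantorPoints m, Real.exp (-(β * (truncPotential μ m x + crossPotential μ x))) ≤
      (Real.exp (-(β * (5 / 2 : ℝ) ^ (-cantorDim))) +
        Real.exp (-(β * (11 / 6 : ℝ) ^ (-cantorDim)))) ^ m := by
  induction m with
  | zero =>
    simp only [cantorPoints, Finset.sum_singleton, pow_zero, Real.exp_le_one_iff,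
      h.truncPotential_zero zero_mem_cantorSet]
    have := crossPotential_nonneg μ 0
    have : 0 ≤ β * (1 + crossPotential μ 0) := by positivity
    linarith
  | succ m ih =>
    refine (sum_cantorPoints_succ_le m fun x ↦ (Real.exp_pos _).le).trans ?_
    rw [pow_succ]
    refine le_trans ?_ (mul_le_mul_of_nonneg_right ih (by positivity))
    rw [Finset.sum_mul]
    refine Finset.sum_le_sum fun x hx ↦ ?_
    have hxC := mem_cantorSet_of_mem_cantorPoints m x hx
    have key : ∀ e, Real.exp (-(β * (truncPotential μ (m + 1) (cantorMap e x) +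
        crossPotential μ (cantorMap e x)))) ≤
        Real.exp (-(β * (truncPotential μ m x + crossPotential μ x))) *
          Real.exp (-(β * (if e then 11 / 6 else 5 / 2 : ℝ) ^ (-cantorDim))) := fun e ↦ by
      rw [← Real.exp_add, Real.exp_le_exp, h.truncPotential_succ m e hxC]
      have := mul_le_mul_of_nonneg_left
        (h.le_crossPotential_cantorMap e (cantorSet_subset_unitInterval hxC)) hβ
      linarith
    have h1 := key false
    have h2 := key true
    simp only [Bool.false_eq_true, if_false, if_true] at h1 h2
    exact (add_le_add h1 h2).trans_eq (mul_add _ _ _).symm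

lemma truncPotential_add_le (h : IsSelfSimilar (fun _ ↦ 1 / 2) μ) (J m : ℕ) {x : ℝ}
    (hx : x ∈ cantorSet) : truncPotential μ (J + m) x ≤ truncPotential μ J x + m := by
  have := h.isProbabilityMeasure
  rw [h.truncPotential_eq _ x hx, h.truncPotential_eq _ x hx, Finset.sum_range_add]
  have : ∑ i ∈ Finset.range m, crossPotential μ (tentMap^[J + i + 1] x) ≤
      ∑ i ∈ Finset.range m, (1 : ℝ) := Finset.sum_le_sum fun i _ ↦ crossPotential_le_one μ _
  simp only [Finset.sum_const, Finset.card_range, nsmul_eq_mul, mul_one] at this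
  linarith

lemma sum_exp_truncPotential_le (h : IsSelfSimilar (fun _ ↦ 1 / 2) μ) {β : ℝ} (hβ : 0 ≤ β)
    (J m : ℕ) :
    ∑ x ∈ cantorPoints (J + m), Real.exp (-(β * truncPotential μ J x)) ≤
      Real.exp (β * (m + 1)) * (Real.exp (-(β * (5 / 2 : ℝ) ^ (-cantorDim))) +
        Real.exp (-(β * (11 / 6 : ℝ) ^ (-cantorDim)))) ^ (J + m) := by
  have := h.isProbabilityMeasure
  refine le_trans ?_ (mul_le_mul_of_nonneg_left (h.sum_exp_potential_le hβ (J + m))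
    (Real.exp_pos _).le)
  rw [Finset.mul_sum]
  refine Finset.sum_le_sum fun x hx ↦ ?_
  rw [← Real.exp_add, Real.exp_le_exp]
  have h1 := h.truncPotential_add_le J m (mem_cantorSet_of_mem_cantorPoints _ x hx)
  have h2 := mul_le_mul_of_nonneg_left (add_le_add h1 (crossPotential_le_one μ x)) hβ
  linarith

lemma prob_avoid_le (h : IsSelfSimilar (fun _ ↦ 1 / 2) μ) {P : Measure (ℕ → ℝ)}
    (hP : ∀ (I : Finset ℕ) (f : ℕ → Set ℝ), (∀ n, MeasurableSet (f n)) →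
      P {ω | ∀ n ∈ I, ω n ∈ f n} = ∏ n ∈ I, μ (f n))
    {c : ℝ} (hc : 0 < c) (k J : ℕ) (x : ℝ) :
    P {ω | ∀ n ∈ Finset.Ico k ⌊c ^ cantorDim * 2 ^ J⌋₊, ω n ∈ (ball x (coverRadius c n))ᶜ} ≤
      ENNReal.ofReal (Real.exp (k + 1) *
        Real.exp (-(c ^ cantorDim * truncPotential μ J x))) := by
  have := h.isProbabilityMeasure
  rw [hP _ _ fun n ↦ measurableSet_ball.compl]
  have h1 : ∀ n, μ (ball x (coverRadius c n))ᶜ ≤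
      ENNReal.ofReal (Real.exp (-μ.real (ball x (coverRadius c n)))) := fun n ↦ by
    rw [← ofReal_measureReal, probReal_compl_eq_one_sub measurableSet_ball]
    exact ENNReal.ofReal_le_ofReal (Real.one_sub_le_exp_neg _)
  refine (Finset.prod_le_prod' fun n _ ↦ h1 n).trans ?_
  rw [← ENNReal.ofReal_prod_of_nonneg fun _ _ ↦ (Real.exp_pos _).le, ← Real.exp_sum,
    ← Real.exp_add]
  refine ENNReal.ofReal_le_ofReal (Real.exp_le_exp.2 ?_)
  rw [Finset.sum_neg_distrib]
  have h2 := h.le_sum_measureReal_ball hc J x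
  set N := ⌊c ^ cantorDim * 2 ^ J⌋₊
  have h3 : ∑ n ∈ Finset.range N, μ.real (ball x (coverRadius c n)) ≤
      ∑ n ∈ Finset.range k, μ.real (ball x (coverRadius c n)) +
        ∑ n ∈ Finset.Ico k N, μ.real (ball x (coverRadius c n)) := by
    rw [← Finset.sum_union (by
      rw [Finset.disjoint_left]; intro a; simp; lia)]
    refine Finset.sum_le_sum_of_subset_of_nonneg (fun a ha ↦ ?_) fun _ _ _ ↦ measureReal_nonneg
    simp at ha ⊢; lia
  have h4 : ∑ n ∈ Finset.range k, μ.real (ball x (coverRadius c n)) ≤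
      ∑ n ∈ Finset.range k, (1 : ℝ) := Finset.sum_le_sum fun _ _ ↦ measureReal_le_one
  simp only [Finset.sum_const, Finset.card_range, nsmul_eq_mul, mul_one] at h4
  linarith

lemma prob_not_cover_eq_zero (h : IsSelfSimilar (fun _ ↦ 1 / 2) μ) {P : Measure (ℕ → ℝ)}
    (hP : ∀ (I : Finset ℕ) (f : ℕ → Set ℝ), (∀ n, MeasurableSet (f n)) →
      P {ω | ∀ n ∈ I, ω n ∈ f n} = ∏ n ∈ I, μ (f n))
    {c c' : ℝ} (hc' : 0 < c') (hcc : c' < c)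
    (hrate : Real.exp (-(c' ^ cantorDim * (5 / 2 : ℝ) ^ (-cantorDim))) +
      Real.exp (-(c' ^ cantorDim * (11 / 6 : ℝ) ^ (-cantorDim))) < 1) (k : ℕ) :
    P {ω | ∃ x ∈ cantorSet, ∀ n, k ≤ n → x ∉ ball (ω n) (coverRadius c n)} = 0 := by
  set L := Real.exp (-(c' ^ cantorDim * (5 / 2 : ℝ) ^ (-cantorDim))) +
      Real.exp (-(c' ^ cantorDim * (11 / 6 : ℝ) ^ (-cantorDim))) with hL
  have hδ : 0 < c - c' := by linarith
  have hδs : 0 < (c - c') ^ cantorDim := by positivity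
  obtain ⟨m, hm⟩ := pow_unbounded_of_one_lt (c' ^ cantorDim / (c - c') ^ cantorDim)
    (one_lt_two : (1 : ℝ) < 2)
  rw [div_lt_iff₀ hδs] at hm
  have hbound : ∀ J : ℕ,
      P {ω | ∃ x ∈ cantorSet, ∀ n, k ≤ n → x ∉ ball (ω n) (coverRadius c n)} ≤
        ENNReal.ofReal (Real.exp (k + 1) * (Real.exp (c' ^ cantorDim * (m + 1)) * L ^ (J + m))) := by
    intro J
    have hsub : {ω | ∃ x ∈ cantorSet, ∀ n, k ≤ n → x ∉ ball (ω n) (coverRadius c n)} ⊆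
        ⋃ x ∈ cantorPoints (J + m), {ω : ℕ → ℝ | ∀ n ∈ Finset.Ico k ⌊c' ^ cantorDim * 2 ^ J⌋₊,
          ω n ∈ (ball x (coverRadius c' n))ᶜ} := by
      rintro ω ⟨x, hx, hω⟩
      obtain ⟨y, hy, hxy⟩ := exists_mem_cantorPoints (J + m) x hx
      refine mem_iUnion₂.2 ⟨y, hy, fun n hn ↦ ?_⟩
      rw [Finset.mem_Ico, Nat.lt_iff_add_one_le, Nat.le_floor_iff (by positivity)] at hn
      have h1 : ((1 : ℝ) / 3) ^ (J + m) < coverRadius (c - c') n := by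
        rw [lt_coverRadius_iff hδ (by positivity), third_pow_rpow_neg_cantorDim, pow_add]
        have h2 := hn.2
        push_cast at h2
        refine h2.trans_lt ?_
        have := mul_lt_mul_of_pos_right hm (by positivity : (0 : ℝ) < 2 ^ J)
        linarith
      have h2 : coverRadius (c - c') n = coverRadius c n - coverRadius c' n := sub_mul _ _ _
      have h3 := hω n hn.1
      rw [mem_ball, Real.dist_eq, not_lt] at h3
      rw [mem_compl_iff, mem_ball, Real.dist_eq, not_lt]
      have h4 := abs_sub_le x y (ω n)
      rw [abs_sub_comm y] at h4
      linarith
    refine (measure_mono hsub).trans ((measure_biUnion_finset_le _ _).trans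
      ((Finset.sum_le_sum fun x _ ↦ h.prob_avoid_le hP hc' k J x).trans ?_))
    rw [← ENNReal.ofReal_sum_of_nonneg fun _ _ ↦ by positivity, ← Finset.mul_sum]
    refine ENNReal.ofReal_le_ofReal (mul_le_mul_of_nonneg_left ?_ (Real.exp_pos _).le)
    exact h.sum_exp_truncPotential_le (by positivity) J m
  have hL0 : 0 ≤ L := by positivity
  have ht : Tendsto (fun J : ℕ ↦ ENNReal.ofReal
      (Real.exp (k + 1) * (Real.exp (c' ^ cantorDim * (m + 1)) * L ^ (J + m)))) atTop (𝓝 0) := by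
    have h1 := (((tendsto_add_atTop_iff_nat m).2 (tendsto_pow_atTop_nhds_zero_of_lt_one hL0
      hrate)).const_mul (Real.exp (c' ^ cantorDim * (m + 1)))).const_mul (Real.exp (k + 1))
    simpa using ENNReal.tendsto_ofReal h1
  exact le_antisymm (ge_of_tendsto' ht hbound) zero_le

end IsSelfSimilar

theorem IsSelfSimilar.prob_cover_eq_one {μ : Measure ℝ} (h : IsSelfSimilar (fun _ ↦ 1 / 2) μ)
    {P : Measure (ℕ → ℝ)}
    (hP : ∀ (I : Finset ℕ) (f : ℕ → Set ℝ), (∀ n, MeasurableSet (f n)) →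
      P {ω | ∀ n ∈ I, ω n ∈ f n} = ∏ n ∈ I, μ (f n))
    {c c' : ℝ} (hc' : 0 < c') (hcc : c' < c)
    (hrate : Real.exp (-(c' ^ cantorDim * (5 / 2 : ℝ) ^ (-cantorDim))) +
      Real.exp (-(c' ^ cantorDim * (11 / 6 : ℝ) ^ (-cantorDim))) < 1) :
    P {ω | cantorSet ⊆ coverSet (coverRadius c) ω} = 1 := by
  have huniv : P univ = 1 := by simpa using hP ∅ (fun _ ↦ univ) fun _ ↦ MeasurableSet.univ
  have h0 : P (⋃ k, {ω | ∃ x ∈ cantorSet, ∀ n, k ≤ n → x ∉ ball (ω n) (coverRadius c n)}) = 0 :=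
    measure_iUnion_null fun k ↦ h.prob_not_cover_eq_zero hP hc' hcc hrate k
  refine le_antisymm (huniv ▸ measure_mono (subset_univ _)) ?_
  have hsub : univ ⊆ {ω | cantorSet ⊆ coverSet (coverRadius c) ω} ∪
      ⋃ k, {ω | ∃ x ∈ cantorSet, ∀ n, k ≤ n → x ∉ ball (ω n) (coverRadius c n)} := by
    intro ω _
    by_cases hω : cantorSet ⊆ coverSet (coverRadius c) ω
    · exact Or.inl hω
    · obtain ⟨x, hx, hxc⟩ := not_subset.1 hω
      simp only [coverSet, mem_iInter, mem_iUnion, not_forall, not_exists] at hxc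
      obtain ⟨k, hk⟩ := hxc
      exact Or.inr (mem_iUnion.2 ⟨k, x, hx, hk⟩)
  calc 1 = P univ := huniv.symm
    _ ≤ _ := measure_mono hsub
    _ ≤ _ := measure_union_le _ _
    _ = _ := by rw [h0, add_zero]

section MaximalErgodic

variable {α : Type*}

/-- The maximum of the Birkhoff sums of `φ` up to time `n`, and of `0`. -/
def maxBirkhoffSum (T : α → α) (φ : α → ℝ) : ℕ → α → ℝ
  | 0, _ => 0
  | n + 1, x => max 0 (φ x + maxBirkhoffSum T φ n (T x))

variable {T : α → α} {φ : α → ℝ}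

lemma maxBirkhoffSum_nonneg (n : ℕ) (x : α) : 0 ≤ maxBirkhoffSum T φ n x := by
  cases n
  · exact le_rfl
  · exact le_max_left _ _

lemma maxBirkhoffSum_le_succ (n : ℕ) :
    ∀ x, maxBirkhoffSum T φ n x ≤ maxBirkhoffSum T φ (n + 1) x := by
  induction n with
  | zero => exact fun x ↦ maxBirkhoffSum_nonneg 1 x
  | succ n ih => exact fun x ↦ max_le_max_left _ (add_le_add_right (ih (T x)) _)

lemma birkhoffSum_le_maxBirkhoffSum (n : ℕ) :
    ∀ x, birkhoffSum T φ n x ≤ maxBirkhoffSum T φ n x := by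
  induction n with
  | zero => intro x; simp [birkhoffSum_zero, maxBirkhoffSum]
  | succ n ih =>
    intro x
    rw [birkhoffSum_succ']
    exact (add_le_add_right (ih (T x)) _).trans (le_max_right _ _)

variable [MeasurableSpace α] {ν : Measure α}

lemma measurable_maxBirkhoffSum (hT : Measurable T) (hφ : Measurable φ) (n : ℕ) :
    Measurable (maxBirkhoffSum T φ n) := by
  induction n with
  | zero => exact measurable_const
  | succ n ih => exact measurable_const.max (hφ.add (ih.comp hT))

lemma integrable_maxBirkhoffSum (hT : MeasurePreserving T ν ν) (hφ : Integrable φ ν) (n : ℕ) :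
    Integrable (maxBirkhoffSum T φ n) ν := by
  induction n with
  | zero => exact integrable_zero _ _ _
  | succ n ih => exact (integrable_zero _ _ _).sup (hφ.add (hT.integrable_comp_of_integrable ih))

lemma setIntegral_maxBirkhoffSum_pos_nonneg (hT : MeasurePreserving T ν ν) (hφm : Measurable φ)
    (hφ : Integrable φ ν) (n : ℕ) : 0 ≤ ∫ x in {x | 0 < maxBirkhoffSum T φ n x}, φ x ∂ν := by
  have hA : MeasurableSet {x | 0 < maxBirkhoffSum T φ n x} :=
    measurableSet_lt measurable_const (measurable_maxBirkhoffSum hT.measurable hφm n)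
  have hi := integrable_maxBirkhoffSum hT hφ n
  have hiT : Integrable (fun x ↦ maxBirkhoffSum T φ n (T x)) ν :=
    hT.integrable_comp_of_integrable hi
  have h0 : ∫ x, (maxBirkhoffSum T φ n x - maxBirkhoffSum T φ n (T x)) ∂ν = 0 := by
    have h1 := integral_map (μ := ν) hT.measurable.aemeasurable (f := maxBirkhoffSum T φ n)
      (measurable_maxBirkhoffSum hT.measurable hφm n).aestronglyMeasurable
    rw [hT.map_eq] at h1
    rw [integral_sub hi hiT, h1]
    exact sub_self _
  rw [← integral_indicator hA]
  refine h0.symm.trans_le (integral_mono (hi.sub hiT) (hφ.indicator hA) fun x ↦ ?_)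
  change maxBirkhoffSum T φ n x - maxBirkhoffSum T φ n (T x) ≤ _
  have hTx := maxBirkhoffSum_nonneg (T := T) (φ := φ) n (T x)
  by_cases hx : 0 < maxBirkhoffSum T φ n x
  · rw [indicator_of_mem (by exact hx)]
    cases n with
    | zero => exact absurd hx (lt_irrefl _)
    | succ n =>
      rcases lt_max_iff.1 hx with h | h
      · exact absurd h (lt_irrefl _)
      · have h1 : maxBirkhoffSum T φ (n + 1) x = φ x + maxBirkhoffSum T φ n (T x) :=
          max_eq_right h.le
        have h2 := maxBirkhoffSum_le_succ (T := T) (φ := φ) n (T x)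
        linarith
  · rw [indicator_of_notMem (by exact hx)]
    linarith

/-- A consequence of the maximal ergodic theorem: if the mean of `φ` is negative, then with positive
probability none of the Birkhoff sums of `φ` is positive. -/
theorem exists_birkhoffSum_nonpos (hT : MeasurePreserving T ν ν) (hφm : Measurable φ)
    (hφ : Integrable φ ν) (hneg : ∫ x, φ x ∂ν < 0) :
    ∃ K, MeasurableSet K ∧ ν K ≠ 0 ∧ ∀ x ∈ K, ∀ n, birkhoffSum T φ n x ≤ 0 := by
  have hA : ∀ n, MeasurableSet {x | 0 < maxBirkhoffSum T φ n x} := fun n ↦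
    measurableSet_lt measurable_const (measurable_maxBirkhoffSum hT.measurable hφm n)
  refine ⟨(⋃ n, {x | 0 < maxBirkhoffSum T φ n x})ᶜ, (MeasurableSet.iUnion hA).compl,
    fun h0 ↦ hneg.not_ge ?_, fun x hx n ↦ ?_⟩
  · have h1 := tendsto_setIntegral_of_monotone (μ := ν) (f := φ) hA
      (monotone_nat_of_le_succ fun n x hx ↦ lt_of_lt_of_le hx (maxBirkhoffSum_le_succ n x))
      hφ.integrableOn
    rw [setIntegral_congr_set (ae_eq_univ.2 h0), setIntegral_univ] at h1
    exact ge_of_tendsto' h1 fun n ↦ setIntegral_maxBirkhoffSum_pos_nonneg hT hφm hφ n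
  · refine (birkhoffSum_le_maxBirkhoffSum n x).trans (not_lt.1 fun h ↦ hx ?_)
    exact mem_iUnion.2 ⟨n, h⟩

end MaximalErgodic

lemma measurable_cantorDigit : Measurable cantorDigit := by
  have : cantorDigit = fun x ↦ if x ≤ 1 / 2 then false else true := by
    ext x; by_cases h : x ≤ 1 / 2
    · rw [cantorDigit, decide_eq_true h, if_pos h]; rfl
    · rw [cantorDigit, decide_eq_false h, if_neg h]; rfl
  rw [this]
  exact Measurable.ite measurableSet_Iic measurable_const measurable_const

theorem IsSelfSimilar.exists_measure_ball_le {μ ν : Measure ℝ} {w : Bool → ℝ}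
    (h : IsSelfSimilar (fun _ ↦ 1 / 2) μ) (h' : IsSelfSimilar w ν) (hw : ∀ e, 0 < w e) {β : ℝ}
    (hβ : β * ∫ x, crossPotential μ x ∂ν <
      w false * -Real.log (w false) + w true * -Real.log (w true)) :
    ∃ ε > 0, ∃ K, MeasurableSet K ∧ K ⊆ cantorSet ∧ ν K ≠ 0 ∧ ∀ x ∈ K, ∀ n : ℕ,
      ν (ball x ((1 / 3) ^ n)) ≤
        ENNReal.ofReal (Real.exp (β - ε * n - β * truncPotential μ n x)) := by
  have := h.isProbabilityMeasure
  have := h'.isProbabilityMeasure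
  set ε := (w false * -Real.log (w false) + w true * -Real.log (w true) -
    β * ∫ x, crossPotential μ x ∂ν) / 2 with hε
  have hε0 : 0 < ε := by rw [hε]; linarith
  have hT := h'.measurePreserving_tentMap
  let I : ℝ → ℝ := fun x ↦ -Real.log (w (cantorDigit x))
  have hIm : Measurable I :=
    (Measurable.of_discrete (f := fun e ↦ -Real.log (w e))).comp measurable_cantorDigit
  have hIi : Integrable I ν := by
    refine Integrable.of_bound hIm.aestronglyMeasurable
      (|Real.log (w false)| + |Real.log (w true)|) (.of_forall fun x ↦ ?_)
    have h1 := abs_nonneg (Real.log (w false))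
    have h2 := abs_nonneg (Real.log (w true))
    simp only [I, norm_neg, Real.norm_eq_abs]
    cases cantorDigit x <;> linarith
  have hκi : Integrable (fun x ↦ crossPotential μ (tentMap x)) ν :=
    hT.integrable_comp_of_integrable
      (h'.integrable_of_continuous (continuous_crossPotential μ))
  have hIint : ∫ x, I x ∂ν = w false * -Real.log (w false) + w true * -Real.log (w true) := by
    have h1 : ∀ e, (fun x ↦ I (cantorMap e x)) =ᵐ[ν] fun _ ↦ -Real.log (w e) := fun e ↦ by
      filter_upwards [h'.ae_mem_Icc] with x hx
      simp only [I, cantorDigit_cantorMap e hx]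
    rw [h'.integral_eq hIm fun e ↦ (integrable_const _).congr (h1 e).symm,
      integral_congr_ae (h1 false), integral_congr_ae (h1 true)]
    simp
  let φ : ℝ → ℝ := fun x ↦ β * crossPotential μ (tentMap x) - I x + ε
  have hφm : Measurable φ :=
    (((((continuous_crossPotential μ).measurable.comp measurable_tentMap).const_mul β).sub
      hIm).add_const ε)
  have hsub : Integrable (fun x ↦ β * crossPotential μ (tentMap x) - I x) ν :=
    (hκi.const_mul β).sub hIi
  have hφi : Integrable φ ν := hsub.add (integrable_const ε)
  have hφ : ∫ x, φ x ∂ν < 0 := by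
    have h1 := integral_map (μ := ν) hT.measurable.aemeasurable (f := crossPotential μ)
      (continuous_crossPotential μ).aestronglyMeasurable
    rw [hT.map_eq] at h1
    have h2 : ∫ x, φ x ∂ν = β * ∫ x, crossPotential μ x ∂ν -
        (w false * -Real.log (w false) + w true * -Real.log (w true)) + ε := by
      change ∫ x, (β * crossPotential μ (tentMap x) - I x + ε) ∂ν = _
      rw [integral_add hsub (integrable_const ε), integral_sub (hκi.const_mul β) hIi, integral_const_mul, hIint, h1]
      simp
    rw [h2]
    linarith
  obtain ⟨K, hK, hK0, hKn⟩ := exists_birkhoffSum_nonpos hT hφm hφi hφ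
  refine ⟨ε, hε0, K ∩ cantorSet, hK.inter isClosed_cantorSet.measurableSet, inter_subset_right,
    ?_, fun x ⟨hxK, hxC⟩ n ↦ ?_⟩
  · rwa [measure_inter_conull h'.compl_eq]
  · refine (h'.measure_ball_le n x hxC).trans (ENNReal.ofReal_le_ofReal ?_)
    have h1 : ∏ i ∈ Finset.range n, w (cantorDigit (tentMap^[i] x)) =
        Real.exp (-∑ i ∈ Finset.range n, I (tentMap^[i] x)) := by
      rw [← Finset.sum_neg_distrib, Real.exp_sum]
      refine Finset.prod_congr rfl fun i _ ↦ ?_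
      simp only [I, neg_neg]
      rw [Real.exp_log (hw _)]
    rw [h1, Real.exp_le_exp, h.truncPotential_eq n x hxC]
    have h2 := hKn x hxK n
    rw [birkhoffSum] at h2
    simp only [φ, Finset.sum_add_distrib, Finset.sum_sub_distrib, ← Finset.mul_sum,
      Finset.sum_const, Finset.card_range, nsmul_eq_mul, ← Function.iterate_succ_apply'] at h2
    linarith

lemma ENNReal.two_mul_mul_le_sq_add_sq (a b : ℝ≥0∞) : 2 * a * b ≤ a * a + b * b := by
  rcases eq_or_ne a ⊤ with rfl | ha
  · simp
  rcases eq_or_ne b ⊤ with rfl | hb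
  · simp
  lift a to NNReal using ha
  lift b to NNReal using hb
  have := two_mul_le_add_sq a b
  rw [sq, sq] at this
  exact_mod_cast this

/-- A second moment bound for the probability that a random set `{x | ω ∈ A x}` is `ν`-null. -/
theorem measure_mul_le_of_second_moment {Ω : Type*} [MeasurableSpace Ω] (P : Measure Ω)
    [IsProbabilityMeasure P] (ν : Measure ℝ) [IsFiniteMeasure ν] (hν : ν univ ≠ 0)
    {A : ℝ → Set Ω} (hA : MeasurableSet {q : Ω × ℝ | q.1 ∈ A q.2})
    (hpos : ∀ᵐ x ∂ν, P (A x) ≠ 0) {G : ℝ → ℝ → ℝ≥0∞} {τ : ℝ≥0∞}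
    (hG : ∀ᵐ x ∂ν, ∀ᵐ y ∂ν, P (A x ∩ A y) ≤ P (A x) * P (A y) * G x y)
    (hGi : ∀ᵐ x ∂ν, ∫⁻ y, G x y ∂ν ≤ ν univ + τ) {E : Set Ω}
    (hE : ∀ ω ∈ E, ∀ᵐ x ∂ν, ω ∉ A x) : P E * ν univ ≤ τ := by
  set m := ν univ with hm
  have hm' : m ≠ ⊤ := measure_ne_top _ _
  have hAx : ∀ x, MeasurableSet (A x) := fun x ↦ measurable_prodMk_right hA
  let g : ℝ → ℝ≥0∞ := fun x ↦ (P (A x))⁻¹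
  have hg : Measurable g := (measurable_measure_prodMk_right hA).inv
  let F : Ω → ℝ → ℝ≥0∞ := fun ω x ↦ (A x).indicator (fun _ ↦ g x) ω
  have hF : Measurable (Function.uncurry F) := (hg.comp measurable_snd).indicator hA
  have hFl : ∀ ω, Measurable (F ω) := fun ω ↦ hF.comp measurable_prodMk_left
  have hFr : ∀ x, Measurable fun ω ↦ F ω x := fun x ↦ hF.comp measurable_prodMk_right
  let M : Ω → ℝ≥0∞ := fun ω ↦ ∫⁻ x, F ω x ∂ν
  have hM : Measurable M := hF.lintegral_prod_right'
  have h1 : ∫⁻ ω, M ω ∂P = m := by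
    rw [lintegral_lintegral_swap hF.aemeasurable]
    have : ∀ᵐ x ∂ν, ∫⁻ ω, F ω x ∂P = 1 := by
      filter_upwards [hpos] with x hx
      rw [lintegral_indicator_const (hAx x)]
      exact ENNReal.inv_mul_cancel hx (measure_ne_top _ _)
    rw [lintegral_congr_ae this]
    simp [hm]
  have h2 : ∫⁻ ω, M ω * M ω ∂P ≤ m * (m + τ) := by
    have e1 : ∀ ω, M ω * M ω = ∫⁻ x, F ω x * M ω ∂ν := fun ω ↦
      (lintegral_mul_const _ (hFl ω)).symm
    simp_rw [e1]
    rw [lintegral_lintegral_swap (hF.mul (hM.comp measurable_fst)).aemeasurable]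
    have e2 : ∀ᵐ x ∂ν, ∫⁻ ω, F ω x * M ω ∂P ≤ m + τ := by
      filter_upwards [hpos, hG, hGi] with x hx hGx hGix
      have e3 : ∀ ω, F ω x * M ω = ∫⁻ y, F ω x * F ω y ∂ν := fun ω ↦
        (lintegral_const_mul _ (hFl ω)).symm
      simp_rw [e3]
      rw [lintegral_lintegral_swap (((hFr x).comp measurable_fst).mul hF).aemeasurable]
      refine le_trans (lintegral_mono_ae ?_) hGix
      filter_upwards [hpos, hGx] with y hy hxy
      have e4 : ∀ ω, F ω x * F ω y = (A x ∩ A y).indicator (fun _ ↦ g x * g y) ω := fun ω ↦ by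
        by_cases hωx : ω ∈ A x <;> by_cases hωy : ω ∈ A y <;> simp [F, hωx, hωy]
      simp_rw [e4]
      rw [lintegral_indicator_const ((hAx x).inter (hAx y))]
      calc g x * g y * P (A x ∩ A y) ≤ g x * g y * (P (A x) * P (A y) * G x y) := by gcongr
        _ = (g x * P (A x)) * (g y * P (A y)) * G x y := by ring
        _ = G x y := by
          rw [ENNReal.inv_mul_cancel hx (measure_ne_top _ _),
            ENNReal.inv_mul_cancel hy (measure_ne_top _ _), one_mul, one_mul]
    refine (lintegral_mono_ae e2).trans ?_
    rw [lintegral_const, mul_comm]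
  have hZ : MeasurableSet {ω | M ω = 0} := hM (measurableSet_singleton 0)
  have hEZ : P E ≤ P {ω | M ω = 0} := by
    refine measure_mono fun ω hω ↦ ?_
    refine (lintegral_eq_zero_iff (hFl ω)).2 ((hE ω hω).mono fun x hx ↦ ?_)
    exact indicator_of_notMem hx _
  have h3 : 2 * m * m + m * m * P {ω | M ω = 0} ≤ m * (m + τ) + m * m := by
    calc 2 * m * m + m * m * P {ω | M ω = 0}
        = ∫⁻ ω, (2 * m * M ω + {ω | M ω = 0}.indicator (fun _ ↦ m * m) ω) ∂P := by
          rw [lintegral_add_left (hM.const_mul _), lintegral_const_mul _ hM, h1,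
            lintegral_indicator_const hZ]
      _ ≤ ∫⁻ ω, (M ω * M ω + m * m) ∂P := by
          refine lintegral_mono fun ω ↦ ?_
          by_cases hω : M ω = 0
          · simp [hω]
          · rw [indicator_of_notMem (by exact hω), add_zero, add_comm]
            exact ENNReal.two_mul_mul_le_sq_add_sq _ _
      _ ≤ m * (m + τ) + m * m := by
          have hMM : Measurable fun ω ↦ M ω * M ω := hM.mul hM
          rw [lintegral_add_left hMM, lintegral_const, measure_univ, mul_one]
          gcongr
  have hmm : m * m ≠ ⊤ := ENNReal.mul_ne_top hm' hm'
  have h4 : 2 * (m * m) + m * (P {ω | M ω = 0} * m) ≤ 2 * (m * m) + m * τ := by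
    calc _ = 2 * m * m + m * m * P {ω | M ω = 0} := by ring
      _ ≤ _ := h3
      _ = _ := by ring
  rw [ENNReal.add_le_add_iff_left (ENNReal.mul_ne_top ENNReal.ofNat_ne_top hmm),
    ENNReal.mul_le_mul_iff_right hν hm'] at h4
  exact (mul_le_mul_left hEZ m).trans h4

lemma exists_forall_coverRadius_le {c t : ℝ} (hc : 0 < c) (ht : 0 < t) :
    ∃ k, ∀ n, k ≤ n → coverRadius c n ≤ t := by
  obtain ⟨k, hk⟩ := exists_nat_ge (c ^ cantorDim * t ^ (-cantorDim))
  refine ⟨k, fun n hn ↦ ?_⟩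
  have hn' : (k : ℝ) ≤ n := mod_cast hn
  rw [← not_lt, lt_coverRadius_iff hc ht]
  linarith

namespace IsSelfSimilar

variable {μ : Measure ℝ}

lemma exists_forall_measureReal_ball_le (h : IsSelfSimilar (fun _ ↦ 1 / 2) μ) {c a : ℝ}
    (hc : 0 < c) (ha : 0 < a) :
    ∃ k, ∀ n, k ≤ n → ∀ x ∈ cantorSet, μ.real (ball x (coverRadius c n)) ≤ a := by
  have := h.isProbabilityMeasure
  obtain ⟨q, hq⟩ := exists_pow_lt_of_lt_one ha (by norm_num : (1 : ℝ) / 2 < 1)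
  obtain ⟨k, hk⟩ := exists_forall_coverRadius_le hc (by positivity : (0 : ℝ) < (1 / 3) ^ q)
  refine ⟨k, fun n hn x hx ↦ ?_⟩
  refine ENNReal.toReal_le_of_le_ofReal ha.le ?_
  exact (measure_mono (ball_subset_ball (hk n hn))).trans
    ((h.measure_ball_le_half q hx).trans (ENNReal.ofReal_le_ofReal hq.le))

lemma measure_compl_inter_compl_le [IsProbabilityMeasure μ] {A B : Set ℝ} (hA : MeasurableSet A)
    (hB : MeasurableSet B) {a q : ℝ} (ha : a ≤ 1) (hAa : μ.real A ≤ a) (hBa : μ.real B ≤ a)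
    (hq : 1 ≤ q * (1 - a) ^ 2) :
    μ (Aᶜ ∩ Bᶜ) ≤ μ Aᶜ * μ Bᶜ * ENNReal.ofReal (Real.exp (q * μ.real (A ∩ B))) := by
  have hq0 : 0 ≤ q := by
    by_contra! h
    nlinarith [sq_nonneg (1 - a)]
  rw [← compl_union, ← ofReal_measureReal, ← ofReal_measureReal (s := Aᶜ),
    ← ofReal_measureReal (s := Bᶜ), probReal_compl_eq_one_sub (hA.union hB),
    probReal_compl_eq_one_sub hA, probReal_compl_eq_one_sub hB,
    ← ENNReal.ofReal_mul (by linarith), ← ENNReal.ofReal_mul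
      (mul_nonneg (by linarith) (by linarith))]
  refine ENNReal.ofReal_le_ofReal ?_
  have h1 := measureReal_union_add_inter (μ := μ) (s := A) hB
  have h2 : (1 - a) ^ 2 ≤ (1 - μ.real A) * (1 - μ.real B) := by
    rw [sq]; exact mul_le_mul (by linarith) (by linarith) (by linarith) (by linarith)
  have hA0 := measureReal_nonneg (μ := μ) (s := A)
  have hB0 := measureReal_nonneg (μ := μ) (s := B)
  have hd := measureReal_nonneg (μ := μ) (s := A ∩ B)
  have h3 : 0 ≤ (1 - μ.real A) * (1 - μ.real B) := (sq_nonneg _).trans h2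
  have h4 := mul_le_mul_of_nonneg_left (Real.add_one_le_exp (q * μ.real (A ∩ B))) h3
  have h5 := mul_le_mul_of_nonneg_right (hq.trans (mul_le_mul_of_nonneg_left h2 hq0)) hd
  nlinarith [mul_nonneg hA0 hB0]

lemma sum_measureReal_inter_le (h : IsSelfSimilar (fun _ ↦ 1 / 2) μ) {c : ℝ} (hc : 0 < c)
    (k N j : ℕ) {x y : ℝ} (hxy : (1 / 3) ^ (j + 1) ≤ |x - y|) :
    ∑ n ∈ Finset.Ico k N, μ.real (ball x (coverRadius c n) ∩ ball y (coverRadius c n)) ≤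
      c ^ cantorDim * truncPotential μ (j + 2) x := by
  have := h.isProbabilityMeasure
  refine le_trans ?_ (h.sum_measureReal_ball_le hc
    (Nat.floor_le (by positivity : (0 : ℝ) ≤ c ^ cantorDim * 2 ^ (j + 2))) x)
  rw [← Finset.sum_filter_ne_zero]
  refine (Finset.sum_le_sum fun n _ ↦ measureReal_mono inter_subset_left).trans
    (Finset.sum_le_sum_of_subset_of_nonneg (fun n hn ↦ ?_) fun _ _ _ ↦ measureReal_nonneg)
  replace hn := (Finset.mem_filter.1 hn).2
  have hne : (ball x (coverRadius c n) ∩ ball y (coverRadius c n)).Nonempty := by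
    by_contra! h0
    simp [h0] at hn
  obtain ⟨z, hzx, hzy⟩ := hne
  rw [mem_ball, Real.dist_eq] at hzx hzy
  have h1 := abs_sub_le x z y
  rw [abs_sub_comm x z] at h1
  have h2 : ((1 : ℝ) / 3) ^ (j + 2) < coverRadius c n := by
    have h3 : (0 : ℝ) < (1 / 3) ^ (j + 1) := by positivity
    rw [pow_succ]
    linarith
  rw [lt_coverRadius_iff hc (by positivity), third_pow_rpow_neg_cantorDim] at h2
  rw [Finset.mem_range, Nat.lt_iff_add_one_le, Nat.le_floor_iff (by positivity)]
  push_cast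
  exact h2.le

lemma lintegral_exp_sum_inter_le (h : IsSelfSimilar (fun _ ↦ 1 / 2) μ) {c : ℝ} (hc : 0 < c)
    {ν : Measure ℝ} {β ε : ℝ} (hε : 0 < ε) (hβ : 0 ≤ β) {x : ℝ} (hx : x ∈ cantorSet)
    (hb : ∀ n : ℕ, ν (ball x ((1 / 3) ^ n)) ≤
      ENNReal.ofReal (Real.exp (β - ε * n - β * truncPotential μ n x)))
    {k L : ℕ} (hk : ∀ n, k ≤ n → coverRadius c n ≤ (1 / 3) ^ (L + 1)) (N : ℕ)
    {K : Set ℝ} (hK : K ⊆ cantorSet) (hKm : MeasurableSet K) :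
    ∫⁻ y in K, ENNReal.ofReal (Real.exp (β / c ^ cantorDim * ∑ n ∈ Finset.Ico k N,
      μ.real (ball x (coverRadius c n) ∩ ball y (coverRadius c n)))) ∂ν ≤
      ν K + ∑' j : ℕ, ENNReal.ofReal (Real.exp (3 * β - ε * (j + L : ℕ))) := by
  have := h.isProbabilityMeasure
  have hβ0 : 0 < c ^ cantorDim := by positivity
  have hU : ∀ n, 0 ≤ truncPotential μ n x := fun n ↦
    integral_nonneg fun _ ↦ truncKernel_nonneg _ _
  have hatom : ν {x} = 0 := by
    have ht : Tendsto (fun n : ℕ ↦ ENNReal.ofReal (Real.exp (β - ε * n))) atTop (𝓝 0) := by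
      rw [← ENNReal.ofReal_zero]
      refine ENNReal.tendsto_ofReal (Real.tendsto_exp_atBot.comp ?_)
      exact tendsto_atBot_add_const_left _ β (tendsto_neg_atTop_atBot.comp
        (tendsto_natCast_atTop_atTop.const_mul_atTop hε))
    refine le_antisymm (ge_of_tendsto' ht fun n ↦ ?_) zero_le
    refine (measure_mono (singleton_subset_iff.2 (mem_ball_self (by positivity)))).trans
      ((hb n).trans (ENNReal.ofReal_le_ofReal (Real.exp_le_exp.2 ?_)))
    have := mul_nonneg hβ (hU n)
    linarith
  have hpt : ∀ᵐ y ∂ν.restrict K, ENNReal.ofReal (Real.exp (β / c ^ cantorDim *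
      ∑ n ∈ Finset.Ico k N, μ.real (ball x (coverRadius c n) ∩ ball y (coverRadius c n)))) ≤
      1 + ∑' j : ℕ, (ball x ((1 / 3) ^ (j + L))).indicator
        (fun _ ↦ ENNReal.ofReal (Real.exp (β * truncPotential μ (j + L + 2) x))) y := by
    have h1 : ∀ᵐ y ∂ν.restrict K, y ≠ x :=
      ae_restrict_of_ae (by rw [ae_iff]; simpa using hatom)
    filter_upwards [h1, ae_restrict_mem hKm] with y hyx hyK
    have hyC := cantorSet_subset_unitInterval (hK hyK)
    have hxC := cantorSet_subset_unitInterval hx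
    have hpos : 0 < |x - y| := abs_pos.2 (sub_ne_zero.2 hyx.symm)
    rcases le_or_gt ((1 / 3) ^ L) |x - y| with hfar | hnear
    · have h2 : ∀ n ∈ Finset.Ico k N,
          μ.real (ball x (coverRadius c n) ∩ ball y (coverRadius c n)) = 0 := fun n hn ↦ by
        have h3 := hk n (Finset.mem_Ico.1 hn).1
        have h4 : (0 : ℝ) < (1 / 3) ^ L := by positivity
        rw [pow_succ] at h3
        rw [(ball_disjoint_ball (by rw [Real.dist_eq]; linarith)).inter_eq]
        simp
      rw [Finset.sum_eq_zero h2]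
      simp
    · have hex : ∃ m, (1 / 3 : ℝ) ^ (m + L) ≤ |x - y| := by
        obtain ⟨m, hm⟩ := exists_pow_lt_of_lt_one hpos (by norm_num : (1 / 3 : ℝ) < 1)
        exact ⟨m, (pow_le_pow_of_le_one (by norm_num) (by norm_num) (by lia)).trans hm.le⟩
      classical
      obtain ⟨j, hj⟩ : ∃ j, Nat.find hex = j + 1 := Nat.exists_eq_succ_of_ne_zero fun h0 ↦ by
        have := Nat.find_spec hex
        rw [h0, zero_add] at this
        exact absurd hnear this.not_gt
      have hj1 : (1 / 3 : ℝ) ^ (j + L + 1) ≤ |x - y| := by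
        have := Nat.find_spec hex
        rwa [hj, add_right_comm] at this
      have hj2 : |x - y| < (1 / 3 : ℝ) ^ (j + L) :=
        not_le.1 (Nat.find_min hex (by lia : j < Nat.find hex))
      refine le_trans ?_ (le_add_of_nonneg_left zero_le)
      refine le_trans ?_ (ENNReal.le_tsum j)
      rw [indicator_of_mem (by rwa [mem_ball, Real.dist_eq, abs_sub_comm])]
      refine ENNReal.ofReal_le_ofReal (Real.exp_le_exp.2 ?_)
      refine (mul_le_mul_of_nonneg_left (h.sum_measureReal_inter_le hc k N (j + L) hj1)
        (by positivity)).trans_eq ?_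
      rw [← mul_assoc, div_mul_cancel₀ _ hβ0.ne']
  refine (lintegral_mono_ae hpt).trans ?_
  rw [lintegral_add_left measurable_const, lintegral_const, one_mul, Measure.restrict_apply_univ,
    lintegral_tsum fun j ↦ (measurable_const.indicator measurableSet_ball).aemeasurable]
  gcongr with j
  rw [lintegral_indicator_const measurableSet_ball]
  refine (mul_le_mul_right ((Measure.restrict_apply_le _ _).trans (hb _)) _).trans ?_
  rw [← ENNReal.ofReal_mul (Real.exp_pos _).le, ← Real.exp_add]
  refine ENNReal.ofReal_le_ofReal (Real.exp_le_exp.2 ?_)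
  have h1 := mul_le_mul_of_nonneg_left (h.truncPotential_add_le (j + L) 2 hx) hβ
  push_cast at h1 ⊢
  linarith

end IsSelfSimilar

/-- By compactness, the Cantor set is covered by finitely many of the balls of index at least `k`. -/
lemma setOf_subset_coverSet_subset (r : ℕ → ℝ) (k : ℕ) :
    {ω | cantorSet ⊆ coverSet r ω} ⊆
      ⋃ N, {ω | cantorSet ⊆ ⋃ n ∈ Finset.Ico k N, ball (ω n) (r n)} := by
  intro ω hω
  have h1 : cantorSet ⊆ ⋃ N, ⋃ n ∈ Finset.Ico k N, ball (ω n) (r n) := fun x hx ↦ by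
    have h2 := mem_iInter.1 (hω hx) k
    simp only [mem_iUnion, exists_prop, Finset.mem_Ico] at h2 ⊢
    obtain ⟨n, hn, hxn⟩ := h2
    exact ⟨n + 1, n, ⟨hn, n.lt_succ_self⟩, hxn⟩
  refine mem_iUnion.2 (isCompact_cantorSet.elim_directed_cover _
    (fun N ↦ isOpen_biUnion fun _ _ ↦ isOpen_ball) h1 (directed_of_isDirected_le ?_))
  exact fun N N' hN ↦ biUnion_subset_biUnion_left
    (Finset.coe_subset.2 (Finset.Ico_subset_Ico_right hN))

lemma measurableSet_forall_notMem_ball (r : ℕ → ℝ) (I : Finset ℕ) :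
    MeasurableSet {q : (ℕ → ℝ) × ℝ | ∀ n ∈ I, q.1 n ∈ (ball q.2 (r n))ᶜ} := by
  have : {q : (ℕ → ℝ) × ℝ | ∀ n ∈ I, q.1 n ∈ (ball q.2 (r n))ᶜ} =
      ⋂ n ∈ I, {q : (ℕ → ℝ) × ℝ | r n ≤ dist (q.1 n) q.2} := by
    ext q; simp
  rw [this]
  refine Finset.measurableSet_biInter _ fun n _ ↦ measurableSet_le measurable_const ?_
  exact (((measurable_pi_apply n).comp measurable_fst).dist measurable_snd)

namespace IsSelfSimilar

variable {μ : Measure ℝ}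

lemma prob_cover_mul_le (h : IsSelfSimilar (fun _ ↦ 1 / 2) μ) {P : Measure (ℕ → ℝ)}
    (hP : ∀ (I : Finset ℕ) (f : ℕ → Set ℝ), (∀ n, MeasurableSet (f n)) →
      P {ω | ∀ n ∈ I, ω n ∈ f n} = ∏ n ∈ I, μ (f n)) {c : ℝ} (hc : 0 < c)
    {ν : Measure ℝ} [IsFiniteMeasure ν] {β ε : ℝ} (hβ : c ^ cantorDim < β) (hε : 0 < ε)
    {K : Set ℝ} (hKm : MeasurableSet K) (hK : K ⊆ cantorSet) (hK0 : ν K ≠ 0)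
    (hb : ∀ x ∈ K, ∀ n : ℕ, ν (ball x ((1 / 3) ^ n)) ≤
      ENNReal.ofReal (Real.exp (β - ε * n - β * truncPotential μ n x))) (L : ℕ) :
    P {ω | cantorSet ⊆ coverSet (coverRadius c) ω} * ν K ≤
      ∑' j : ℕ, ENNReal.ofReal (Real.exp (3 * β - ε * (j + L : ℕ))) := by
  have := h.isProbabilityMeasure
  have : IsProbabilityMeasure P := ⟨by simpa using hP ∅ (fun _ ↦ univ) fun _ ↦ .univ⟩
  have hs : 0 < c ^ cantorDim := by positivity
  set q := β / c ^ cantorDim with hq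
  have hq1 : 1 < q := (one_lt_div hs).2 hβ
  obtain ⟨a, ha0, ha1, haq⟩ : ∃ a, 0 < a ∧ a < 1 ∧ 1 ≤ q * (1 - a) ^ 2 := by
    refine ⟨(q - 1) / (2 * q), by apply div_pos <;> linarith, ?_, ?_⟩
    · rw [div_lt_one (by linarith)]; linarith
    · have : q * (1 - (q - 1) / (2 * q)) ^ 2 = (q + 1) ^ 2 / (4 * q) := by
        field_simp; ring
      rw [this, le_div_iff₀ (by linarith)]
      nlinarith [sq_nonneg (q - 1)]
  obtain ⟨k₁, hk₁⟩ := exists_forall_coverRadius_le hc (by positivity : (0 : ℝ) < (1 / 3) ^ (L + 1))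
  obtain ⟨k₂, hk₂⟩ := h.exists_forall_measureReal_ball_le hc ha0
  set k := max k₁ k₂ with hk
  let r := coverRadius c
  let A : ℕ → ℝ → Set (ℕ → ℝ) := fun N x ↦ {ω | ∀ n ∈ Finset.Ico k N, ω n ∈ (ball x (r n))ᶜ}
  have hmain : ∀ N, P {ω | cantorSet ⊆ ⋃ n ∈ Finset.Ico k N, ball (ω n) (r n)} * ν K ≤
      ∑' j : ℕ, ENNReal.ofReal (Real.exp (3 * β - ε * (j + L : ℕ))) := fun N ↦ by
    have hPA : ∀ x, P (A N x) = ∏ n ∈ Finset.Ico k N, μ (ball x (r n))ᶜ := fun x ↦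
      hP _ _ fun n ↦ measurableSet_ball.compl
    have hball : ∀ n ∈ Finset.Ico k N, ∀ x ∈ cantorSet, μ.real (ball x (r n)) ≤ a :=
      fun n hn ↦ hk₂ n ((le_max_right _ _).trans (Finset.mem_Ico.1 hn).1)
    have key := measure_mul_le_of_second_moment P (ν.restrict K) (by simpa using hK0)
      (A := A N) (measurableSet_forall_notMem_ball r (Finset.Ico k N))
      (τ := ∑' j : ℕ, ENNReal.ofReal (Real.exp (3 * β - ε * (j + L : ℕ))))
      (G := fun x y ↦ ENNReal.ofReal (Real.exp (q * ∑ n ∈ Finset.Ico k N,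
        μ.real (ball x (r n) ∩ ball y (r n)))))
      (E := {ω | cantorSet ⊆ ⋃ n ∈ Finset.Ico k N, ball (ω n) (r n)}) ?_ ?_ ?_ ?_
    · rwa [Measure.restrict_apply_univ] at key
    · filter_upwards [ae_restrict_mem hKm] with x hx
      rw [hPA]
      refine Finset.prod_ne_zero_iff.2 fun n hn ↦ ?_
      rw [← ENNReal.toReal_ne_zero.trans ⟨And.left, fun h ↦ ⟨h, measure_ne_top _ _⟩⟩]
      change μ.real (ball x (r n))ᶜ ≠ 0
      rw [probReal_compl_eq_one_sub measurableSet_ball]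
      linarith [hball n hn x (hK hx)]
    · filter_upwards [ae_restrict_mem hKm] with x hx
      filter_upwards [ae_restrict_mem hKm] with y hy
      have hinter : A N x ∩ A N y =
          {ω | ∀ n ∈ Finset.Ico k N, ω n ∈ (ball x (r n))ᶜ ∩ (ball y (r n))ᶜ} := by
        ext ω
        simp only [A, mem_inter_iff, mem_ofPred_eq, forall_and]
      rw [hinter, hP _ _ fun n ↦ measurableSet_ball.compl.inter measurableSet_ball.compl, hPA, hPA,
        Finset.mul_sum, Real.exp_sum, ENNReal.ofReal_prod_of_nonneg fun _ _ ↦ (Real.exp_pos _).le,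
        ← Finset.prod_mul_distrib, ← Finset.prod_mul_distrib]
      exact Finset.prod_le_prod' fun n hn ↦ measure_compl_inter_compl_le measurableSet_ball
        measurableSet_ball ha1.le (hball n hn x (hK hx)) (hball n hn y (hK hy)) haq
    · filter_upwards [ae_restrict_mem hKm] with x hx
      rw [Measure.restrict_apply_univ]
      exact h.lintegral_exp_sum_inter_le hc hε (hs.trans hβ).le (hK hx) (hb x hx)
        (fun n hn ↦ hk₁ n ((le_max_left _ _).trans hn)) N hK hKm
    · intro ω hω
      filter_upwards [ae_restrict_mem hKm] with x hx hxA
      obtain ⟨n, hn, hxn⟩ := mem_iUnion₂.1 (hω (hK hx))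
      exact hxA n hn (mem_ball_comm.1 hxn)
  have hmono : Monotone fun N ↦ {ω : ℕ → ℝ | cantorSet ⊆ ⋃ n ∈ Finset.Ico k N, ball (ω n) (r n)} :=
    fun N N' hN ω hω ↦ hω.trans (biUnion_subset_biUnion_left
      (Finset.coe_subset.2 (Finset.Ico_subset_Ico_right hN)))
  calc _ ≤ (⨆ N, P {ω | cantorSet ⊆ ⋃ n ∈ Finset.Ico k N, ball (ω n) (r n)}) * ν K := by
        gcongr
        rw [← hmono.measure_iUnion]
        exact measure_mono (setOf_subset_coverSet_subset _ _)
    _ ≤ _ := by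
        rw [ENNReal.iSup_mul]
        exact iSup_le hmain

theorem prob_cover_eq_zero (h : IsSelfSimilar (fun _ ↦ 1 / 2) μ) {P : Measure (ℕ → ℝ)}
    (hP : ∀ (I : Finset ℕ) (f : ℕ → Set ℝ), (∀ n, MeasurableSet (f n)) →
      P {ω | ∀ n ∈ I, ω n ∈ f n} = ∏ n ∈ I, μ (f n)) {c : ℝ} (hc : 0 < c)
    {w : Bool → ℝ} (hw : ∀ e, 0 < w e) {ν : Measure ℝ} (hν : IsSelfSimilar w ν) {β : ℝ}
    (hβ : c ^ cantorDim < β) (hcross : β * ∫ x, crossPotential μ x ∂ν <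
      w false * -Real.log (w false) + w true * -Real.log (w true)) :
    P {ω | cantorSet ⊆ coverSet (coverRadius c) ω} = 0 := by
  obtain ⟨ε, hε, K, hKm, hK, hK0, hb⟩ := h.exists_measure_ball_le hν hw hcross
  have := hν.isProbabilityMeasure
  have hsum : ∑' j : ℕ, ENNReal.ofReal (Real.exp (3 * β - ε * j)) ≠ ⊤ := by
    have : Summable fun j : ℕ ↦ Real.exp (3 * β - ε * j) := by
      have h1 : (fun j : ℕ ↦ Real.exp (3 * β - ε * j)) =
          fun j : ℕ ↦ Real.exp (3 * β) * Real.exp (-ε) ^ j := by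
        ext j
        rw [← Real.exp_nat_mul, ← Real.exp_add]
        ring_nf
      rw [h1]
      exact (summable_geometric_of_lt_one (Real.exp_pos _).le
        (Real.exp_lt_one_iff.2 (neg_lt_zero.2 hε))).mul_left _
    exact this.tsum_ofReal_ne_top
  have ht := ENNReal.tendsto_sum_nat_add _ hsum
  have h0 := ge_of_tendsto' ht fun L ↦ h.prob_cover_mul_le hP hc hβ hε hKm hK hK0 hb L
  exact (mul_eq_zero.1 (le_antisymm h0 zero_le)).resolve_right hK0

end IsSelfSimilar

/-- The coefficients of a polynomial majorant of `(1 + t) ^ (-s)`: the binomial series, truncated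
at degree five, with an enlarged term of degree six. -/
def binomialMajorantCoeff (s : ℝ) : ℕ → ℝ
  | 0 => 1
  | 1 => -s
  | 2 => s * (s + 1) / 2
  | 3 => -(s * (s + 1) * (s + 2) / 6)
  | 4 => s * (s + 1) * (s + 2) * (s + 3) / 24
  | 5 => -(s * (s + 1) * (s + 2) * (s + 3) * (s + 4) / 120)
  | _ => 4 / 5

lemma one_add_rpow_neg_le {s t : ℝ}
    (hs : s * (s + 1) * (s + 2) * (s + 3) * (s + 4) * (s + 5) / 120 ≤ (6 - s) * (2 / 5))
    (hs0 : 0 ≤ s) (ht : |t| ≤ 1 / 2) :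
    (1 + t) ^ (-s) ≤ ∑ k ∈ Finset.range 7, binomialMajorantCoeff s k * t ^ k := by
  set p : ℝ → ℝ := fun t ↦ ∑ k ∈ Finset.range 7, binomialMajorantCoeff s k * t ^ k with hp
  set D : ℝ → ℝ := fun t ↦ (1 + t) ^ (s - 1) * (t ^ 5 * (6 * (4 / 5) -
    s * (s + 1) * (s + 2) * (s + 3) * (s + 4) * (s + 5) / 120 + (6 + s) * (4 / 5) * t))
  have hderiv : ∀ u : ℝ, -(1 / 2) ≤ u → HasDerivAt (fun t ↦ p t * (1 + t) ^ s) (D u) u := by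
    intro u hu
    have hu' : 0 < 1 + u := by linarith
    have h1 : HasDerivAt p (∑ k ∈ Finset.range 7, binomialMajorantCoeff s k * (k * u ^ (k - 1))) u := by
      refine HasDerivAt.fun_sum fun k _ ↦ ?_
      exact (hasDerivAt_pow k u).const_mul _
    have h2 := ((hasDerivAt_id u).const_add 1).rpow_const (p := s) (Or.inl hu'.ne')
    refine (h1.mul h2).congr_deriv ?_
    have h3 : (1 + u) ^ s = (1 + u) ^ (s - 1) * (1 + u) := by
      rw [← Real.rpow_add_one hu'.ne']; ring_nf
    simp only [id, h3, D, hp, Finset.sum_range_succ, Finset.sum_range_zero, binomialMajorantCoeff]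
    push_cast
    ring
  have hcont : ContinuousOn (fun t ↦ p t * (1 + t) ^ s) (Ici (-(1 / 2))) :=
    fun u hu ↦ (hderiv u hu).continuousAt.continuousWithinAt
  have hlin : ∀ u : ℝ, -(1 / 2) ≤ u → 0 ≤ 6 * (4 / 5) -
      s * (s + 1) * (s + 2) * (s + 3) * (s + 4) * (s + 5) / 120 + (6 + s) * (4 / 5) * u :=
    fun u hu ↦ by nlinarith
  have h0 : p 0 * (1 + 0) ^ s = 1 := by simp [hp, Finset.sum_range_succ, binomialMajorantCoeff]
  obtain ⟨ht1, ht2⟩ := abs_le.1 ht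
  have hge : 1 ≤ p t * (1 + t) ^ s := by
    rcases le_total 0 t with h | h
    · have := monotoneOn_of_deriv_nonneg (convex_Ici 0) (f := fun t ↦ p t * (1 + t) ^ s)
        (hcont.mono (Ici_subset_Ici.2 (by norm_num)))
        (fun u hu ↦ ?_) (fun u hu ↦ ?_) self_mem_Ici h h
      · exact h0.symm.le.trans this
      · rw [interior_Ici] at hu
        exact (hderiv u (by linarith [mem_Ioi.1 hu])).differentiableAt.differentiableWithinAt
      · rw [interior_Ici] at hu
        have hu0 := mem_Ioi.1 hu
        rw [(hderiv u (by linarith)).deriv]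
        have := hlin u (by linarith)
        positivity
    · have := antitoneOn_of_deriv_nonpos (convex_Icc (-(1 / 2) : ℝ) 0)
        (f := fun t ↦ p t * (1 + t) ^ s)
        (hcont.mono Icc_subset_Ici_self)
        (fun u hu ↦ ?_) (fun u hu ↦ ?_) ⟨ht1, h⟩ (right_mem_Icc.2 (by norm_num)) h
      · exact h0.symm.le.trans this
      · rw [interior_Icc] at hu
        exact (hderiv u hu.1.le).differentiableAt.differentiableWithinAt
      · rw [interior_Icc] at hu
        obtain ⟨hu1, hu2⟩ := hu
        rw [(hderiv u hu1.le).deriv]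
        have h5 : u ^ 5 ≤ 0 := Odd.pow_nonpos (by decide) hu2.le
        have h6 : 0 ≤ (1 + u) ^ (s - 1) := Real.rpow_nonneg (by linarith) _
        exact mul_nonpos_of_nonneg_of_nonpos h6 (mul_nonpos_of_nonpos_of_nonneg h5 (hlin u hu1.le))
  have hpos : 0 < (1 + t) ^ s := Real.rpow_pos_of_pos (by linarith) _
  rw [Real.rpow_neg (by linarith), inv_eq_one_div, div_le_iff₀ hpos]
  exact hge

lemma cantorDim_mem_Icc : cantorDim ∈ Icc (0.63092 : ℝ) 0.63094 := by
  have h2 := Real.log_two_gt_d9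
  have h2' := Real.log_two_lt_d9
  have h3 := Real.log_three_gt_d9
  have h3' := Real.log_three_lt_d9
  have h3p : 0 < Real.log 3 := by linarith
  constructor
  · rw [cantorDim, le_div_iff₀ h3p]; nlinarith
  · rw [cantorDim, div_le_iff₀ h3p]; nlinarith

lemma crossKernel_add_le {x y : ℝ} (hx : x ∈ Icc (0 : ℝ) 1) (hy : y ∈ Icc (0 : ℝ) 1) :
    crossKernel (x + y) ≤ 2 ^ (-cantorDim) * ∑ k ∈ Finset.range 7,
      binomialMajorantCoeff cantorDim k / 2 ^ k * ((1 / 2 - x) + (1 / 2 - y)) ^ k := by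
  obtain ⟨hs1, hs2⟩ := cantorDim_mem_Icc
  set s := cantorDim
  have hpoly : s * (s + 1) * (s + 2) * (s + 3) * (s + 4) * (s + 5) / 120 ≤ (6 - s) * (2 / 5) := by
    have : s * (s + 1) * (s + 2) * (s + 3) * (s + 4) * (s + 5) ≤
      0.63094 * (0.63094 + 1) * (0.63094 + 2) * (0.63094 + 3) * (0.63094 + 4) * (0.63094 + 5) := by
      have : 0 ≤ s := by linarith
      gcongr
    norm_num at this
    linarith
  have h := one_add_rpow_neg_le hpoly (by linarith) (t := ((1 / 2 - x) + (1 / 2 - y)) / 2)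
    (abs_le.2 ⟨by linarith [hx.2, hy.2], by linarith [hx.1, hy.1]⟩)
  rw [crossKernel, max_eq_right (by linarith [hx.2, hy.2]),
    show 3 - (x + y) = 2 * (1 + ((1 / 2 - x) + (1 / 2 - y)) / 2) by ring,
    Real.mul_rpow (by norm_num) (by linarith [hx.2, hy.2])]
  refine mul_le_mul_of_nonneg_left (h.trans_eq ?_) (by positivity)
  refine Finset.sum_congr rfl fun k _ ↦ ?_
  rw [div_pow]
  ring

/-- The moments of a measure about `1 / 2`. -/
def halfMoment (ν : Measure ℝ) (k : ℕ) : ℝ := ∫ x, (1 / 2 - x) ^ k ∂ν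

namespace IsSelfSimilar

variable {w : Bool → ℝ} {μ ν : Measure ℝ}

lemma integral_sub_add_pow (h : IsSelfSimilar w ν) (a : ℝ) (k : ℕ) :
    ∫ x, (a + (1 / 2 - x)) ^ k ∂ν =
      ∑ j ∈ Finset.range (k + 1), a ^ (k - j) * halfMoment ν j * k.choose j := by
  have h1 : ∀ x : ℝ, (a + (1 / 2 - x)) ^ k =
      ∑ j ∈ Finset.range (k + 1), a ^ (k - j) * (1 / 2 - x) ^ j * k.choose j := fun x ↦ by
    rw [add_comm, add_pow]
    exact Finset.sum_congr rfl fun j _ ↦ by ring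
  simp_rw [h1]
  rw [integral_finsetSum _ fun j _ ↦ h.integrable_of_continuous (by fun_prop)]
  simp_rw [integral_mul_const, integral_const_mul, halfMoment]

lemma halfMoment_eq (h : IsSelfSimilar w ν) (k : ℕ) :
    3 ^ k * halfMoment ν k = (w false + (-1) ^ k * w true) *
      ∑ j ∈ Finset.range (k + 1), halfMoment ν j * k.choose j := by
  have h1 := h.integral_sub_add_pow 1 k
  simp only [one_pow, one_mul] at h1
  have hm : Continuous fun x : ℝ ↦ (1 / 2 - x) ^ k := by fun_prop
  rw [← h1, halfMoment, h.integral_eq hm.measurable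
    fun e ↦ h.integrable_of_continuous (hm.comp (continuous_cantorMap e))]
  have hf : ∀ x : ℝ, (1 / 2 - cantorMap false x) ^ k = (1 / 3) ^ k * (1 + (1 / 2 - x)) ^ k :=
    fun x ↦ by rw [← mul_pow, cantorMap_false]; ring_nf
  have ht : ∀ x : ℝ, (1 / 2 - cantorMap true x) ^ k =
      (-1) ^ k * (1 / 3) ^ k * (1 + (1 / 2 - x)) ^ k :=
    fun x ↦ by rw [← mul_pow, ← mul_pow, cantorMap_true]; ring_nf
  simp_rw [hf, ht, integral_const_mul]
  have h3 : (3 : ℝ) ^ k * (1 / 3) ^ k = 1 := by rw [← mul_pow]; norm_num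
  linear_combination (w false + (-1) ^ k * w true) * (∫ x, (1 + (1 / 2 - x)) ^ k ∂ν) * h3

lemma halfMoment_zero (h : IsSelfSimilar w ν) : halfMoment ν 0 = 1 := by
  have := h.isProbabilityMeasure
  simp [halfMoment]

lemma integral_crossPotential_le (h : IsSelfSimilar (fun _ ↦ 1 / 2) μ) (hν : IsSelfSimilar w ν) :
    ∫ x, crossPotential μ x ∂ν ≤ 2 ^ (-cantorDim) * ∑ k ∈ Finset.range 7,
      binomialMajorantCoeff cantorDim k / 2 ^ k *
        ∑ j ∈ Finset.range (k + 1), halfMoment ν (k - j) * halfMoment μ j * k.choose j := by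
  have := h.isProbabilityMeasure
  have := hν.isProbabilityMeasure
  have h1 : ∀ᵐ x ∂ν, crossPotential μ x ≤ 2 ^ (-cantorDim) * ∑ k ∈ Finset.range 7,
      binomialMajorantCoeff cantorDim k / 2 ^ k *
        ∑ j ∈ Finset.range (k + 1), (1 / 2 - x) ^ (k - j) * halfMoment μ j * k.choose j := by
    filter_upwards [hν.ae_mem_Icc] with x hx
    refine (integral_mono_ae (h.integrable_of_continuous (continuous_crossKernel.comp
      (continuous_const_add x))) (h.integrable_of_continuous (by fun_prop))
      (h.ae_mem_Icc.mono fun y hy ↦ crossKernel_add_le hx hy)).trans_eq ?_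
    rw [integral_const_mul, integral_finsetSum _ fun j _ ↦
      h.integrable_of_continuous (by fun_prop)]
    simp_rw [integral_const_mul, h.integral_sub_add_pow]
  refine (integral_mono_ae (hν.integrable_of_continuous (continuous_crossPotential μ))
    (hν.integrable_of_continuous (by fun_prop)) h1).trans_eq ?_
  rw [integral_const_mul, integral_finsetSum _ fun j _ ↦
    hν.integrable_of_continuous (by fun_prop)]
  simp_rw [integral_const_mul]
  congr 1
  refine Finset.sum_congr rfl fun k _ ↦ ?_
  rw [integral_finsetSum _ fun j _ ↦ hν.integrable_of_continuous (by fun_prop)]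
  simp_rw [integral_mul_const]
  rfl

lemma integral_crossPotential_le_of_weights (h : IsSelfSimilar (fun _ ↦ 1 / 2) μ)
    (hν : IsSelfSimilar w ν) (hf : w false = 8 / 15) (ht : w true = 7 / 15) :
    ∫ x, crossPotential μ x ∂ν ≤ 2 ^ (-cantorDim) * 1.0299 := by
  refine (h.integral_crossPotential_le hν).trans (mul_le_mul_of_nonneg_left ?_ (by positivity))
  have m0 := h.halfMoment_zero
  have m1 := h.halfMoment_eq 1
  have m2 := h.halfMoment_eq 2
  have m3 := h.halfMoment_eq 3
  have m4 := h.halfMoment_eq 4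
  have m5 := h.halfMoment_eq 5
  have m6 := h.halfMoment_eq 6
  have n0 := hν.halfMoment_zero
  have n1 := hν.halfMoment_eq 1
  have n2 := hν.halfMoment_eq 2
  have n3 := hν.halfMoment_eq 3
  have n4 := hν.halfMoment_eq 4
  have n5 := hν.halfMoment_eq 5
  have n6 := hν.halfMoment_eq 6
  norm_num [Finset.sum_range_succ, Nat.choose, hf, ht] at m1 m2 m3 m4 m5 m6 n1 n2 n3 n4 n5 n6
  replace m2 : halfMoment μ 2 = 1 / 8 := by linarith
  replace m4 : halfMoment μ 4 = 7 / 320 := by linarith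
  replace m6 : halfMoment μ 6 = 205 / 46592 := by linarith
  replace n1 : halfMoment ν 1 = 1 / 44 := by linarith
  replace n2 : halfMoment ν 2 = 23 / 176 := by linarith
  replace n3 : halfMoment ν 3 = 257 / 71104 := by linarith
  replace n4 : halfMoment ν 4 = 33587 / 1422080 := by linarith
  replace n5 : halfMoment ν 5 = 732283 / 1036411904 := by linarith
  replace n6 : halfMoment ν 6 = 23739163 / 4899401728 := by linarith
  norm_num [Finset.sum_range_succ, Nat.choose, binomialMajorantCoeff, m0, m1, m2, m3, m4, m5, m6, n0, n1,
    n2, n3, n4, n5, n6]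
  obtain ⟨hs1, hs2⟩ := cantorDim_mem_Icc
  set s := cantorDim
  have hs0 : 0 ≤ s := by linarith
  have b2 : s * (s + 1) ≤ 0.63094 * (0.63094 + 1) := by gcongr
  have b3 : 0.63092 * (0.63092 + 1) * (0.63092 + 2) ≤ s * (s + 1) * (s + 2) := by gcongr
  have b4 : s * (s + 1) * (s + 2) * (s + 3) ≤
      0.63094 * (0.63094 + 1) * (0.63094 + 2) * (0.63094 + 3) := by gcongr
  have b5 : 0.63092 * (0.63092 + 1) * (0.63092 + 2) * (0.63092 + 3) * (0.63092 + 4) ≤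
      s * (s + 1) * (s + 2) * (s + 3) * (s + 4) := by gcongr
  norm_num at b2 b3 b4 b5
  linarith

end IsSelfSimilar

lemma lt_entropy_of_weights :
    0.6908 < (8 / 15 : ℝ) * -Real.log (8 / 15) + 7 / 15 * -Real.log (7 / 15) := by
  have h1 := Real.abs_log_sub_add_sum_range_le (x := -(1 / 15)) (by norm_num [abs_lt]) 3
  have h2 := Real.abs_log_sub_add_sum_range_le (x := 1 / 15) (by norm_num [abs_lt]) 3
  have e1 : Real.log (8 / 15) = Real.log (1 - -(1 / 15)) - Real.log 2 := by
    rw [← Real.log_div (by norm_num) (by norm_num)]; norm_num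
  have e2 : Real.log (7 / 15) = Real.log (1 - 1 / 15) - Real.log 2 := by
    rw [← Real.log_div (by norm_num) (by norm_num)]; norm_num
  have h3 := Real.log_two_gt_d9
  rw [e1, e2]
  norm_num [Finset.sum_range_succ, abs_le] at h1 h2 ⊢
  linarith

lemma rpow_cantorDim_mul_lt : (1.06126 : ℝ) ^ cantorDim * (2 ^ (-cantorDim) * 1.0299) < 0.6908 := by
  obtain ⟨hs1, hs2⟩ := cantorDim_mem_Icc
  have h1 : (1.06126 : ℝ) ^ cantorDim * 2 ^ (-cantorDim) ≤ 0.6705 := by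
    have l1 := Real.abs_log_sub_add_sum_range_le (x := -0.06126) (by norm_num [abs_lt]) 4
    have l2 := Real.one_sub_inv_le_log_of_pos (x := 1.00575) (by norm_num)
    have l3 : Real.log 0.6705 = Real.log 1.00575 + Real.log 2 - Real.log 3 := by
      rw [← Real.log_mul (by norm_num) (by norm_num), ← Real.log_div (by norm_num) (by norm_num)]
      norm_num
    have l4 := Real.log_two_gt_d9
    have l5 := Real.log_three_lt_d9
    norm_num [Finset.sum_range_succ, abs_le] at l1 l2
    rw [Real.rpow_neg (by norm_num), ← div_eq_mul_inv, ← Real.div_rpow (by norm_num) (by norm_num),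
      ← Real.log_le_log_iff (by positivity) (by norm_num), Real.log_rpow (by norm_num),
      Real.log_div (by norm_num) (by norm_num), l3]
    norm_num
    nlinarith
  linarith

/-- Explicit bounds for the critical constant of the Dvoretzky covering problem driven by the
natural measure on the middle-thirds Cantor set, with radii `r_n = c n^{-1/s}`,
`s = log 2 / log 3`. -/
theorem cantor_covering_constants
    (s : ℝ) (hs : s = Real.log 2 / Real.log 3)
    (μ : Measure ℝ) (hμ : μ = (μH[s] cantorSet)⁻¹ • (μH[s]).restrict cantorSet)
    (P : Measure (ℕ → ℝ))
    (hP : ∀ (I : Finset ℕ) (f : ℕ → Set ℝ), (∀ n, MeasurableSet (f n)) →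
      P {ω | ∀ n ∈ I, ω n ∈ f n} = ∏ n ∈ I, μ (f n))
    (c : ℝ) (hc : 0 < c)
    (r : ℕ → ℝ) (hr : ∀ n : ℕ, r n = c * ((n + 1 : ℕ) : ℝ) ^ (-(1 / s))) :
    (c < 1.06126 → P {ω | cantorSet ⊆ coverSet r ω} = 0) ∧
    (c > 1.37546 → P {ω | cantorSet ⊆ coverSet r ω} = 1) := by
  obtain rfl : s = cantorDim := hs
  obtain rfl : r = coverRadius c := funext hr
  have h : IsSelfSimilar (fun _ ↦ 1 / 2) μ := hμ ▸ isSelfSimilar_hausdorffMeasure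
  refine ⟨fun hc1 ↦ ?_, fun hc2 ↦
    h.prob_cover_eq_one hP (by norm_num) hc2 cantor_covering_rate_lt_one⟩
  obtain ⟨ν, hν⟩ := exists_isSelfSimilar (w := fun e ↦ if e then 7 / 15 else 8 / 15)
    (fun e ↦ by cases e <;> norm_num) (by norm_num)
  refine h.prob_cover_eq_zero hP hc (fun e ↦ by cases e <;> norm_num) hν
    (Real.rpow_lt_rpow hc.le hc1 cantorDim_pos) ?_
  calc (1.06126 : ℝ) ^ cantorDim * ∫ x, crossPotential μ x ∂ν
      ≤ 1.06126 ^ cantorDim * (2 ^ (-cantorDim) * 1.0299) := by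
        gcongr
        exact h.integral_crossPotential_le_of_weights hν rfl rfl
    _ < 0.6908 := rpow_cantorDim_mul_lt
    _ < _ := lt_entropy_of_weights

end
end

section
/- Let μ be a Borel probability measure on ℝ with support X and let r = (r_n)_{n≥1} be a sequence of positive real numbers. Suppose that for every Borel probability measure ν on ℝ with support contained in X there exists a Borel set X_ν ⊆ X with ν(X_ν) = 1 such that ℙ_μ({ω : X_ν ⊆ E_r(ω)}) = 1. Then ℙ_μ({ω : X ⊆ E_r(ω)}) = 1. -/
open MeasureTheory Metric Filter Set
open scoped ENNReal Topology

noncomputable section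

/-- The topological support of a measure. -/
def msupport (μ : Measure ℝ) : Set ℝ :=
  {x | ∀ U : Set ℝ, IsOpen U → x ∈ U → 0 < μ U}

/-- The union of the balls of index at least `k`. -/
def tailCover (r : ℕ → ℝ) (k : ℕ) (ω : ℕ → ℝ) : Set ℝ :=
  ⋃ n, ⋃ (_ : k ≤ n), ball (ω n) (r n)

lemma isOpen_tailCover (r : ℕ → ℝ) (k : ℕ) (ω : ℕ → ℝ) : IsOpen (tailCover r k ω) :=
  isOpen_iUnion fun _ => isOpen_iUnion fun _ => isOpen_ball

lemma isClosed_msupport (μ : Measure ℝ) : IsClosed (msupport μ) := by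
  rw [← isOpen_compl_iff, isOpen_iff_forall_mem_open]
  intro x hx
  simp only [msupport, mem_compl_iff, mem_ofPred_eq, not_forall] at hx
  obtain ⟨U, hU, hxU, hμ⟩ := hx
  exact ⟨U, fun y hy hyX => hμ (hyX U hU hy), hU, hxU⟩

lemma msupport_subset_of_measure_compl_eq_zero {ν : Measure ℝ} {X : Set ℝ} (hX : IsClosed X)
    (hν : ν Xᶜ = 0) : msupport ν ⊆ X := by
  intro x hx
  by_contra hxX
  exact (hx Xᶜ hX.isOpen_compl hxX).ne' hν

lemma isOpen_setOf_subset_tailCover (r : ℕ → ℝ) (k : ℕ) {K : Set ℝ} (hK : IsCompact K) :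
    IsOpen {ω : ℕ → ℝ | K ⊆ tailCover r k ω} := by
  have hopen : IsOpen {p : (ℕ → ℝ) × ℝ | p.2 ∈ tailCover r k p.1} := by
    have : {p : (ℕ → ℝ) × ℝ | p.2 ∈ tailCover r k p.1} =
        ⋃ n, ⋃ (_ : k ≤ n), {p : (ℕ → ℝ) × ℝ | dist p.2 (p.1 n) < r n} := by
      ext p
      simp [tailCover]
    rw [this]
    exact isOpen_iUnion fun n => isOpen_iUnion fun _ =>
      isOpen_lt (by fun_prop) continuous_const
  rw [isOpen_iff_mem_nhds]
  intro ω hω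
  exact hK.eventually_forall_of_forall_eventually
    (P := fun ω x => x ∈ tailCover r k ω) fun x hx => hopen.mem_nhds (hω hx)

/-- Measurable selection of an uncovered point of a compact set. -/
lemma exists_measurable_mem_diff_tailCover (r : ℕ → ℝ) (k : ℕ) {K : Set ℝ} (hK : IsCompact K) :
    ∃ x : (ℕ → ℝ) → ℝ, Measurable x ∧
      ∀ ω, ¬ K ⊆ tailCover r k ω → x ω ∈ K \ tailCover r k ω := by
  have hmem : ∀ ω, ¬ K ⊆ tailCover r k ω →
      sInf (K \ tailCover r k ω) ∈ K \ tailCover r k ω := fun ω hω =>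
    (hK.diff (isOpen_tailCover r k ω)).sInf_mem (sdiff_nonempty.2 hω)
  refine ⟨fun ω => sInf (K \ tailCover r k ω), measurable_of_Iic fun t => ?_, hmem⟩
  have heq : (fun ω => sInf (K \ tailCover r k ω)) ⁻¹' Iic t =
      {ω | K ∩ Iic t ⊆ tailCover r k ω}ᶜ ∪
        ({ω | K ⊆ tailCover r k ω} ∩ {_ω | (0 : ℝ) ≤ t}) := by
    ext ω
    simp only [mem_preimage, mem_Iic, mem_union, mem_compl_iff, mem_inter_iff, mem_ofPred_eq]
    by_cases hω : K ⊆ tailCover r k ω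
    · simp [sdiff_eq_empty.2 hω, hω, inter_subset_left.trans hω]
    · simp only [hω, false_and, or_false]
      constructor
      · exact fun hle hsub => (hmem ω hω).2 (hsub ⟨(hmem ω hω).1, hle⟩)
      · intro hns
        obtain ⟨y, hy, hyU⟩ := not_subset.1 hns
        exact (csInf_le (hK.bddBelow.mono sdiff_subset) ⟨hy.1, hyU⟩).trans hy.2
  rw [heq]
  exact (isOpen_setOf_subset_tailCover r k (hK.inter_right isClosed_Iic)).measurableSet.compl.union
    ((isOpen_setOf_subset_tailCover r k hK).measurableSet.inter (MeasurableSet.const _))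

/-- If for every Borel probability measure `ν` supported in `X = supp μ` there is a Borel set
`X_ν ⊆ X` of full `ν`-measure which is a.s. covered by `E_r`, then `X` itself is a.s. covered. -/
theorem covered_of_ae_covered_for_all_measures
    (μ : Measure ℝ) [IsProbabilityMeasure μ]
    (P : Measure (ℕ → ℝ))
    (hP : ∀ (s : Finset ℕ) (f : ℕ → Set ℝ), (∀ n, MeasurableSet (f n)) →
      P {ω | ∀ n ∈ s, ω n ∈ f n} = ∏ n ∈ s, μ (f n))
    (r : ℕ → ℝ) (hpos : ∀ n, 0 < r n)
    (h : ∀ ν : Measure ℝ, IsProbabilityMeasure ν → msupport ν ⊆ msupport μ →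
      ∃ B : Set ℝ, MeasurableSet B ∧ B ⊆ msupport μ ∧ ν B = 1 ∧
        P {ω | B ⊆ coverSet r ω} = 1) :
    P {ω | msupport μ ⊆ coverSet r ω} = 1 := by
  have : IsProbabilityMeasure P := ⟨by simpa using hP ∅ (fun _ => univ) fun _ => .univ⟩
  have hX := isClosed_msupport μ
  set X := msupport μ
  have hK (m : ℕ) : IsCompact (X ∩ Icc (-(m : ℝ)) m) := isCompact_Icc.inter_left hX
  have key (k m : ℕ) : P {ω | ¬ X ∩ Icc (-(m : ℝ)) m ⊆ tailCover r k ω} = 0 := by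
    obtain ⟨x, hxm, hx⟩ := exists_measurable_mem_diff_tailCover r k (hK m)
    set A := {ω | ¬ X ∩ Icc (-(m : ℝ)) m ⊆ tailCover r k ω}
    have hA : MeasurableSet A := (isOpen_setOf_subset_tailCover r k (hK m)).measurableSet.compl
    by_contra hPA
    have : IsProbabilityMeasure (ProbabilityTheory.cond P A) :=
      ProbabilityTheory.cond_isProbabilityMeasure hPA
    have hν : IsProbabilityMeasure ((ProbabilityTheory.cond P A).map x) :=
      Measure.isProbabilityMeasure_map hxm.aemeasurable
    have hνX : (ProbabilityTheory.cond P A).map x Xᶜ = 0 := by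
      rw [Measure.map_apply hxm hX.measurableSet.compl, ProbabilityTheory.cond_apply hA]
      have : A ∩ x ⁻¹' Xᶜ = ∅ :=
        eq_empty_of_forall_notMem fun ω hω => hω.2 (hx ω hω.1).1.1
      rw [this, measure_empty, mul_zero]
    obtain ⟨B, hB, -, hνB, hPB⟩ := h _ hν (msupport_subset_of_measure_compl_eq_zero hX hνX)
    rw [Measure.map_apply hxm hB, ProbabilityTheory.cond_apply hA] at hνB
    set T := A ∩ x ⁻¹' B
    have hT : MeasurableSet T := hA.inter (hxm hB)
    have hPT : P T ≠ 0 := fun h0 => by simp [h0] at hνB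
    have hsub : {ω | B ⊆ coverSet r ω} ⊆ Tᶜ := fun ω hω hωT =>
      (hx ω hωT.1).2 (mem_iInter.1 (hω hωT.2) k)
    refine hPT ((prob_compl_eq_one_iff hT).1 (le_antisymm prob_le_one ?_))
    exact hPB ▸ measure_mono hsub
  have hae : ∀ᵐ ω ∂P, ∀ k m : ℕ, X ∩ Icc (-(m : ℝ)) m ⊆ tailCover r k ω :=
    ae_all_iff.2 fun k => ae_all_iff.2 fun m => key k m
  have hcov : ∀ᵐ ω ∂P, X ⊆ coverSet r ω := by
    filter_upwards [hae] with ω hω y hy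
    obtain ⟨m, hm⟩ := exists_nat_ge |y|
    exact mem_iInter.2 fun k => hω k m ⟨hy, abs_le.1 hm⟩
  rw [measure_congr (eventuallyEq_univ.2 hcov), measure_univ]

end
end

section
/- Let μ be a Borel probability measure on ℝ with support X, let r = (r_n)_{n≥1} be a sequence of positive real numbers, and let A ⊆ X be an analytic set such that ℙ_μ({ω : C ⊆ E_r(ω)}) = 1 for every compact set C ⊆ A. Then ℙ_μ({ω : A ⊆ E_r(ω)}) = 1. -/
open MeasureTheory Metric Filter Set
open scoped ENNReal Topology

noncomputable section

/-- A neighbourhood of the box `{y | ∀ i, y i ≤ b i}` in Baire space contains the cylinder given by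
finitely many of the constraints. -/
theorem exists_cylinder_subset_of_box_subset {b : ℕ → ℕ} {V : Set (ℕ → ℕ)} (hV : IsOpen V)
    (hb : {y : ℕ → ℕ | ∀ i, y i ≤ b i} ⊆ V) :
    ∃ m, {y : ℕ → ℕ | ∀ i < m, y i ≤ b i} ⊆ V := by
  by_contra! hcon
  simp only [Set.not_subset] at hcon
  choose y hy hyV using hcon
  have hcomp : IsCompact (Set.univ.pi fun i => Set.Iic (b i)) :=
    isCompact_univ_pi fun i => (Set.finite_Iic (b i)).isCompact
  obtain ⟨z, hz, φ, hφ, hlim⟩ := hcomp.tendsto_subseq (x := fun m i => min (y m i) (b i))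
    (fun m i _ => mem_Iic.2 (min_le_right _ _))
  have hylim : Tendsto (y ∘ φ) atTop (𝓝 z) := by
    rw [tendsto_pi_nhds] at hlim ⊢
    intro i
    refine (hlim i).congr' ?_
    filter_upwards [eventually_gt_atTop i] with m hm
    exact min_eq_left (hy (φ m) i (hm.trans_le hφ.le_apply))
  obtain ⟨m, hm⟩ := (hylim.eventually (hV.mem_nhds (hb fun i => hz i (mem_univ i)))).exists
  exact hyV _ hm

/-- A monotone-continuity argument: a set function on Baire space which is continuous along
increasing sequences and exceeds `c` on the whole space exceeds `c` on all the cylinders of some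
box. -/
theorem exists_bound_forall_cylinder_lt {g : Set (ℕ → ℕ) → ℝ≥0∞} {c : ℝ≥0∞}
    (hg : ∀ S : ℕ → Set (ℕ → ℕ), Monotone S → g (⋃ n, S n) = ⨆ n, g (S n))
    (hc : c < g univ) :
    ∃ b : ℕ → ℕ, ∀ m, c < g {y | ∀ i < m, y i ≤ b i} := by
  have hstep : ∀ (T : {S // c < g S}) (m : ℕ), ∃ n, c < g (T.1 ∩ {y | y m ≤ n}) := by
    rintro ⟨S, hS⟩ m
    have hmono : Monotone fun n => S ∩ {y : ℕ → ℕ | y m ≤ n} :=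
      fun n n' hn y hy => ⟨hy.1, hy.2.trans hn⟩
    have hU : ⋃ n, S ∩ {y : ℕ → ℕ | y m ≤ n} = S := by
      ext y
      simp only [mem_iUnion, mem_inter_iff, mem_ofPred_eq]
      exact ⟨fun ⟨_, hy, _⟩ => hy, fun hy => ⟨y m, hy, le_rfl⟩⟩
    have := hg _ hmono
    rw [hU] at this
    exact lt_iSup_iff.1 (this ▸ hS)
  choose N hN using hstep
  let T : ℕ → {S // c < g S} := fun m =>
    Nat.rec ⟨univ, hc⟩ (fun m t => ⟨t.1 ∩ {y | y m ≤ N t m}, hN t m⟩) m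
  refine ⟨fun m => N (T m) m, fun m => ?_⟩
  have hT : ∀ m, (T m).1 = {y | ∀ i < m, y i ≤ N (T i) i} := by
    intro m
    induction m with
    | zero => simp [T]
    | succ m ih =>
      have hsucc : (T (m + 1)).1 = (T m).1 ∩ {y | y m ≤ N (T m) m} := rfl
      rw [hsucc, ih]
      ext y
      simp only [mem_inter_iff, mem_ofPred_eq, Nat.lt_succ_iff_lt_or_eq]
      exact ⟨fun hy i hi => hi.elim (hy.1 i) fun hi => hi ▸ hy.2,
        fun hy => ⟨fun i hi => hy i (Or.inl hi), hy m (Or.inr rfl)⟩⟩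
  exact hT m ▸ (T m).2

/-- The set of parameters whose section of an open set contains a given closed set is Borel. -/
theorem measurableSet_setOf_subset_section {Ω : Type*} [TopologicalSpace Ω] [MeasurableSpace Ω]
    [OpensMeasurableSpace Ω] {E : Type*} [PseudoMetricSpace E] [ProperSpace E]
    {W : Set (Ω × E)} (hW : IsOpen W) {D : Set E} (hD : IsClosed D) :
    MeasurableSet {ω | D ⊆ {x | (ω, x) ∈ W}} := by
  have hcompact : ∀ K : Set E, IsCompact K → IsOpen {ω | K ⊆ {x | (ω, x) ∈ W}} := by
    intro K hK
    rw [isOpen_iff_mem_nhds]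
    intro ω hω
    refine hK.eventually_forall_of_forall_eventually fun x hx => ?_
    exact hW.mem_nhds (hω hx)
  rcases isEmpty_or_nonempty E with hE | ⟨⟨x₀⟩⟩
  · have : {ω | D ⊆ {x | (ω, x) ∈ W}} = univ :=
      eq_univ_of_forall fun ω x _ => (hE.false x).elim
    rw [this]
    exact MeasurableSet.univ
  have heq : {ω | D ⊆ {x | (ω, x) ∈ W}} =
      ⋂ n : ℕ, {ω | closedBall x₀ n ∩ D ⊆ {x | (ω, x) ∈ W}} := by
    ext ω
    simp only [mem_ofPred_eq, mem_iInter, ← iUnion_subset_iff, ← iUnion_inter,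
      iUnion_closedBall_nat, univ_inter]
  rw [heq]
  exact MeasurableSet.iInter fun n =>
    (hcompact _ ((isCompact_closedBall x₀ n).inter_right hD)).measurableSet

/-- If an analytic set fails to be contained in a random open set with positive outer probability,
then so does one of its compact subsets. -/
theorem MeasureTheory.AnalyticSet.exists_isCompact_measure_not_subset_pos {Ω : Type*}
    [TopologicalSpace Ω] [MeasurableSpace Ω] [OpensMeasurableSpace Ω] {P : Measure Ω}
    [IsFiniteMeasure P] {E : Type*} [PseudoMetricSpace E] [ProperSpace E]
    {W : Set (Ω × E)} (hW : IsOpen W) {A : Set E} (hA : AnalyticSet A)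
    (hpos : 0 < P {ω | ¬ A ⊆ {x | (ω, x) ∈ W}}) :
    ∃ C ⊆ A, IsCompact C ∧ 0 < P {ω | ¬ C ⊆ {x | (ω, x) ∈ W}} := by
  rw [AnalyticSet] at hA
  rcases hA with rfl | ⟨f, hf, rfl⟩
  · simp at hpos
  obtain ⟨c, hc0, hc⟩ := exists_between hpos
  obtain ⟨b, hb⟩ := exists_bound_forall_cylinder_lt
    (g := fun S => P {ω | ¬ f '' S ⊆ {x | (ω, x) ∈ W}}) (c := c)
    (fun S hS => by
      have hmono : Monotone fun n => {ω | ¬ f '' S n ⊆ {x | (ω, x) ∈ W}} :=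
        fun n n' hn ω hω hsub => hω ((image_mono (hS hn)).trans hsub)
      rw [← hmono.measure_iUnion]
      congr 1
      ext ω
      simp [image_iUnion, iUnion_subset_iff])
    (by simpa only [image_univ] using hc)
  have hL : IsCompact {y : ℕ → ℕ | ∀ i, y i ≤ b i} := by
    convert isCompact_univ_pi fun i => (Set.finite_Iic (b i)).isCompact using 1
    ext y
    simp [Pi.le_def]
  refine ⟨f '' {y | ∀ i, y i ≤ b i}, image_subset_range _ _, hL.image hf, hc0.trans_le ?_⟩
  let D : ℕ → Set E := fun m => closure (f '' {y | ∀ i < m, y i ≤ b i})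
  have hDanti : Antitone fun m => {ω | ¬ D m ⊆ {x | (ω, x) ∈ W}} :=
    fun m m' hm ω hω hsub => hω <| by
      refine (closure_mono (image_mono ?_)).trans hsub
      exact ofPred_subset_ofPred.2 fun y hy i hi => hy i (hi.trans_le hm)
  have hmeas : ∀ m, MeasurableSet {ω | ¬ D m ⊆ {x | (ω, x) ∈ W}} :=
    fun m => (measurableSet_setOf_subset_section hW isClosed_closure).compl
  calc c ≤ ⨅ m, P {ω | ¬ D m ⊆ {x | (ω, x) ∈ W}} :=
        le_iInf fun m => (hb m).le.trans
          (measure_mono fun ω hω hsub => hω (subset_closure.trans hsub))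
    _ = P (⋂ m, {ω | ¬ D m ⊆ {x | (ω, x) ∈ W}}) :=
        (hDanti.measure_iInter (fun m => (hmeas m).nullMeasurableSet)
          ⟨0, measure_ne_top _ _⟩).symm
    _ ≤ P {ω | ¬ f '' {y | ∀ i, y i ≤ b i} ⊆ {x | (ω, x) ∈ W}} := measure_mono fun ω hω (hsub : f '' _ ⊆ _) => by
        have hU : IsOpen {x | (ω, x) ∈ W} := hW.preimage (by fun_prop)
        obtain ⟨δ, hδ, hδU⟩ := (hL.image hf).exists_cthickening_subset_open hU hsub
        obtain ⟨m, hm⟩ := exists_cylinder_subset_of_box_subset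
          (isOpen_thickening.preimage hf)
          (image_subset_iff.1 (self_subset_thickening hδ (f '' {y | ∀ i, y i ≤ b i})))
        refine mem_iInter.1 hω m ((closure_mono (image_subset_iff.2 hm)).trans ?_)
        exact (closure_thickening_subset_cthickening _ _).trans hδU

/-- If every compact subset of an analytic set `A ⊆ supp μ` is a.s. covered by `E_r`,
then `A` itself is a.s. covered. -/
theorem analytic_covered_of_compact_covered
    (μ : Measure ℝ) [IsProbabilityMeasure μ]
    (P : Measure (ℕ → ℝ))
    (hP : ∀ (s : Finset ℕ) (f : ℕ → Set ℝ), (∀ n, MeasurableSet (f n)) →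
      P {ω | ∀ n ∈ s, ω n ∈ f n} = ∏ n ∈ s, μ (f n))
    (r : ℕ → ℝ) (hpos : ∀ n, 0 < r n)
    (A : Set ℝ) (hA : MeasureTheory.AnalyticSet A) (hAX : A ⊆ msupport μ)
    (h : ∀ C : Set ℝ, IsCompact C → C ⊆ A → P {ω | C ⊆ coverSet r ω} = 1) :
    P {ω | A ⊆ coverSet r ω} = 1 := by
  have : IsProbabilityMeasure P := ⟨by simpa using hP ∅ (fun _ => univ) fun _ => MeasurableSet.univ⟩
  have hopen : ∀ k, IsOpen {p : (ℕ → ℝ) × ℝ | p.2 ∈ ⋃ n, ⋃ (_ : k ≤ n), ball (p.1 n) (r n)} := by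
    intro k
    simp only [mem_iUnion, mem_ball, ofPred_exists]
    exact isOpen_iUnion fun n => isOpen_iUnion fun _ => isOpen_lt (by fun_prop) continuous_const
  suffices hae : ∀ᵐ ω ∂P, A ⊆ coverSet r ω by
    rw [← measure_univ (μ := P)]
    exact measure_congr (eventuallyEq_univ.2 hae)
  simp only [coverSet, subset_iInter_iff, ae_all_iff]
  intro k
  rw [ae_iff]
  by_contra hne
  obtain ⟨C, hCA, hC, hCpos⟩ :=
    hA.exists_isCompact_measure_not_subset_pos (hopen k) (pos_iff_ne_zero.2 hne)
  refine hCpos.ne' ?_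
  have hmeas := measurableSet_setOf_subset_section (hopen k) hC.isClosed
  refine (prob_compl_eq_zero_iff hmeas).2 (le_antisymm prob_le_one ?_)
  rw [← h C hC hCA]
  exact measure_mono fun ω hω => hω.trans (iInter_subset _ k)

end
end

section
/- Let μ be a Borel probability measure on ℝ with support X and let r = (r_n)_{n≥1} be a non-increasing sequence of positive real numbers tending to zero with sup_{x∈X} μ(B(x,r_1)) < 1. Suppose A ⊆ X is an analytic set such that J(ν) = ∞ for every Borel probability measure ν whose support is a compact subset of A, and let C ⊆ A ∩ X_0 be a compact set. Then for every Borel probability measure ν supported in C and every M > 0, lim_{k→∞} ν({x ∈ C : ∫ p_k(x,y) dν(y) ≥ M}) = 1. -/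
open MeasureTheory Metric Filter Set
open scoped ENNReal Topology

noncomputable section

/-- `p_k(x,y) = ∏_{n=1}^k [1-μ(B(x,r_n))-μ(B(y,r_n))+μ(B(x,r_n)∩B(y,r_n))] /
[(1-μ(B(x,r_n)))(1-μ(B(y,r_n)))]`. -/
def pk (μ : Measure ℝ) (r : ℕ → ℝ) (k : ℕ) (x y : ℝ) : ℝ :=
  ∏ n ∈ Finset.range k,
    (1 - (μ (ball x (r n))).toReal - (μ (ball y (r n))).toReal +
        (μ (ball x (r n) ∩ ball y (r n))).toReal) /
      ((1 - (μ (ball x (r n))).toReal) * (1 - (μ (ball y (r n))).toReal))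

/-- `J_k(ν) = ∬ p_k(x,y) dν(y) dν(x)`. -/
def Jk (μ : Measure ℝ) (r : ℕ → ℝ) (ν : Measure ℝ) (k : ℕ) : ℝ :=
  ∫ x, (∫ y, pk μ r k x y ∂ν) ∂ν

/-- `X₀`, the points of the support all of whose ball boundaries are `μ`-null. -/
def X₀ (μ : Measure ℝ) (r : ℕ → ℝ) : Set ℝ :=
  {x ∈ msupport μ | ∀ k : ℕ, μ (frontier (ball x (r k))) = 0}

section ProductKernel

variable {α β : Type*} [MeasurableSpace β]

/-- The Gram kernel of the feature map `x ↦ h x` into `L²(μ)`. -/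
def gramKernel (μ : Measure β) (h : α × β → ℝ) (z : α × α) : ℝ :=
  ∫ ω, h (z.1, ω) * h (z.2, ω) ∂μ

/-- The kernels `∏_{n<k} (1 + Q_n)` for Gram kernels `Q_n`. -/
def productKernel (μ : Measure β) (h : ℕ → α × β → ℝ) (k : ℕ) (z : α × α) : ℝ :=
  ∏ n ∈ Finset.range k, (1 + gramKernel μ (h n) z)

variable {μ : Measure β} {h : ℕ → α × β → ℝ}

lemma productKernel_zero : productKernel μ h 0 = fun _ => 1 := by
  ext z; simp [productKernel]

lemma productKernel_succ (k : ℕ) (z : α × α) : productKernel μ h (k + 1) z =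
    productKernel μ h k z + productKernel μ h k z * gramKernel μ (h k) z := by
  rw [productKernel, Finset.prod_range_succ, ← productKernel]; ring

lemma productKernel_swap (k : ℕ) (z : α × α) :
    productKernel μ h k z.swap = productKernel μ h k z := by
  simp [productKernel, gramKernel, mul_comm]

end ProductKernel

section BoundedMeasurable

variable {α β : Type*} [MeasurableSpace α] [MeasurableSpace β]

/-- Bounded measurable real functions. -/
structure IsBddMeas (f : α → ℝ) : Prop where
  measurable : Measurable f
  bdd : ∃ b, ∀ x, |f x| ≤ b

namespace IsBddMeas

variable {f g : α → ℝ}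

lemma const (c : ℝ) : IsBddMeas (fun _ : α => c) := ⟨measurable_const, |c|, fun _ => le_rfl⟩

lemma add (hf : IsBddMeas f) (hg : IsBddMeas g) : IsBddMeas (fun x => f x + g x) := by
  obtain ⟨a, ha⟩ := hf.bdd
  obtain ⟨b, hb⟩ := hg.bdd
  exact ⟨hf.measurable.add hg.measurable, a + b,
    fun x => (abs_add_le _ _).trans (add_le_add (ha x) (hb x))⟩

lemma mul (hf : IsBddMeas f) (hg : IsBddMeas g) : IsBddMeas (fun x => f x * g x) := by
  obtain ⟨a, ha⟩ := hf.bdd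
  obtain ⟨b, hb⟩ := hg.bdd
  refine ⟨hf.measurable.mul hg.measurable, a * b, fun x => ?_⟩
  rw [abs_mul]
  exact mul_le_mul (ha x) (hb x) (abs_nonneg _) ((abs_nonneg _).trans (ha x))

lemma sub (hf : IsBddMeas f) (hg : IsBddMeas g) : IsBddMeas (fun x => f x - g x) := by
  simpa [sub_eq_add_neg] using hf.add ((const (-1)).mul hg)

lemma comp (hf : IsBddMeas f) {φ : β → α} (hφ : Measurable φ) :
    IsBddMeas (fun x => f (φ x)) :=
  ⟨hf.measurable.comp hφ, hf.bdd.imp fun _ h x => h (φ x)⟩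

lemma indicator_one {s : Set α} (hs : MeasurableSet s) :
    IsBddMeas (s.indicator (fun _ => (1 : ℝ))) :=
  ⟨measurable_const.indicator hs, 1, fun x => by by_cases h : x ∈ s <;> simp [h]⟩

lemma memLp (hf : IsBddMeas f) (p : ℝ≥0∞) (ν : Measure α) [IsFiniteMeasure ν] :
    MemLp f p ν := by
  obtain ⟨b, hb⟩ := hf.bdd
  exact MemLp.of_bound hf.measurable.aestronglyMeasurable b
    (Eventually.of_forall fun x => by simpa using hb x)

lemma integrable (hf : IsBddMeas f) (ν : Measure α) [IsFiniteMeasure ν] : Integrable f ν :=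
  memLp_one_iff_integrable.1 (hf.memLp 1 ν)

lemma integral_right {F : α × β → ℝ} (hF : IsBddMeas F) (ν : Measure β)
    [IsProbabilityMeasure ν] : IsBddMeas (fun x => ∫ y, F (x, y) ∂ν) := by
  obtain ⟨b, hb⟩ := hF.bdd
  refine ⟨(hF.measurable.stronglyMeasurable.integral_prod_right').measurable, b, fun x => ?_⟩
  simpa using norm_integral_le_of_norm_le_const (μ := ν) (f := fun y => F (x, y))
    (Eventually.of_forall fun y => by simpa using hb (x, y))

end IsBddMeas

/-- Positive semidefiniteness of a kernel on `L²(ν)`, tested on bounded measurable functions. -/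
def IsPosSemidefKernel (ν : Measure α) (K : α × α → ℝ) : Prop :=
  ∀ f : α → ℝ, IsBddMeas f → 0 ≤ ∫ z, K z * (f z.1 * f z.2) ∂(ν.prod ν)

lemma IsPosSemidefKernel.one (ν : Measure α) [IsProbabilityMeasure ν] :
    IsPosSemidefKernel ν (fun _ => 1) := by
  intro f _
  simp only [one_mul]
  rw [integral_prod_mul f f]
  exact mul_self_nonneg _

lemma IsBddMeas.gram_integrand {h : α × β → ℝ} (hh : IsBddMeas h) :
    IsBddMeas (fun w : (α × α) × β => h (w.1.1, w.2) * h (w.1.2, w.2)) :=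
  (hh.comp (φ := fun w : (α × α) × β => (w.1.1, w.2)) (by fun_prop)).mul
    (hh.comp (φ := fun w : (α × α) × β => (w.1.2, w.2)) (by fun_prop))

lemma IsBddMeas.gramKernel {h : α × β → ℝ} (hh : IsBddMeas h) (μ : Measure β)
    [IsProbabilityMeasure μ] : IsBddMeas (gramKernel μ h) :=
  hh.gram_integrand.integral_right μ

lemma IsBddMeas.quadratic_integrand {K : α × α → ℝ} (hK : IsBddMeas K) {f g : α → ℝ}
    (hf : IsBddMeas f) (hg : IsBddMeas g) :
    IsBddMeas (fun z : α × α => K z * (f z.1 * g z.2)) :=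
  hK.mul ((hf.comp measurable_fst).mul (hg.comp measurable_snd))

/-- Schur product of a positive semidefinite kernel with a Gram kernel. -/
lemma IsPosSemidefKernel.mul_gramKernel {ν : Measure α} [IsProbabilityMeasure ν]
    {μ : Measure β} [IsProbabilityMeasure μ] {K : α × α → ℝ} (hK : IsBddMeas K)
    (hpos : IsPosSemidefKernel ν K) {h : α × β → ℝ} (hh : IsBddMeas h) :
    IsPosSemidefKernel ν (fun z => K z * gramKernel μ h z) := by
  intro f hf
  have hint : IsBddMeas (fun w : (α × α) × β =>
      K w.1 * (f w.1.1 * f w.1.2) * (h (w.1.1, w.2) * h (w.1.2, w.2))) :=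
    ((hK.quadratic_integrand hf hf).comp measurable_fst).mul hh.gram_integrand
  have hswap : ∫ z, K z * gramKernel μ h z * (f z.1 * f z.2) ∂(ν.prod ν) =
      ∫ ω, ∫ z, K z * ((f z.1 * h (z.1, ω)) * (f z.2 * h (z.2, ω))) ∂(ν.prod ν) ∂μ := by
    have := integral_integral_swap (μ := ν.prod ν) (ν := μ)
      (f := fun z ω => K z * (f z.1 * f z.2) * (h (z.1, ω) * h (z.2, ω)))
      (hint.integrable _)
    simp only [integral_const_mul] at this
    simp only [gramKernel]
    calc _ = _ := integral_congr_ae (Eventually.of_forall fun z => mul_right_comm _ _ _)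
      _ = _ := this
      _ = _ := by simp only [mul_assoc, mul_left_comm]
  rw [hswap]
  exact integral_nonneg fun ω => hpos _ (hf.mul (hh.comp (φ := fun x => (x, ω)) (by fun_prop)))

variable {μ : Measure β} [IsProbabilityMeasure μ] {h : ℕ → α × β → ℝ}

lemma isBddMeas_productKernel (hh : ∀ n, IsBddMeas (h n)) (k : ℕ) :
    IsBddMeas (productKernel μ h k) := by
  induction k with
  | zero => rw [productKernel_zero]; exact IsBddMeas.const 1
  | succ k ih =>
    rw [funext (productKernel_succ (μ := μ) (h := h) k)]
    exact ih.add (ih.mul ((hh k).gramKernel μ))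

variable {ν : Measure α} [IsProbabilityMeasure ν]

lemma integral_productKernel_succ (hh : ∀ n, IsBddMeas (h n)) (k : ℕ) {f : α → ℝ}
    (hf : IsBddMeas f) :
    ∫ z, productKernel μ h (k + 1) z * (f z.1 * f z.2) ∂(ν.prod ν) =
      ∫ z, productKernel μ h k z * (f z.1 * f z.2) ∂(ν.prod ν) +
      ∫ z, productKernel μ h k z * gramKernel μ (h k) z * (f z.1 * f z.2) ∂(ν.prod ν) := by
  have hk := isBddMeas_productKernel (μ := μ) hh k
  rw [← integral_add ((hk.quadratic_integrand hf hf).integrable _)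
    (((hk.mul ((hh k).gramKernel μ)).quadratic_integrand hf hf).integrable _)]
  simp only [productKernel_succ, add_mul]

lemma isPosSemidefKernel_productKernel (hh : ∀ n, IsBddMeas (h n)) (k : ℕ) :
    IsPosSemidefKernel ν (productKernel μ h k) := by
  induction k with
  | zero => rw [productKernel_zero]; exact IsPosSemidefKernel.one ν
  | succ k ih =>
    intro f hf
    rw [integral_productKernel_succ hh k hf]
    exact add_nonneg (ih f hf)
      (ih.mul_gramKernel (isBddMeas_productKernel hh k) (hh k) f hf)

/-- The energies of a fixed density increase along the product kernels. -/
lemma monotone_energy_productKernel (hh : ∀ n, IsBddMeas (h n)) {f : α → ℝ}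
    (hf : IsBddMeas f) :
    Monotone fun k => ∫ z, productKernel μ h k z * (f z.1 * f z.2) ∂(ν.prod ν) := by
  refine monotone_nat_of_le_succ fun k => ?_
  rw [integral_productKernel_succ hh k hf]
  exact le_add_of_nonneg_right ((isPosSemidefKernel_productKernel hh k).mul_gramKernel
      (isBddMeas_productKernel hh k) (hh k) f hf)

/-- Densities with values in `[0, 1]` are weakly compact, tested on bounded functions. -/
lemma exists_weak_limit_density {f : ℕ → α → ℝ} (hf : ∀ k, Measurable (f k))
    (h0 : ∀ k x, 0 ≤ f k x) (h1 : ∀ k x, f k x ≤ 1) (U : Ultrafilter ℕ) :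
    ∃ φ : α → ℝ, Measurable φ ∧ (∀ x, 0 ≤ φ x) ∧ (∀ x, φ x ≤ 1) ∧
      ∀ u : α → ℝ, IsBddMeas u →
        Tendsto (fun k => ∫ x, f k x * u x ∂ν) U (𝓝 (∫ x, φ x * u x ∂ν)) := by
  have hfb : ∀ k, IsBddMeas (f k) := fun k =>
    ⟨hf k, 1, fun x => by rw [abs_of_nonneg (h0 k x)]; exact h1 k x⟩
  set F : ℕ → Lp ℝ 2 ν := fun k => ((hfb k).memLp 2 ν).toLp (f k) with hF
  have hFnorm : ∀ k, ‖F k‖ ≤ 1 := fun k => by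
    have := Lp.norm_le_of_ae_bound (μ := ν) (p := 2) (f := F k) (C := 1) zero_le_one (by
      filter_upwards [((hfb k).memLp 2 ν).coeFn_toLp] with x hx
      rw [hF, hx, Real.norm_of_nonneg (h0 k x)]; exact h1 k x)
    simpa [measureUnivNNReal] using this
  set T : ℕ → WeakDual ℝ (Lp ℝ 2 ν) := fun k =>
    StrongDual.toWeakDual (InnerProductSpace.toDual ℝ _ (F k)) with hT
  obtain ⟨L, -, hL⟩ := (WeakDual.isCompact_closedBall (𝕜 := ℝ) (E := Lp ℝ 2 ν)
    0 1).ultrafilter_le_nhds (U.map T) (by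
      simp only [le_principal_iff, Ultrafilter.mem_coe, Ultrafilter.mem_map]
      refine univ_mem' fun k => ?_
      simpa [hT] using hFnorm k)
  set G : Lp ℝ 2 ν := (InnerProductSpace.toDual ℝ _).symm (WeakDual.toStrongDual L) with hG
  have hlim : ∀ u : α → ℝ, IsBddMeas u →
      Tendsto (fun k => ∫ x, f k x * u x ∂ν) U (𝓝 (∫ x, G x * u x ∂ν)) := by
    intro u hu
    have hev := ((WeakDual.eval_continuous ((hu.memLp 2 ν).toLp u)).tendsto L).comp
      (show Tendsto T U (𝓝 L) from hL)
    convert hev using 2 with k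
    · simp only [hT, Function.comp]
      change _ = (InnerProductSpace.toDual ℝ _ (F k)) _
      rw [InnerProductSpace.toDual_apply_apply, L2.inner_def]
      refine integral_congr_ae ?_
      filter_upwards [((hfb k).memLp 2 ν).coeFn_toLp, (hu.memLp 2 ν).coeFn_toLp] with x h1 h2
      rw [hF, h1, h2]; simp [mul_comm]
    · change _ = (WeakDual.toStrongDual L) _
      rw [← InnerProductSpace.toDual_symm_apply, L2.inner_def]
      refine integral_congr_ae ?_
      filter_upwards [(hu.memLp 2 ν).coeFn_toLp] with x h2
      rw [h2]; simp [hG, mul_comm]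
  have hGint : Integrable G ν := (Lp.memLp G).integrable (by norm_num)
  have hset : ∀ s, MeasurableSet s →
      Tendsto (fun k => ∫ x in s, f k x ∂ν) U (𝓝 (∫ x in s, G x ∂ν)) := by
    intro s hs
    have e : ∀ g : α → ℝ, ∫ x, g x * s.indicator (fun _ => (1 : ℝ)) x ∂ν = ∫ x in s, g x ∂ν := by
      intro g
      rw [← integral_indicator hs]
      congr 1 with x
      by_cases hx : x ∈ s <;> simp [hx]
    simpa only [e] using hlim _ (IsBddMeas.indicator_one hs)
  have hG0 : 0 ≤ᵐ[ν] G := ae_nonneg_of_forall_setIntegral_nonneg hGint fun s hs _ =>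
    ge_of_tendsto' (hset s hs) fun k => integral_nonneg (h0 k)
  have hG1 : G ≤ᵐ[ν] fun _ => 1 :=
    ae_le_of_forall_setIntegral_le hGint (integrable_const _) fun s hs _ =>
      le_of_tendsto' (hset s hs) fun k =>
        integral_mono ((hfb k).integrable _) (integrable_const _) (h1 k)
  refine ⟨fun x => max 0 (min 1 (G x)), ?_, fun x => le_max_left _ _,
    fun x => max_le zero_le_one (min_le_left _ _), fun u hu => ?_⟩
  · exact measurable_const.max (measurable_const.min (Lp.stronglyMeasurable G).measurable)
  · convert hlim u hu using 2
    refine integral_congr_ae ?_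
    filter_upwards [hG0, hG1] with x a b
    rw [min_eq_right b, max_eq_right (show (0 : ℝ) ≤ G x from a)]

/-- Weak lower semicontinuity of the energy of a positive semidefinite kernel. -/
lemma IsPosSemidefKernel.energy_le_of_tendsto {K : α × α → ℝ} (hK : IsBddMeas K)
    (hsymm : ∀ z : α × α, K z.swap = K z) (hpos : IsPosSemidefKernel ν K)
    {f : ℕ → α → ℝ} (hf : ∀ k, IsBddMeas (f k)) {φ : α → ℝ} (hφ : IsBddMeas φ)
    {l : Filter ℕ} [l.NeBot]
    (hlim : ∀ u : α → ℝ, IsBddMeas u →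
        Tendsto (fun k => ∫ x, f k x * u x ∂ν) l (𝓝 (∫ x, φ x * u x ∂ν)))
    {B : ℝ} (hB : ∀ᶠ k in l, ∫ z, K z * (f k z.1 * f k z.2) ∂(ν.prod ν) ≤ B) :
    ∫ z, K z * (φ z.1 * φ z.2) ∂(ν.prod ν) ≤ B := by
  have hu : IsBddMeas (fun x => ∫ y, K (x, y) * φ y ∂ν) :=
    (hK.mul (hφ.comp measurable_snd)).integral_right ν
  have hcross : ∀ g : α → ℝ, IsBddMeas g → ∫ z, K z * (g z.1 * φ z.2) ∂(ν.prod ν) =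
      ∫ x, g x * ∫ y, K (x, y) * φ y ∂ν ∂ν := by
    intro g hg
    rw [integral_prod _ ((hK.quadratic_integrand hg hφ).integrable _)]
    simp only [← integral_const_mul, mul_left_comm]
  have hflip : ∀ g : α → ℝ, ∫ z, K z * (φ z.1 * g z.2) ∂(ν.prod ν) =
      ∫ z, K z * (g z.1 * φ z.2) ∂(ν.prod ν) := by
    intro g
    rw [← integral_prod_swap]
    simp only [hsymm, Prod.fst_swap, Prod.snd_swap, mul_comm (φ _)]
  have key : ∀ k, 2 * (∫ x, f k x * ∫ y, K (x, y) * φ y ∂ν ∂ν) -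
      ∫ z, K z * (φ z.1 * φ z.2) ∂(ν.prod ν) ≤
      ∫ z, K z * (f k z.1 * f k z.2) ∂(ν.prod ν) := by
    intro k
    have h := hpos _ ((hf k).sub hφ)
    have i1 := (hK.quadratic_integrand (hf k) (hf k)).integrable (ν.prod ν)
    have i2 := (hK.quadratic_integrand (hf k) hφ).integrable (ν.prod ν)
    have i3 := (hK.quadratic_integrand hφ (hf k)).integrable (ν.prod ν)
    have i4 := (hK.quadratic_integrand hφ hφ).integrable (ν.prod ν)
    have e : ∀ z : α × α, K z * ((f k z.1 - φ z.1) * (f k z.2 - φ z.2)) =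
        K z * (f k z.1 * f k z.2) - K z * (f k z.1 * φ z.2) - K z * (φ z.1 * f k z.2) +
          K z * (φ z.1 * φ z.2) := fun z => by ring
    simp only [e] at h
    rw [integral_add (by exact (i1.sub i2).sub i3) i4, integral_sub (by exact i1.sub i2) i3, integral_sub i1 i2,
      hflip, hcross _ (hf k)] at h
    linarith
  have hlim' := ((hlim _ hu).const_mul 2).sub_const (∫ z, K z * (φ z.1 * φ z.2) ∂(ν.prod ν))
  have := le_of_tendsto hlim' (hB.mono fun k hk => (key k).trans hk)
  rw [← hcross _ hφ] at this
  linarith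

end BoundedMeasurable

section Avoidance

variable {μ : Measure ℝ} {r : ℕ → ℝ} {C : Set ℝ} {c : ℝ}

/-- The centred and normalised indicator that `ω` avoids the ball `B(x, r_n)`, for `x ∈ C`. -/
def avoidance (μ : Measure ℝ) (r : ℕ → ℝ) (C : Set ℝ) (n : ℕ) : ℝ × ℝ → ℝ :=
  {w | w.1 ∈ C}.indicator fun w =>
    {w : ℝ × ℝ | dist w.2 w.1 < r n}ᶜ.indicator (fun _ => (1 : ℝ)) w /
      (1 - (μ (ball w.1 (r n))).toReal) - 1

lemma isBddMeas_avoidance [IsProbabilityMeasure μ] (hC : MeasurableSet C) (hc : c < 1)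
    (hball : ∀ x ∈ C, ∀ n, (μ (ball x (r n))).toReal ≤ c) (n : ℕ) :
    IsBddMeas (avoidance μ r C n) := by
  have hS : MeasurableSet {w : ℝ × ℝ | dist w.2 w.1 < r n} :=
    measurableSet_lt (by fun_prop) measurable_const
  refine ⟨Measurable.indicator ?_ (measurable_fst hC), 1 / (1 - c) + 1, fun w => ?_⟩
  · have hm : Measurable fun x => (μ (ball x (r n))).toReal :=
      (measurable_measure_prodMk_left (ν := μ) hS).ennreal_toReal
    exact ((measurable_const.indicator hS.compl).div
      (measurable_const.sub (hm.comp measurable_fst))).sub measurable_const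
  · have hc' : 0 < 1 - c := sub_pos.2 hc
    by_cases hw : w.1 ∈ C
    · have hb := hball _ hw n
      rw [avoidance, indicator_of_mem (show w ∈ {w : ℝ × ℝ | w.1 ∈ C} from hw)]
      refine (abs_sub _ _).trans ?_
      rw [abs_one, abs_div, abs_of_pos (show 0 < 1 - (μ (ball w.1 (r n))).toReal by linarith)]
      gcongr
      by_cases h : w ∈ {w : ℝ × ℝ | dist w.2 w.1 < r n}ᶜ <;> simp [h]
    · rw [avoidance, indicator_of_notMem (show w ∉ {w : ℝ × ℝ | w.1 ∈ C} from hw), abs_zero]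
      positivity

lemma one_sub_measure_union [IsProbabilityMeasure μ] (x y ρ : ℝ) :
    1 - (μ (ball x ρ)).toReal - (μ (ball y ρ)).toReal + (μ (ball x ρ ∩ ball y ρ)).toReal =
      μ.real ((ball x ρ)ᶜ ∩ (ball y ρ)ᶜ) := by
  rw [← compl_union, probReal_compl_eq_one_sub (measurableSet_ball.union measurableSet_ball)]
  have := measureReal_union_add_inter (μ := μ) (s := ball x ρ) (t := ball y ρ) measurableSet_ball
  simp only [measureReal_def] at *
  linarith

/-- On `C × C` each factor of `p_k` is one plus the Gram kernel of the avoidance feature. -/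
lemma one_add_gramKernel_avoidance [IsProbabilityMeasure μ] (hc : c < 1)
    (hball : ∀ x ∈ C, ∀ n, (μ (ball x (r n))).toReal ≤ c) (n : ℕ) {x y : ℝ}
    (hx : x ∈ C) (hy : y ∈ C) :
    1 + gramKernel μ (avoidance μ r C n) (x, y) =
      (1 - (μ (ball x (r n))).toReal - (μ (ball y (r n))).toReal +
        (μ (ball x (r n) ∩ ball y (r n))).toReal) /
      ((1 - (μ (ball x (r n))).toReal) * (1 - (μ (ball y (r n))).toReal)) := by
  rw [one_sub_measure_union]
  have hs : 0 < 1 - (μ (ball x (r n))).toReal := by linarith [hball x hx n]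
  have ht : 0 < 1 - (μ (ball y (r n))).toReal := by linarith [hball y hy n]
  set s := 1 - (μ (ball x (r n))).toReal with hsdef
  set t := 1 - (μ (ball y (r n))).toReal with htdef
  have hval : ∀ z ∈ C, ∀ ω, avoidance μ r C n (z, ω) =
      (ball z (r n))ᶜ.indicator (fun _ => (1 : ℝ)) ω / (1 - (μ (ball z (r n))).toReal) - 1 := by
    intro z hz ω
    rw [avoidance, indicator_of_mem (show (z, ω) ∈ {w : ℝ × ℝ | w.1 ∈ C} from hz)]
    rfl
  have hexp : ∀ ω, avoidance μ r C n (x, ω) * avoidance μ r C n (y, ω) =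
      ((ball x (r n))ᶜ ∩ (ball y (r n))ᶜ).indicator (fun _ => (s * t)⁻¹) ω
        - (ball x (r n))ᶜ.indicator (fun _ => s⁻¹) ω
        - (ball y (r n))ᶜ.indicator (fun _ => t⁻¹) ω + 1 := by
    intro ω
    rw [hval x hx, hval y hy, ← hsdef, ← htdef]
    by_cases h1 : ω ∈ (ball x (r n))ᶜ <;> by_cases h2 : ω ∈ (ball y (r n))ᶜ <;>
      simp only [indicator, mem_inter_iff, h1, h2, and_self, and_false, false_and, if_true,
        if_false] <;> field_simp <;> ring
  have hmx : MeasurableSet (ball x (r n))ᶜ := measurableSet_ball.compl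
  have hmy : MeasurableSet (ball y (r n))ᶜ := measurableSet_ball.compl
  have i1 : Integrable (((ball x (r n))ᶜ ∩ (ball y (r n))ᶜ).indicator
    fun _ => (s * t)⁻¹) μ := (integrable_const _).indicator (hmx.inter hmy)
  have i2 : Integrable ((ball x (r n))ᶜ.indicator fun _ => s⁻¹) μ :=
    (integrable_const _).indicator hmx
  have i3 : Integrable ((ball y (r n))ᶜ.indicator fun _ => t⁻¹) μ :=
    (integrable_const _).indicator hmy
  have hμx : μ.real (ball x (r n))ᶜ = s := probReal_compl_eq_one_sub measurableSet_ball
  have hμy : μ.real (ball y (r n))ᶜ = t := probReal_compl_eq_one_sub measurableSet_ball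
  have hgram : gramKernel μ (avoidance μ r C n) (x, y) =
      μ.real ((ball x (r n))ᶜ ∩ (ball y (r n))ᶜ) * (s * t)⁻¹ - 1 := by
    simp only [gramKernel, hexp]
    rw [integral_add (by exact (i1.sub i2).sub i3) (integrable_const _),
      integral_sub (by exact i1.sub i2) i3, integral_sub i1 i2,
      integral_indicator_const _ (hmx.inter hmy), integral_indicator_const _ hmx,
      integral_indicator_const _ hmy, hμx, hμy]
    simp [hs.ne', ht.ne']
  rw [hgram]
  ring

lemma pk_eq_productKernel [IsProbabilityMeasure μ] (hc : c < 1)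
    (hball : ∀ x ∈ C, ∀ n, (μ (ball x (r n))).toReal ≤ c) (k : ℕ) {x y : ℝ}
    (hx : x ∈ C) (hy : y ∈ C) :
    pk μ r k x y = productKernel μ (avoidance μ r C) k (x, y) :=
  Finset.prod_congr rfl fun n _ => (one_add_gramKernel_avoidance hc hball n hx hy).symm

lemma pk_nonneg [IsProbabilityMeasure μ] (k : ℕ) (x y : ℝ) : 0 ≤ pk μ r k x y := by
  refine Finset.prod_nonneg fun n _ => ?_
  have hle : ∀ z, (μ (ball z (r n))).toReal ≤ 1 := fun z => measureReal_le_one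
  rw [one_sub_measure_union]
  exact div_nonneg measureReal_nonneg (mul_nonneg (sub_nonneg.2 (hle x)) (sub_nonneg.2 (hle y)))

end Avoidance

lemma msupport_eq_support (ν : Measure ℝ) : msupport ν = ν.support := by
  rw [Measure.support_eq_forall_isOpen]
  ext x
  exact forall_congr' fun U => forall_comm

lemma Jk_withDensity {μ : Measure ℝ} {r : ℕ → ℝ} {ν : Measure ℝ} [IsProbabilityMeasure ν]
    {K : ℝ × ℝ → ℝ} (hK : IsBddMeas K) {k : ℕ}
    (hpk : ∀ᵐ x ∂ν, ∀ᵐ y ∂ν, pk μ r k x y = K (x, y))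
    {g : ℝ → ℝ} (hg : IsBddMeas g) (hg0 : ∀ x, 0 ≤ g x) :
    Jk μ r (ν.withDensity fun x => ENNReal.ofReal (g x)) k =
      ∫ z, K z * (g z.1 * g z.2) ∂(ν.prod ν) := by
  have hd : ∀ u : ℝ → ℝ, ∫ x, u x ∂(ν.withDensity fun x => ENNReal.ofReal (g x)) =
      ∫ x, g x * u x ∂ν := by
    intro u
    rw [integral_withDensity_eq_integral_toReal_smul hg.measurable.ennreal_ofReal
      (Eventually.of_forall fun _ => ENNReal.ofReal_lt_top)]
    simp [ENNReal.toReal_ofReal (hg0 _)]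
  rw [Jk, hd, integral_prod _ ((hK.quadratic_integrand hg hg).integrable _)]
  refine integral_congr_ae ?_
  filter_upwards [hpk] with x hx
  simp only [hd]
  rw [← integral_const_mul]
  refine integral_congr_ae ?_
  filter_upwards [hx] with y hy
  rw [hy]
  ring

/-- If the densities `1_{D_k}` have `k`-th energy at most `M` and do not lose all their mass, some
probability measure absolutely continuous with respect to `ν` has bounded energies. -/
lemma exists_density_of_energy_le {μ ν : Measure ℝ} [IsProbabilityMeasure μ]
    [IsProbabilityMeasure ν] {h : ℕ → ℝ × ℝ → ℝ} (hh : ∀ n, IsBddMeas (h n))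
    {D : ℕ → Set ℝ} (hD : ∀ k, MeasurableSet (D k)) {M ε : ℝ} (hε : 0 < ε)
    (hfreq : ∃ᶠ k in atTop, ε ≤ ν.real (D k))
    (henergy : ∀ k, ∫ z, productKernel μ h k z * ((D k).indicator (fun _ => 1) z.1 *
      (D k).indicator (fun _ => 1) z.2) ∂(ν.prod ν) ≤ M) :
    ∃ g : ℝ → ℝ, IsBddMeas g ∧ (∀ x, 0 ≤ g x) ∧ ∫ x, g x ∂ν = 1 ∧
      ∃ B, ∀ j, ∫ z, productKernel μ h j z * (g z.1 * g z.2) ∂(ν.prod ν) ≤ B := by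
  have hne : (atTop ⊓ 𝓟 {k | ε ≤ ν.real (D k)}).NeBot := frequently_mem_iff_neBot.1 hfreq
  set U := Ultrafilter.of (atTop ⊓ 𝓟 {k | ε ≤ ν.real (D k)})
  have hU := Ultrafilter.of_le (atTop ⊓ 𝓟 {k | ε ≤ ν.real (D k)})
  have hfb : ∀ k, IsBddMeas ((D k).indicator (fun _ => (1 : ℝ))) := fun k =>
    IsBddMeas.indicator_one (hD k)
  obtain ⟨φ, hφm, hφ0, hφ1, hφlim⟩ := exists_weak_limit_density (ν := ν)
    (f := fun k => (D k).indicator (fun _ => (1 : ℝ))) (fun k => (hfb k).measurable)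
    (fun k x => indicator_nonneg (fun _ _ => zero_le_one) x)
    (fun k x => indicator_le_self' (fun _ _ => zero_le_one) x) U
  have hφ : IsBddMeas φ := ⟨hφm, 1, fun x => by rw [abs_of_nonneg (hφ0 x)]; exact hφ1 x⟩
  set m := ∫ x, φ x ∂ν with hm
  have hεm : ε ≤ m := by
    have hlim1 := hφlim _ (IsBddMeas.const 1)
    simp only [mul_one] at hlim1
    refine ge_of_tendsto hlim1 (hU ?_)
    filter_upwards [mem_inf_of_right (mem_principal_self _)] with k hk
    simpa [integral_indicator_const _ (hD k)] using hk
  have hmpos : 0 < m := hε.trans_le hεm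
  have hφenergy : ∀ j, ∫ z, productKernel μ h j z * (φ z.1 * φ z.2) ∂(ν.prod ν) ≤ M := by
    intro j
    refine (isPosSemidefKernel_productKernel hh j).energy_le_of_tendsto
      (isBddMeas_productKernel hh j) (productKernel_swap j) hfb hφ hφlim (hU ?_)
    filter_upwards [mem_inf_of_left (eventually_ge_atTop j)] with k hk
    exact (monotone_energy_productKernel hh (hfb k) hk).trans (henergy k)
  refine ⟨fun x => m⁻¹ * φ x, (IsBddMeas.const _).mul hφ,
    fun x => mul_nonneg (inv_nonneg.2 hmpos.le) (hφ0 x), ?_, m⁻¹ * m⁻¹ * M, fun j => ?_⟩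
  · rw [integral_const_mul, ← hm, inv_mul_cancel₀ hmpos.ne']
  · have e : ∀ z : ℝ × ℝ, productKernel μ h j z * (m⁻¹ * φ z.1 * (m⁻¹ * φ z.2)) =
        m⁻¹ * m⁻¹ * (productKernel μ h j z * (φ z.1 * φ z.2)) := fun z => by ring
    simp only [e]
    rw [integral_const_mul]
    exact mul_le_mul_of_nonneg_left (hφenergy j) (by positivity)

/-- The energy of `ν` restricted to a sublevel set of its potential. -/
lemma energy_sublevel_le {α : Type*} [MeasurableSpace α] {ν : Measure α} [IsProbabilityMeasure ν]
    {K : α × α → ℝ} (hK : IsBddMeas K) {D : Set α} (hD : MeasurableSet D) {M : ℝ} (hM : 0 ≤ M)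
    (hnonneg : ∀ x ∈ D, ∀ᵐ y ∂ν, 0 ≤ K (x, y)) (hDM : ∀ x ∈ D, ∫ y, K (x, y) ∂ν ≤ M) :
    ∫ z, K z * (D.indicator (fun _ => 1) z.1 * D.indicator (fun _ => 1) z.2) ∂(ν.prod ν) ≤ M := by
  have hf := IsBddMeas.indicator_one hD
  have hq := hK.quadratic_integrand hf hf
  rw [integral_prod _ (hq.integrable _)]
  have hle : ∀ x, ∫ y, K (x, y) * (D.indicator (fun _ => 1) x * D.indicator (fun _ => 1) y) ∂ν
      ≤ M := by
    intro x
    by_cases hx : x ∈ D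
    · refine le_trans (integral_mono_ae ?_ ?_ ?_) (hDM x hx)
      · exact (hq.comp (φ := fun y => (x, y)) (by fun_prop)).integrable ν
      · exact (hK.comp (φ := fun y => (x, y)) (by fun_prop)).integrable ν
      · filter_upwards [hnonneg x hx] with y hy
        by_cases hyD : y ∈ D <;> simp [hx, hyD, hy]
    · simpa [hx] using hM
  simpa using integral_mono ((hq.integral_right ν).integrable ν) (integrable_const M) hle

/-- If `J(ν) = ∞` (equivalently the increasing sequence `(J_k(ν))_k` is unbounded) for every
probability measure compactly supported on the analytic set `A ⊆ supp μ`, then for every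
probability measure `ν` on a compact `C ⊆ A ∩ X₀` the potentials `∫ p_k(x,·) dν` blow up
in `ν`-measure. -/
theorem potential_blowup_of_infinite_energy
    (μ : Measure ℝ) [IsProbabilityMeasure μ]
    (r : ℕ → ℝ) (hmono : Antitone r) (hpos : ∀ n, 0 < r n)
    (hlim : Tendsto r atTop (𝓝 0))
    (hsmall : (⨆ x ∈ msupport μ, μ (ball x (r 0))) < 1)
    (A : Set ℝ) (hA : MeasureTheory.AnalyticSet A) (hAX : A ⊆ msupport μ)
    (hJ : ∀ ν : Measure ℝ, IsProbabilityMeasure ν →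
      IsCompact (msupport ν) → msupport ν ⊆ A →
      ∀ C : ℝ, ∃ k : ℕ, C < Jk μ r ν k)
    (C : Set ℝ) (hCc : IsCompact C) (hCA : C ⊆ A ∩ X₀ μ r)
    (ν : Measure ℝ) (hν : IsProbabilityMeasure ν) (hνC : msupport ν ⊆ C)
    (M : ℝ) (hM : 0 < M) :
    Tendsto (fun k : ℕ => ν {x ∈ C | M ≤ ∫ y, pk μ r k x y ∂ν})
      atTop (𝓝 1) := by
  obtain ⟨c, hc, hball⟩ : ∃ c : ℝ, c < 1 ∧ ∀ x ∈ C, ∀ n, (μ (ball x (r n))).toReal ≤ c := by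
    refine ⟨(⨆ x ∈ msupport μ, μ (ball x (r 0))).toReal, ?_, fun x hx n => ?_⟩
    · simpa using (ENNReal.toReal_lt_toReal hsmall.ne_top ENNReal.one_ne_top).2 hsmall
    · exact ENNReal.toReal_mono hsmall.ne_top ((measure_mono (ball_subset_ball
        (hmono (Nat.zero_le n)))).trans
          (le_iSup₂ (f := fun x _ => μ (ball x (r 0))) x (hAX (hCA hx).1)))
  have hCm : MeasurableSet C := hCc.measurableSet
  have hCae : ∀ᵐ x ∂ν, x ∈ C := by
    rw [msupport_eq_support] at hνC
    exact mem_of_superset Measure.support_mem_ae hνC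
  have hh : ∀ n, IsBddMeas (avoidance μ r C n) := isBddMeas_avoidance hCm hc hball
  set K : ℕ → ℝ × ℝ → ℝ := productKernel μ (avoidance μ r C)
  have hK : ∀ k, IsBddMeas (K k) := isBddMeas_productKernel hh
  have hpk : ∀ k, ∀ x ∈ C, ∀ᵐ y ∂ν, pk μ r k x y = K k (x, y) := fun k x hx =>
    hCae.mono fun y hy => pk_eq_productKernel hc hball k hx hy
  have hset : ∀ k, {x ∈ C | M ≤ ∫ y, pk μ r k x y ∂ν} = {x ∈ C | M ≤ ∫ y, K k (x, y) ∂ν} :=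
    fun k => sep_ext_iff.2 fun x hx => by rw [integral_congr_ae (hpk k x hx)]
  set D : ℕ → Set ℝ := fun k => {x ∈ C | ∫ y, K k (x, y) ∂ν < M}
  have hD : ∀ k, MeasurableSet (D k) := fun k =>
    hCm.inter (measurableSet_lt ((hK k).integral_right ν).measurable measurable_const)
  have hcompl : ∀ k, ν {x ∈ C | M ≤ ∫ y, pk μ r k x y ∂ν} = 1 - ν (D k) := by
    intro k
    rw [hset, ← prob_compl_eq_one_sub (hD k)]
    refine measure_congr ?_
    filter_upwards [hCae] with x hx
    refine propext ?_
    change (x ∈ C ∧ M ≤ _) ↔ ¬ (x ∈ C ∧ _ < M)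
    simp [hx]
  suffices hzero : Tendsto (fun k => ν.real (D k)) atTop (𝓝 0) by
    have h0 : Tendsto (fun k => ν (D k)) atTop (𝓝 0) :=
      (ENNReal.tendsto_toReal_iff (fun k => measure_ne_top ν _) ENNReal.zero_ne_top).1
        hzero
    simp only [hcompl]
    simpa using ENNReal.Tendsto.sub tendsto_const_nhds h0 (Or.inl ENNReal.one_ne_top)
  by_contra hnot
  obtain ⟨ε, hε, hfreq⟩ : ∃ ε > 0, ∃ᶠ k in atTop, ε ≤ ν.real (D k) := by
    by_contra! hcon
    refine hnot (tendsto_order.2 ⟨fun a ha => Eventually.of_forall fun k =>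
      ha.trans_le measureReal_nonneg, fun a ha => ?_⟩)
    simpa using hcon a ha
  obtain ⟨g, hg, hg0, hg1, B, hB⟩ := exists_density_of_energy_le hh hD hε hfreq fun k =>
    energy_sublevel_le (hK k) (hD k) hM.le
      (fun x hx => (hpk k x hx.1).mono fun y hy => hy ▸ pk_nonneg k x y) fun x hx => hx.2.le
  have hsub : msupport (ν.withDensity fun x => ENNReal.ofReal (g x)) ⊆ C := by
    rw [msupport_eq_support] at hνC ⊢
    exact (withDensity_absolutelyContinuous ν _).support_mono.trans hνC
  obtain ⟨k, hk⟩ := hJ (ν.withDensity fun x => ENNReal.ofReal (g x))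
    ⟨by
      rw [withDensity_apply _ MeasurableSet.univ, Measure.restrict_univ,
        ← ofReal_integral_eq_lintegral_ofReal (hg.integrable ν) (Eventually.of_forall hg0), hg1,
        ENNReal.ofReal_one]⟩
    (hCc.of_isClosed_subset (by rw [msupport_eq_support]; exact Measure.isClosed_support) hsub)
    (hsub.trans fun x hx => (hCA hx).1) B
  rw [Jk_withDensity (hK k) (hCae.mono (hpk k)) hg hg0] at hk
  exact hk.not_ge (hB k)

end
end
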